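/- arXiv:2306.11262 — 3 statements merged into one kernel-verified Lean document; each statement's English description precedes it below -/
import Mathlib

section
/- A homomorphism ρ : ℤ² → SL(3,ℝ) is regular if and only if ρ(ℤ²) is a lattice in a minimal horospherical subgroup of SL(3,ℝ). Precisely: ρ is regular if and only if there exist g ∈ SL(3,ℝ) and vectors (a₁,b₁), (a₂,b₂) ∈ ℝ² that are linearly independent over ℝ such that either (i) g·ρ(1,0)·g⁻¹ = [[1,a₁,b₁],[0,1,0],[0,0,1]] and g·ρ(0,1)·g⁻¹ = [[1,a₂,b₂],[0,1,0],[0,0,1]], or (ii) g·ρ(1,0)·g⁻¹ = [[1,0,a₁],[0,1,b₁],[0,0,1]] and g·ρ(0,1)·g⁻¹ = [[1,0,a₂],[0,1,b₂],[0,0,1]]. -/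
open Filter

/-- Frobenius (entrywise ℓ²) norm of a 3×3 real matrix. -/
noncomputable def frobNorm (g : Matrix (Fin 3) (Fin 3) ℝ) : ℝ :=
  Real.sqrt (∑ i, ∑ j, (g i j) ^ 2)

/-- A sequence in SL(3,ℝ) is regular if ‖gₙ‖²/‖gₙ⁻¹‖ → ∞. -/
def IsRegularSeq (g : ℕ → Matrix.SpecialLinearGroup (Fin 3) ℝ) : Prop :=
  Tendsto (fun n => (frobNorm ↑(g n)) ^ 2 / frobNorm ↑((g n)⁻¹)) atTop atTop

/-- A homomorphism is regular if it sends every sequence of pairwise distinct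
elements to a regular sequence. -/
def IsRegularHom {Γ : Type*} [Group Γ]
    (ρ : Γ →* Matrix.SpecialLinearGroup (Fin 3) ℝ) : Prop :=
  ∀ γ : ℕ → Γ, Function.Injective γ → IsRegularSeq fun n => ρ (γ n)

open Matrix in
/-- squared norm -/
noncomputable def nsq (g : Matrix (Fin 3) (Fin 3) ℝ) : ℝ := ∑ i, ∑ j, (g i j) ^ 2

lemma nsq_nonneg (g : Matrix (Fin 3) (Fin 3) ℝ) : 0 ≤ nsq g := by
  unfold nsq; positivity

lemma nsq_expand (g : Matrix (Fin 3) (Fin 3) ℝ) : nsq g =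
    g 0 0 ^ 2 + g 0 1 ^ 2 + g 0 2 ^ 2 + (g 1 0 ^ 2 + g 1 1 ^ 2 + g 1 2 ^ 2)
    + (g 2 0 ^ 2 + g 2 1 ^ 2 + g 2 2 ^ 2) := by
  simp [nsq, Fin.sum_univ_three]

lemma entry_le_nsq (g : Matrix (Fin 3) (Fin 3) ℝ) (i j) : (g i j) ^ 2 ≤ nsq g := by
  unfold nsq
  have h1 : (g i j) ^ 2 ≤ ∑ j, (g i j) ^ 2 :=
    Finset.single_le_sum (f := fun j => (g i j)^2) (fun _ _ => sq_nonneg _) (Finset.mem_univ j)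
  have h2 : ∑ j, (g i j) ^ 2 ≤ ∑ i, ∑ j, (g i j) ^ 2 :=
    Finset.single_le_sum (f := fun i => ∑ j, (g i j)^2)
      (fun _ _ => Finset.sum_nonneg fun _ _ => sq_nonneg _) (Finset.mem_univ i)
  linarith

lemma nsq_eq_zero {g : Matrix (Fin 3) (Fin 3) ℝ} (h : nsq g = 0) : g = 0 := by
  ext i j
  have := entry_le_nsq g i j
  rw [h] at this
  simpa using pow_eq_zero_iff (two_ne_zero) |>.1 (le_antisymm this (sq_nonneg _))

lemma frob_sq (g : Matrix (Fin 3) (Fin 3) ℝ) : frobNorm g ^ 2 = nsq g :=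
  Real.sq_sqrt (nsq_nonneg g)

lemma nsq_mul (X Y : Matrix (Fin 3) (Fin 3) ℝ) : nsq (X * Y) ≤ nsq X * nsq Y := by
  unfold nsq
  have h : ∀ i j, ((X * Y) i j) ^ 2 ≤ (∑ k, X i k ^ 2) * ∑ k, Y k j ^ 2 := by
    intro i j
    rw [Matrix.mul_apply]
    exact Finset.sum_mul_sq_le_sq_mul_sq _ _ _
  calc _ ≤ ∑ i, ∑ j, (∑ k, X i k ^ 2) * ∑ k, Y k j ^ 2 :=
        Finset.sum_le_sum fun i _ => Finset.sum_le_sum fun j _ => h i j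
    _ = _ := by
      rw [Finset.sum_comm (f := fun k j => Y k j ^ 2), Finset.sum_mul_sum]

lemma nsq_smul (c : ℝ) (X : Matrix (Fin 3) (Fin 3) ℝ) : nsq (c • X) = c ^ 2 * nsq X := by
  simp only [nsq_expand, Matrix.smul_apply, smul_eq_mul]; ring

lemma SL_ne_zero (g : Matrix.SpecialLinearGroup (Fin 3) ℝ) :
    0 < nsq (g : Matrix (Fin 3) (Fin 3) ℝ) := by
  rcases (nsq_nonneg (g : Matrix (Fin 3) (Fin 3) ℝ)).lt_or_eq with h | h
  · exact h
  · have h1 := g.det_coe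
    rw [nsq_eq_zero h.symm, Matrix.det_zero] at h1
    norm_num at h1

lemma nsq_continuous : Continuous nsq := by
  unfold nsq; fun_prop

def Reg (ρ : Multiplicative (ℤ × ℤ) →* Matrix.SpecialLinearGroup (Fin 3) ℝ) : Prop :=
  ∀ C : ℝ, 0 < C → {γ | nsq (ρ γ : Matrix (Fin 3) (Fin 3) ℝ) ^ 2
    ≤ C * nsq (((ρ γ)⁻¹ : Matrix.SpecialLinearGroup (Fin 3) ℝ) : Matrix (Fin 3) (Fin 3) ℝ)}.Finite

lemma ratio_le_iff (g : Matrix.SpecialLinearGroup (Fin 3) ℝ) (C : ℝ) (hC : 0 < C) :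
    frobNorm ↑g ^ 2 / frobNorm ↑(g⁻¹) ≤ C ↔
    nsq (g : Matrix (Fin 3) (Fin 3) ℝ) ^ 2 ≤ C ^ 2 * nsq ((g⁻¹ : Matrix.SpecialLinearGroup (Fin 3) ℝ) : Matrix (Fin 3) (Fin 3) ℝ) := by
  have h1 : 0 < frobNorm ↑(g⁻¹) := Real.sqrt_pos.2 (SL_ne_zero _)
  rw [div_le_iff₀ h1, frob_sq, ← frob_sq ↑(g⁻¹), ← mul_pow]
  have := nsq_nonneg (g : Matrix (Fin 3) (Fin 3) ℝ)
  exact (pow_le_pow_iff_left₀ this (by positivity) two_ne_zero).symm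

lemma regular_iff_reg (ρ : Multiplicative (ℤ × ℤ) →* Matrix.SpecialLinearGroup (Fin 3) ℝ) :
    IsRegularHom ρ ↔ Reg ρ := by
  constructor
  · intro h C hC
    by_contra hinf
    have hinf : Set.Infinite _ := hinf
    let e := hinf.natEmbedding
    have h1 := h (fun n => (e n).1) (fun a b hab => e.injective (Subtype.ext hab))
    have h2 := (h1.eventually (eventually_gt_atTop (Real.sqrt C))).exists
    obtain ⟨n, hn⟩ := h2
    have h3 := (e n).2
    simp only [Set.mem_ofPred_eq] at h3
    refine absurd ((ratio_le_iff _ _ (Real.sqrt_pos.2 hC)).2 ?_) (not_le.2 hn)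
    rw [Real.sq_sqrt hC.le]
    exact h3
  · intro h γ hγ
    have key : Tendsto (fun γ => (frobNorm ↑(ρ γ)) ^ 2 / frobNorm ↑((ρ γ)⁻¹)) cofinite atTop := by
      rw [tendsto_atTop]
      intro b
      refine (h (max b 1 ^ 2) (by positivity)).subset ?_
      intro x hx
      simp only [Set.mem_compl_iff, Set.mem_ofPred_eq, not_le] at hx ⊢
      refine (ratio_le_iff _ _ (by positivity)).1 ?_
      exact hx.le.trans (le_max_left _ _)
    have h2 := hγ.tendsto_cofinite
    rw [Nat.cofinite_eq_atTop] at h2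
    exact key.comp h2

/-- conjugated representation -/
noncomputable def conjRep (h : Matrix.SpecialLinearGroup (Fin 3) ℝ)
    (ρ : Multiplicative (ℤ × ℤ) →* Matrix.SpecialLinearGroup (Fin 3) ℝ) :
    Multiplicative (ℤ × ℤ) →* Matrix.SpecialLinearGroup (Fin 3) ℝ :=
  (MulAut.conj h).toMonoidHom.comp ρ

lemma conjRep_apply (h : Matrix.SpecialLinearGroup (Fin 3) ℝ)
    (ρ : Multiplicative (ℤ × ℤ) →* Matrix.SpecialLinearGroup (Fin 3) ℝ) (γ) :
    conjRep h ρ γ = h * ρ γ * h⁻¹ := rfl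

lemma nsq_conj (h g : Matrix.SpecialLinearGroup (Fin 3) ℝ) :
    nsq ((h * g * h⁻¹ : Matrix.SpecialLinearGroup (Fin 3) ℝ) : Matrix (Fin 3) (Fin 3) ℝ) ≤
      (nsq (h : Matrix (Fin 3) (Fin 3) ℝ) *
      nsq ((h⁻¹ : Matrix.SpecialLinearGroup (Fin 3) ℝ) : Matrix (Fin 3) (Fin 3) ℝ)) *
      nsq (g : Matrix (Fin 3) (Fin 3) ℝ) := by
  rw [Matrix.SpecialLinearGroup.coe_mul, Matrix.SpecialLinearGroup.coe_mul]
  refine (nsq_mul _ _).trans ?_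
  have := mul_le_mul_of_nonneg_right (nsq_mul (h : Matrix (Fin 3) (Fin 3) ℝ) g)
    (nsq_nonneg ((h⁻¹ : Matrix.SpecialLinearGroup (Fin 3) ℝ) : Matrix (Fin 3) (Fin 3) ℝ))
  linarith

lemma Reg.conj {ρ : Multiplicative (ℤ × ℤ) →* Matrix.SpecialLinearGroup (Fin 3) ℝ}
    (hρ : Reg ρ) (h : Matrix.SpecialLinearGroup (Fin 3) ℝ) : Reg (conjRep h ρ) := by
  intro C hC
  set k := nsq (h : Matrix (Fin 3) (Fin 3) ℝ) *
      nsq ((h⁻¹ : Matrix.SpecialLinearGroup (Fin 3) ℝ) : Matrix (Fin 3) (Fin 3) ℝ) with hk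
  have hkpos : 0 < k := mul_pos (SL_ne_zero _) (SL_ne_zero _)
  refine (hρ (k ^ 2 * C * k) (by positivity)).subset ?_
  intro γ hγ
  simp only [Set.mem_ofPred_eq, conjRep_apply] at hγ ⊢
  have h1 := nsq_conj h⁻¹ (h * ρ γ * h⁻¹)
  rw [inv_inv, show h⁻¹ * (h * ρ γ * h⁻¹) * h = ρ γ by group,
    mul_comm (nsq ((h⁻¹ : Matrix.SpecialLinearGroup (Fin 3) ℝ) : Matrix (Fin 3) (Fin 3) ℝ)), ← hk] at h1
  have h2 := nsq_conj h (ρ γ)⁻¹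
  rw [← hk, show h * (ρ γ)⁻¹ * h⁻¹ = (h * ρ γ * h⁻¹)⁻¹ by group] at h2
  have h3 := pow_le_pow_left₀ (nsq_nonneg _) h1 2
  calc _ ≤ _ := h3
    _ = k ^ 2 * nsq ((h * ρ γ * h⁻¹ : Matrix.SpecialLinearGroup (Fin 3) ℝ) : Matrix (Fin 3) (Fin 3) ℝ) ^ 2 := by ring
    _ ≤ k ^ 2 * (C * _) := by gcongr
    _ ≤ k ^ 2 * (C * (k * _)) := by gcongr
    _ = _ := by ring

lemma exists_cube (d : ℝ) (hd : d ≠ 0) : ∃ c : ℝ, c ≠ 0 ∧ c ^ 3 * d = 1 := by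
  have pos : ∀ d : ℝ, 0 < d → ∃ c : ℝ, c ≠ 0 ∧ c ^ 3 * d = 1 := by
    intro d hd
    refine ⟨(d⁻¹) ^ ((1:ℝ)/3), (Real.rpow_pos_of_pos (inv_pos.2 hd) _).ne', ?_⟩
    rw [← Real.rpow_natCast, ← Real.rpow_mul (inv_pos.2 hd).le]
    norm_num
    exact inv_mul_cancel₀ hd.ne'
  rcases hd.lt_or_gt with h | h
  · obtain ⟨c, hc, h1⟩ := pos (-d) (by linarith)
    exact ⟨-c, by simpa using hc, by rw [← h1]; ring⟩
  · exact pos d h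

lemma exists_conj (Q : Matrix (Fin 3) (Fin 3) ℝ) (hQ : Q.det ≠ 0) :
    ∃ h : Matrix.SpecialLinearGroup (Fin 3) ℝ, ∀ X : Matrix.SpecialLinearGroup (Fin 3) ℝ,
      Q * ((h * X * h⁻¹ : Matrix.SpecialLinearGroup (Fin 3) ℝ) : Matrix (Fin 3) (Fin 3) ℝ) = X * Q := by
  obtain ⟨c, hc, h1⟩ := exists_cube _ hQ
  let k : Matrix.SpecialLinearGroup (Fin 3) ℝ := ⟨c • Q, by rw [Matrix.det_smul]; simpa using h1⟩
  refine ⟨k⁻¹, fun X => ?_⟩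
  have h2 : k * (k⁻¹ * X * k⁻¹⁻¹) = X * k := by group
  have h3 := congrArg (fun g : Matrix.SpecialLinearGroup (Fin 3) ℝ => (g : Matrix (Fin 3) (Fin 3) ℝ)) h2
  simp only [Matrix.SpecialLinearGroup.coe_mul (n := Fin 3)] at h3
  have hkQ : (k : Matrix (Fin 3) (Fin 3) ℝ) = c • Q := rfl
  rw [Matrix.SpecialLinearGroup.coe_mul, Matrix.SpecialLinearGroup.coe_mul]
  rw [hkQ, Matrix.smul_mul, Matrix.mul_smul] at h3
  exact smul_right_injective _ hc h3

lemma conj_commute {ρ : Multiplicative (ℤ × ℤ) →* Matrix.SpecialLinearGroup (Fin 3) ℝ}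
    {P Q R : Matrix (Fin 3) (Fin 3) ℝ} (hQ : Q.det ≠ 0)
    (hP : ∀ γ, (ρ γ : Matrix (Fin 3) (Fin 3) ℝ) * P = P * ρ γ) (hPQ : P * Q = Q * R) :
    ∃ h : Matrix.SpecialLinearGroup (Fin 3) ℝ,
      ∀ γ, (conjRep h ρ γ : Matrix (Fin 3) (Fin 3) ℝ) * R = R * conjRep h ρ γ := by
  obtain ⟨h, hh⟩ := exists_conj Q hQ
  refine ⟨h, fun γ => ?_⟩
  have e := hh (ρ γ)
  rw [← conjRep_apply] at e
  have hu : IsUnit Q := (Matrix.isUnit_iff_isUnit_det _).2 (isUnit_iff_ne_zero.2 hQ)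
  apply hu.mul_right_injective
  show Q * (_ * R) = Q * (R * _)
  rw [← mul_assoc, e, mul_assoc, ← hPQ, ← mul_assoc, hP, mul_assoc, ← e, ← mul_assoc, hPQ, mul_assoc]

/-- limit argument -/
lemma exists_limit {ρ : Multiplicative (ℤ × ℤ) →* Matrix.SpecialLinearGroup (Fin 3) ℝ}
    (hρ : Reg ρ) : ∃ P : Matrix (Fin 3) (Fin 3) ℝ, P ≠ 0 ∧ P.adjugate = 0 ∧
      ∀ γ, (ρ γ : Matrix (Fin 3) (Fin 3) ℝ) * P = P * ρ γ := by
  let γ : ℕ → Multiplicative (ℤ × ℤ) := fun n => Multiplicative.ofAdd ((n : ℤ), 0)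
  have hγ : Function.Injective γ := by
    intro a b hab
    have : ((a : ℤ), (0:ℤ)) = ((b : ℤ), 0) := Multiplicative.ofAdd.injective hab
    simpa using this
  let c : ℕ → ℝ := fun n => (Real.sqrt (nsq (ρ (γ n) : Matrix (Fin 3) (Fin 3) ℝ)))⁻¹
  let G : ℕ → Matrix (Fin 3) (Fin 3) ℝ := fun n => c n • (ρ (γ n) : Matrix (Fin 3) (Fin 3) ℝ)
  have hc : ∀ n, (c n) ^ 2 * nsq (ρ (γ n) : Matrix (Fin 3) (Fin 3) ℝ) = 1 := by
    intro n
    have := SL_ne_zero (ρ (γ n))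
    simp only [c]
    rw [inv_pow, Real.sq_sqrt this.le, inv_mul_cancel₀ this.ne']
  have hG : ∀ n, nsq (G n) = 1 := fun n => by rw [nsq_smul, hc]
  let K : Set (Matrix (Fin 3) (Fin 3) ℝ) := Set.univ.pi fun _ => Set.univ.pi fun _ => Set.Icc (-1) 1
  have hK : IsCompact K := isCompact_univ_pi fun _ => isCompact_univ_pi fun _ => isCompact_Icc
  have hGK : ∀ n, G n ∈ K := by
    intro n i _ j _
    have := entry_le_nsq (G n) i j
    rw [hG] at this
    exact abs_le.1 ((sq_le_one_iff_abs_le_one _).1 this)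
  have : FirstCountableTopology (Matrix (Fin 3) (Fin 3) ℝ) :=
    inferInstanceAs (FirstCountableTopology (Fin 3 → Fin 3 → ℝ))
  obtain ⟨P, -, φ, hφ, hlim⟩ := hK.tendsto_subseq hGK
  refine ⟨P, ?_, ?_, ?_⟩
  · have h1 : nsq P = 1 := by
      refine tendsto_nhds_unique ((nsq_continuous.tendsto P).comp hlim) ?_
      refine tendsto_const_nhds.congr fun n => ?_
      exact (hG _).symm
    rintro rfl
    simp [nsq] at h1
  · have hcont : Continuous fun X : Matrix (Fin 3) (Fin 3) ℝ => nsq X.adjugate :=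
      nsq_continuous.comp (Continuous.matrix_adjugate continuous_id)
    have h1 : ∀ C : ℝ, 0 < C → C * nsq P.adjugate ≤ 1 := by
      intro C hC
      have ht := ((hcont.tendsto P).comp hlim).const_mul C
      refine le_of_tendsto ht ?_
      have hfin := hρ C hC
      have hev : ∀ᶠ n in atTop, γ (φ n) ∉ {γ | nsq (ρ γ : Matrix (Fin 3) (Fin 3) ℝ) ^ 2
          ≤ C * nsq (((ρ γ)⁻¹ : Matrix.SpecialLinearGroup (Fin 3) ℝ) : Matrix (Fin 3) (Fin 3) ℝ)} := by
        have h2 := (hγ.comp hφ.injective).tendsto_cofinite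
        rw [Nat.cofinite_eq_atTop] at h2
        exact h2.eventually hfin.eventually_cofinite_notMem
      filter_upwards [hev] with n hn
      simp only [not_le] at hn
      simp only [Function.comp, G, Matrix.adjugate_smul, nsq_smul]
      rw [Matrix.SpecialLinearGroup.coe_inv] at hn
      have h3 := hc (φ n)
      simp only [Fintype.card_fin]
      set N := nsq (ρ (γ (φ n)) : Matrix (Fin 3) (Fin 3) ℝ)
      set A := nsq (ρ (γ (φ n)) : Matrix (Fin 3) (Fin 3) ℝ).adjugate
      set d := c (φ n)
      have h4 : (d ^ (3 - 1)) ^ 2 * N ^ 2 = 1 := by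
        rw [show (d ^ (3 - 1)) ^ 2 * N ^ 2 = (d ^ 2 * N) ^ 2 by ring, h3]; norm_num
      nlinarith [mul_le_mul_of_nonneg_left hn.le (sq_nonneg (d ^ (3 - 1)))]
    apply nsq_eq_zero
    by_contra hne
    have hp := lt_of_le_of_ne (nsq_nonneg P.adjugate) (Ne.symm hne)
    have := h1 (2 / nsq P.adjugate) (by positivity)
    rw [div_mul_cancel₀ _ hne] at this
    norm_num at this
  · intro δ
    have hl : Tendsto (fun n => (ρ δ : Matrix (Fin 3) (Fin 3) ℝ) * G (φ n)) atTop (nhds (ρ δ * P)) :=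
      ((continuous_const.matrix_mul continuous_id).tendsto P).comp hlim
    have hr : Tendsto (fun n => G (φ n) * (ρ δ : Matrix (Fin 3) (Fin 3) ℝ)) atTop (nhds (P * ρ δ)) :=
      ((continuous_id.matrix_mul continuous_const).tendsto P).comp hlim
    refine tendsto_nhds_unique hl (hr.congr fun n => ?_)
    simp only [G, Matrix.smul_mul, Matrix.mul_smul]
    rw [← Matrix.SpecialLinearGroup.coe_mul, ← Matrix.SpecialLinearGroup.coe_mul, ← map_mul, ← map_mul, mul_comm]

lemma rank_one {P : Matrix (Fin 3) (Fin 3) ℝ} (h0 : P ≠ 0) (h : P.adjugate = 0) :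
    ∃ v φ : Fin 3 → ℝ, v ≠ 0 ∧ φ ≠ 0 ∧ P = Matrix.vecMulVec v φ := by
  have hm : ∀ i i' j j', P i j * P i' j' = P i j' * P i' j := by
    rw [Matrix.adjugate_fin_three] at h
    have e := fun i j => congrFun (congrFun h i) j
    have e00 := e 0 0
    have e01 := e 0 1
    have e02 := e 0 2
    have e10 := e 1 0
    have e11 := e 1 1
    have e12 := e 1 2
    have e20 := e 2 0
    have e21 := e 2 1
    have e22 := e 2 2
    simp at e00 e01 e02 e10 e11 e12 e20 e21 e22
    intro i i' j j'
    fin_cases i <;> fin_cases i' <;> fin_cases j <;> fin_cases j' <;> simp <;> linarith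
  have : ∃ i j, P i j ≠ 0 := by
    by_contra hh
    push Not at hh
    exact h0 (by ext i j; simp [hh])
  obtain ⟨i, j, hij⟩ := this
  refine ⟨fun a => P a j, fun b => P i b / P i j, fun hv => hij (congrFun hv i), fun hv => ?_, ?_⟩
  · have := congrFun hv j
    simp [hij] at this
  · ext a b
    rw [Matrix.vecMulVec_apply]
    field_simp
    rw [hm]

abbrev ZZ := Multiplicative (ℤ × ℤ)

def zz (m n : ℤ) : ZZ := Multiplicative.ofAdd (m, n)

lemma zz_surj (γ : ZZ) : ∃ m n, γ = zz m n := ⟨γ.toAdd.1, γ.toAdd.2, rfl⟩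

lemma zz_inj {m n m' n' : ℤ} (h : zz m n = zz m' n') : m = m' ∧ n = n' := by
  have : (m, n) = (m', n') := Multiplicative.ofAdd.injective h
  simpa using this

lemma zz_eq (m n : ℤ) : zz m n = zz 1 0 ^ m * zz 0 1 ^ n := by
  apply Multiplicative.toAdd.injective
  simp [zz]

def Additiv (f : ZZ → ℝ) : Prop := ∀ a b, f (a * b) = f a + f b

lemma Additiv.eq {f : ZZ → ℝ} (hf : Additiv f) (m n : ℤ) :
    f (zz m n) = m * f (zz 1 0) + n * f (zz 0 1) := by
  let F : ZZ →* Multiplicative ℝ := MonoidHom.mk' (fun x => Multiplicative.ofAdd (f x))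
    (fun a b => by rw [hf]; rfl)
  have h : F (zz m n) = F (zz 1 0) ^ m * F (zz 0 1) ^ n := by
    rw [zz_eq m n, map_mul, map_zpow, map_zpow]
  have h2 := congrArg Multiplicative.toAdd h
  simpa [F] using h2

lemma Additiv.inv {f : ZZ → ℝ} (hf : Additiv f) (a : ZZ) : f a⁻¹ = - f a := by
  have h1 := hf 1 1
  have h2 := hf a a⁻¹
  simp at h1 h2
  linarith

lemma Additiv.infinite {f : ZZ → ℝ} (hf : Additiv f) : ∃ C, {γ | |f γ| ≤ C}.Infinite := by
  set a := f (zz 1 0) with ha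
  set b := f (zz 0 1) with hb
  refine ⟨|a|, ?_⟩
  by_cases h0 : a = 0
  · refine Set.infinite_of_injective_forall_mem (f := fun k : ℕ => zz k 0) ?_ ?_
    · intro k l h
      exact_mod_cast (zz_inj h).1
    · intro k
      simp [hf.eq (k : ℤ) 0, ← ha, h0]
  · refine Set.infinite_of_injective_forall_mem (f := fun k : ℕ => zz (-⌊(k * b / a : ℝ)⌋) k) ?_ ?_
    · intro k l h
      exact_mod_cast (zz_inj h).2
    · intro k
      simp only [Set.mem_ofPred_eq]
      rw [hf.eq, ← ha, ← hb]
      have h1 : ((-⌊(k * b / a : ℝ)⌋ : ℤ) : ℝ) * a + ((k : ℤ) : ℝ) * b = a * Int.fract (k * b / a : ℝ) := by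
        rw [Int.fract]; push_cast; field_simp; ring
      rw [h1, abs_mul, Int.abs_fract]
      have := (Int.fract_lt_one (k * b / a : ℝ)).le
      nlinarith [abs_nonneg a]

lemma Additiv.infinite_half {f : ZZ → ℝ} (hf : Additiv f) (p : ZZ → Prop)
    (hp : ∀ γ, p γ ∨ p γ⁻¹) : ∃ C, {γ | |f γ| ≤ C ∧ p γ}.Infinite := by
  obtain ⟨C, hC⟩ := hf.infinite
  refine ⟨C, fun hfin => hC ?_⟩
  refine (hfin.union (hfin.image (fun x => x⁻¹))).subset ?_
  intro γ hγ
  rcases hp γ with h | h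
  · exact Or.inl ⟨hγ, h⟩
  · refine Or.inr ⟨γ⁻¹, ⟨?_, h⟩, by simp⟩
    rw [hf.inv, abs_neg]; exact hγ

lemma infinite_two {f g : ZZ → ℝ} (hf : Additiv f) (hg : Additiv g)
    (hD : f (zz 1 0) * g (zz 0 1) = f (zz 0 1) * g (zz 1 0)) :
    ∃ C, 0 < C ∧ {γ | |f γ| ≤ C ∧ |g γ| ≤ C}.Infinite := by
  have hall : ∀ a b, f a * g b = f b * g a := by
    intro a b
    obtain ⟨m, n, rfl⟩ := zz_surj a
    obtain ⟨m', n', rfl⟩ := zz_surj b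
    rw [hf.eq m n, hf.eq m' n', hg.eq m n, hg.eq m' n']
    linear_combination (m * n' - n * m' : ℝ) * hD
  by_cases h : ∃ a, f a ≠ 0
  · obtain ⟨a, ha⟩ := h
    obtain ⟨C, hC⟩ := hf.infinite
    refine ⟨|C| + |C| * |g a / f a| + 1, by positivity, hC.mono ?_⟩
    intro γ hγ
    have h1 : g γ = f γ * (g a / f a) := by
      field_simp; linarith [hall a γ]
    have h2 : |f γ| ≤ |C| := le_trans hγ (le_abs_self C)
    have h3 : 0 ≤ |C| * |g a / f a| := by positivity
    refine ⟨by linarith, ?_⟩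
    rw [h1, abs_mul]
    have := mul_le_mul_of_nonneg_right h2 (abs_nonneg (g a / f a))
    linarith [abs_nonneg C]
  · push Not at h
    obtain ⟨C, hC⟩ := hg.infinite
    refine ⟨|C| + 1, by positivity, hC.mono ?_⟩
    intro γ hγ
    have h2 : |g γ| ≤ |C| := le_trans hγ (le_abs_self C)
    exact ⟨by rw [h]; simp; positivity, by linarith⟩

/-- two-dimensional lemma -/
lemma two_dim (p q r s : ZZ → ℝ)
    (hp : ∀ x y, p (x * y) = p x * p y + q x * r y)
    (hq : ∀ x y, q (x * y) = p x * q y + q x * s y)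
    (hr : ∀ x y, r (x * y) = r x * p y + s x * r y)
    (hs : ∀ x y, s (x * y) = r x * q y + s x * s y)
    (hd : ∀ x, p x * s x - q x * r x ≠ 0) :
    ∃ f, Additiv f ∧ ∀ C, ∃ C', 0 < C' ∧ ∀ γ, |f γ| ≤ C →
      p γ ^ 2 + q γ ^ 2 + r γ ^ 2 + s γ ^ 2 ≤ C' * |p γ * s γ - q γ * r γ| := by
  -- common direction
  obtain ⟨t0, q0, r0, b, hN, hbt, hbq, hbr⟩ : ∃ (t0 q0 r0 : ℝ) (b : ZZ → ℝ),
      (t0 ≠ 0 ∨ q0 ≠ 0 ∨ r0 ≠ 0) ∧ (∀ x, p x - s x = 2 * (b x * t0)) ∧ (∀ x, q x = b x * q0) ∧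
      (∀ x, r x = b x * r0) := by
    have c1 : ∀ x y, q x * r y = q y * r x := by
      intro x y
      have h := hp x y
      rw [mul_comm x y, hp y x] at h
      linarith
    have c2 : ∀ x y, (p x - s x) * q y = (p y - s y) * q x := by
      intro x y
      have h := hq x y
      rw [mul_comm x y, hq y x] at h
      linarith
    have c3 : ∀ x y, (p x - s x) * r y = (p y - s y) * r x := by
      intro x y
      have h := hr x y
      rw [mul_comm x y, hr y x] at h
      linarith
    by_cases h1 : ∃ x, q x ≠ 0
    · obtain ⟨x0, h1⟩ := h1
      refine ⟨(p x0 - s x0) / 2, q x0, r x0, fun x => q x / q x0, Or.inr (Or.inl h1), ?_, ?_, ?_⟩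
      · intro x; have := c2 x x0; field_simp; linarith
      · intro x; field_simp
      · intro x; have := c1 x x0; field_simp; linarith
    by_cases h2 : ∃ x, r x ≠ 0
    · obtain ⟨x0, h2⟩ := h2
      refine ⟨(p x0 - s x0) / 2, q x0, r x0, fun x => r x / r x0, Or.inr (Or.inr h2), ?_, ?_, ?_⟩
      · intro x; have := c3 x x0; field_simp; linarith
      · intro x; have := c1 x x0; field_simp; linarith
      · intro x; field_simp
    push Not at h1 h2
    refine ⟨1, 0, 0, fun x => (p x - s x) / 2, Or.inl one_ne_zero, ?_, ?_, ?_⟩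
    · intro x; ring
    · intro x; simp [h1]
    · intro x; simp [h2]
  set δ := t0 ^ 2 + q0 * r0 with hδ
  set a : ZZ → ℝ := fun x => (p x + s x) / 2 with ha
  have hpa : ∀ x, p x = a x + b x * t0 := fun x => by simp only [ha]; linarith [hbt x]
  have hsa : ∀ x, s x = a x - b x * t0 := fun x => by simp only [ha]; linarith [hbt x]
  have hma : ∀ x y, a (x * y) = a x * a y + δ * (b x * b y) := by
    intro x y
    have h1 := hp x y
    have h2 := hs x y
    have h3 : a (x * y) = (p (x * y) + s (x * y)) / 2 := rfl
    rw [h3, h1, h2, hpa x, hpa y, hsa x, hsa y, hbq, hbq, hbr, hbr]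
    simp only [hδ]; ring
  have hmb : ∀ x y, b (x * y) = a x * b y + a y * b x := by
    intro x y
    have h1 := hp x y
    have h2 := hs x y
    have h3 := hq x y
    have h4 := hr x y
    have h5 := hbt (x * y)
    rw [h1, h2] at h5
    rw [hbq (x * y)] at h3
    rw [hbr (x * y)] at h4
    rw [hpa x, hpa y, hsa x, hsa y, hbq x, hbq y, hbr x, hbr y] at h5
    rw [hpa x, hsa y, hbq x, hbq y] at h3
    rw [hpa y, hsa x, hbr x, hbr y] at h4
    rcases hN with h | h | h
    · apply mul_right_cancel₀ h; linarith
    · apply mul_right_cancel₀ h; linarith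
    · apply mul_right_cancel₀ h; linarith
  have hdet : ∀ x, p x * s x - q x * r x = a x ^ 2 - δ * b x ^ 2 := by
    intro x; rw [hpa, hsa, hbq, hbr]; simp only [hδ]; ring
  have hnorm : ∀ x, p x ^ 2 + q x ^ 2 + r x ^ 2 + s x ^ 2 =
      2 * a x ^ 2 + (2 * t0 ^ 2 + q0 ^ 2 + r0 ^ 2) * b x ^ 2 := by
    intro x; rw [hpa, hsa, hbq, hbr]; ring
  set M := 2 * t0 ^ 2 + q0 ^ 2 + r0 ^ 2 with hM
  have hM0 : 0 ≤ M := by positivity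
  simp only [hdet] at hd
  suffices h : ∃ f, Additiv f ∧ ∀ C, ∃ C', 0 < C' ∧ ∀ γ, |f γ| ≤ C →
      a γ ^ 2 + b γ ^ 2 ≤ C' * |a γ ^ 2 - δ * b γ ^ 2| by
    obtain ⟨f, hf, h⟩ := h
    refine ⟨f, hf, fun C => ?_⟩
    obtain ⟨C', hC', h⟩ := h C
    refine ⟨(M + 2) * C', by positivity, fun γ hγ => ?_⟩
    rw [hnorm, hdet, mul_assoc]
    have h1 := mul_le_mul_of_nonneg_left (h γ hγ) (by positivity : 0 ≤ M + 2)
    nlinarith [sq_nonneg (a γ), sq_nonneg (b γ), mul_nonneg hM0 (sq_nonneg (a γ))]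
  rcases lt_trichotomy δ 0 with hneg | hzero | hpos
  · refine ⟨fun _ => 0, fun _ _ => by simp, fun C => ⟨1 + 1 / (-δ), ?_, fun γ _ => ?_⟩⟩
    · have : 0 < 1 / (-δ) := by apply div_pos one_pos; linarith
      linarith
    · rw [abs_of_nonneg (by nlinarith [sq_nonneg (a γ), sq_nonneg (b γ)])]
      have h0 : 0 < -δ := by linarith
      have h1 : 0 < 1 / (-δ) := div_pos one_pos h0
      have h2 : 1 / (-δ) * (a γ ^ 2 - δ * b γ ^ 2) = 1 / (-δ) * a γ ^ 2 + b γ ^ 2 := by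
        have hne := hneg.ne
        field_simp; ring
      rw [add_mul, h2]
      nlinarith [sq_nonneg (a γ), sq_nonneg (b γ), mul_nonneg h1.le (sq_nonneg (a γ)), mul_nonneg h0.le (sq_nonneg (b γ))]
  · rw [hzero] at hma hd ⊢
    have ha0 : ∀ x, a x ≠ 0 := fun x h => hd x (by rw [h]; ring)
    refine ⟨fun x => b x / a x, ?_, fun C => ⟨1 + C ^ 2, by positivity, fun γ hγ => ?_⟩⟩
    · intro x y
      have := ha0 x
      have := ha0 y
      simp only
      rw [hma, hmb]
      field_simp
      ring
    · have h1 : (b γ / a γ) ^ 2 ≤ C ^ 2 := sq_le_sq' (by linarith [(abs_le.1 hγ).1]) (abs_le.1 hγ).2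
      rw [div_pow, div_le_iff₀ (by have := ha0 γ; positivity)] at h1
      rw [zero_mul, sub_zero, abs_of_nonneg (sq_nonneg _)]
      linarith
  · set e := Real.sqrt δ with he
    have he2 : e ^ 2 = δ := Real.sq_sqrt hpos.le
    have hepos : 0 < e := Real.sqrt_pos.2 hpos
    set u : ZZ → ℝ := fun x => a x + e * b x with hu
    set w : ZZ → ℝ := fun x => a x - e * b x with hw
    have huw : ∀ x, u x * w x = a x ^ 2 - δ * b x ^ 2 := fun x => by
      simp only [hu, hw, ← he2]; ring
    have hu0 : ∀ x, u x ≠ 0 := fun x h => hd x (by rw [← huw, h, zero_mul])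
    have hw0 : ∀ x, w x ≠ 0 := fun x h => hd x (by rw [← huw, h, mul_zero])
    have hum : ∀ x y, u (x * y) = u x * u y := fun x y => by
      simp only [hu]; rw [hma, hmb, ← he2]; ring
    have hwm : ∀ x y, w (x * y) = w x * w y := fun x y => by
      simp only [hw]; rw [hma, hmb, ← he2]; ring
    refine ⟨fun x => Real.log (u x) - Real.log (w x), ?_, fun C =>
      ⟨(1 + 1 / e ^ 2) * Real.exp C, by positivity, fun γ hγ => ?_⟩⟩
    · intro x y
      simp only
      rw [hum, hwm, Real.log_mul (hu0 _) (hu0 _), Real.log_mul (hw0 _) (hw0 _)]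
      ring
    · have key : ∀ x y : ℝ, x ≠ 0 → y ≠ 0 → Real.log x - Real.log y ≤ C → x ^ 2 ≤ Real.exp C * |x * y| := by
        intro x y hx hy h
        have h1 : |x| ≤ Real.exp C * |y| := by
          rw [← Real.exp_log_eq_abs hx, ← Real.exp_log_eq_abs hy, ← Real.exp_add]
          exact Real.exp_le_exp.2 (by linarith)
        rw [abs_mul, ← sq_abs]
        nlinarith [abs_nonneg x]
      have h1 := key _ _ (hu0 γ) (hw0 γ) (abs_le.1 hγ).2
      have h2 := key _ _ (hw0 γ) (hu0 γ) (by linarith [(abs_le.1 hγ).1])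
      rw [mul_comm (w γ)] at h2
      rw [huw] at h1 h2
      set D := Real.exp C * |a γ ^ 2 - δ * b γ ^ 2|
      have e1 : a γ ^ 2 + e ^ 2 * b γ ^ 2 ≤ D := by
        simp only [hu, hw] at h1 h2; nlinarith
      have e2 : a γ ^ 2 ≤ D := by nlinarith [mul_nonneg (sq_nonneg e) (sq_nonneg (b γ))]
      have e3 : b γ ^ 2 ≤ 1 / e ^ 2 * D := by
        rw [div_mul_eq_mul_div, one_mul, le_div_iff₀ (by positivity)]
        nlinarith [sq_nonneg (a γ)]
      rw [mul_assoc]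
      change _ ≤ (1 + 1 / e ^ 2) * D
      linarith

local notation "Mat3" => Matrix (Fin 3) (Fin 3) ℝ
local notation "SL3" => Matrix.SpecialLinearGroup (Fin 3) ℝ

lemma Reg.false_of_infinite {ρ : ZZ →* SL3} (hρ : Reg ρ) {S : Set ZZ} (hS : S.Infinite) (C : ℝ)
    (hC : 0 < C) (h : ∀ γ ∈ S, nsq (ρ γ : Mat3) ^ 2 ≤ C * nsq (((ρ γ)⁻¹ : SL3) : Mat3)) : False :=
  hS ((hρ C hC).subset h)

lemma coe_map_mul (ρ : ZZ →* SL3) (x y : ZZ) (i j : Fin 3) : (ρ (x * y) : Mat3) i j =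
    (ρ x : Mat3) i 0 * (ρ y : Mat3) 0 j + (ρ x : Mat3) i 1 * (ρ y : Mat3) 1 j
      + (ρ x : Mat3) i 2 * (ρ y : Mat3) 2 j := by
  rw [map_mul, Matrix.SpecialLinearGroup.coe_mul, Matrix.mul_apply, Fin.sum_univ_three]

lemma inv_entry (g : SL3) : (((g)⁻¹ : SL3) : Mat3) = !![
    g 1 1 * g 2 2 - g 1 2 * g 2 1, -(g 0 1 * g 2 2) + g 0 2 * g 2 1, g 0 1 * g 1 2 - g 0 2 * g 1 1;
    -(g 1 0 * g 2 2) + g 1 2 * g 2 0, g 0 0 * g 2 2 - g 0 2 * g 2 0, -(g 0 0 * g 1 2) + g 0 2 * g 1 0;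
    g 1 0 * g 2 1 - g 1 1 * g 2 0, -(g 0 0 * g 2 1) + g 0 1 * g 2 0, g 0 0 * g 1 1 - g 0 1 * g 1 0] := by
  rw [Matrix.SpecialLinearGroup.coe_inv, Matrix.adjugate_fin_three]

lemma not_reg_block {ρ : ZZ →* SL3} (hρ : Reg ρ)
    (h01 : ∀ γ, (ρ γ : Mat3) 0 1 = 0) (h02 : ∀ γ, (ρ γ : Mat3) 0 2 = 0)
    (h10 : ∀ γ, (ρ γ : Mat3) 1 0 = 0) (h20 : ∀ γ, (ρ γ : Mat3) 2 0 = 0) : False := by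
  have hdet : ∀ γ, (ρ γ : Mat3) 0 0 * ((ρ γ : Mat3) 1 1 * (ρ γ : Mat3) 2 2 - (ρ γ : Mat3) 1 2 * (ρ γ : Mat3) 2 1) = 1 := by
    intro γ
    have := (ρ γ).det_coe
    rw [Matrix.det_fin_three, h01, h02, h10, h20] at this
    linarith
  obtain ⟨f, hf, hfC⟩ := two_dim (fun γ => (ρ γ : Mat3) 1 1) (fun γ => (ρ γ : Mat3) 1 2)
    (fun γ => (ρ γ : Mat3) 2 1) (fun γ => (ρ γ : Mat3) 2 2)
    (fun x y => by rw [coe_map_mul, h10]; ring)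
    (fun x y => by rw [coe_map_mul, h10]; ring)
    (fun x y => by rw [coe_map_mul, h20]; ring)
    (fun x y => by rw [coe_map_mul, h20]; ring)
    (fun x h => by have := hdet x; rw [h] at this; norm_num at this)
  obtain ⟨C, hC⟩ := hf.infinite_half (fun γ => |(ρ γ : Mat3) 0 0| ≤ 1) (by
    intro γ
    have h1 := coe_map_mul ρ γ γ⁻¹ 0 0
    rw [mul_inv_cancel, map_one, h01, h02] at h1
    simp only [Matrix.SpecialLinearGroup.coe_one, Matrix.one_apply_eq, zero_mul, add_zero] at h1
    by_contra hh
    push Not at hh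
    have h2 := congrArg abs h1
    rw [abs_one, abs_mul] at h2
    nlinarith [hh.1, hh.2])
  obtain ⟨C', hC', hb⟩ := hfC C
  refine hρ.false_of_infinite hC ((1 + C') ^ 2) (by positivity) ?_
  rintro γ ⟨hγ1, hγ2⟩
  have h1 := hb γ hγ1
  have h2 := hdet γ
  have h3 := entry_le_nsq (((ρ γ)⁻¹ : SL3) : Mat3) 0 0
  rw [inv_entry] at h3
  simp only [Matrix.of_apply, Matrix.cons_val_zero] at h3
  rw [← inv_entry] at h3
  set D := (ρ γ : Mat3) 1 1 * (ρ γ : Mat3) 2 2 - (ρ γ : Mat3) 1 2 * (ρ γ : Mat3) 2 1 with hD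
  set χ := (ρ γ : Mat3) 0 0
  have h4 : |χ| * |D| = 1 := by rw [← abs_mul, h2, abs_one]
  have h5 : 1 ≤ |D| := by nlinarith [abs_nonneg D]
  have h6 : nsq (ρ γ : Mat3) ≤ (1 + C') * |D| := by
    rw [nsq_expand, h01, h02, h10, h20]
    have : χ ^ 2 ≤ |D| := by rw [← sq_abs]; nlinarith [abs_nonneg χ]
    change χ ^ 2 + 0 ^ 2 + 0 ^ 2 + _ + _ ≤ _
    nlinarith
  calc nsq (ρ γ : Mat3) ^ 2 ≤ ((1 + C') * |D|) ^ 2 := pow_le_pow_left₀ (nsq_nonneg _) h6 2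
    _ = (1 + C') ^ 2 * D ^ 2 := by rw [mul_pow, sq_abs]
    _ ≤ _ := by gcongr

lemma not_reg_of_idem {ρ : ZZ →* SL3} (hρ : Reg ρ) (v φ : Fin 3 → ℝ)
    (hs : φ 0 * v 0 + φ 1 * v 1 + φ 2 * v 2 ≠ 0)
    (hP : ∀ γ, (ρ γ : Mat3) * Matrix.vecMulVec v φ = Matrix.vecMulVec v φ * ρ γ) : False := by
  obtain ⟨w0, w1, w2, hw, hwφ⟩ : ∃ w0 w1 w2 : ℝ, w0 ^ 2 + w1 ^ 2 + w2 ^ 2 ≠ 0 ∧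
      φ 0 * w0 + φ 1 * w1 + φ 2 * w2 = 0 := by
    by_cases h : φ 0 = 0
    · exact ⟨1, 0, 0, by norm_num, by simp [h]⟩
    · refine ⟨-φ 1, φ 0, 0, ?_, by ring⟩
      positivity
  set s := φ 0 * v 0 + φ 1 * v 1 + φ 2 * v 2 with hsdef
  let Q : Mat3 := !![v 0, w0, φ 1 * w2 - φ 2 * w1; v 1, w1, φ 2 * w0 - φ 0 * w2; v 2, w2, φ 0 * w1 - φ 1 * w0]
  let R : Mat3 := !![s, 0, 0; 0, 0, 0; 0, 0, 0]
  have hQ : Q.det ≠ 0 := by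
    have : Q.det = (w0 ^ 2 + w1 ^ 2 + w2 ^ 2) * s := by
      simp only [Q, Matrix.det_fin_three, Matrix.of_apply, Matrix.cons_val', Matrix.cons_val, hsdef]
      linear_combination (-(w0 * v 0 + w1 * v 1 + w2 * v 2)) * hwφ
    rw [this]
    exact mul_ne_zero hw hs
  have hPQ : Matrix.vecMulVec v φ * Q = Q * R := by
    have hz : φ 0 * (φ 1 * w2 - φ 2 * w1) + φ 1 * (φ 2 * w0 - φ 0 * w2) + φ 2 * (φ 0 * w1 - φ 1 * w0) = 0 := by ring
    ext i j
    rw [Matrix.mul_apply, Matrix.mul_apply, Fin.sum_univ_three, Fin.sum_univ_three]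
    simp only [Matrix.vecMulVec_apply]
    have : v i * φ 0 * Q 0 j + v i * φ 1 * Q 1 j + v i * φ 2 * Q 2 j =
      v i * (φ 0 * Q 0 j + φ 1 * Q 1 j + φ 2 * Q 2 j) := by ring
    rw [this]
    fin_cases j
    · simp [Q, R, ← hsdef]
      fin_cases i <;> simp
    · simp [Q, R, hwφ]
    · simp [Q, R]; right; ring
  obtain ⟨h, hh⟩ := conj_commute hQ hP hPQ
  have e : ∀ γ i j, ((conjRep h ρ γ : Mat3) * R) i j = (R * (conjRep h ρ γ : Mat3)) i j :=
    fun γ i j => by rw [hh]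
  simp only [Matrix.mul_apply, Fin.sum_univ_three, R, Matrix.of_apply, Matrix.cons_val', Matrix.cons_val] at e
  refine not_reg_block (hρ.conj h) (fun γ => ?_) (fun γ => ?_) (fun γ => ?_) (fun γ => ?_)
  · have := e γ 0 1; simpa [hs] using this
  · have := e γ 0 2; simpa [hs] using this
  · have := e γ 1 0; simpa [hs] using this
  · have := e γ 2 0; simpa [hs] using this

lemma exists_unipotent {ρ : ZZ →* SL3} (hρ : Reg ρ) : ∃ h : SL3,
    ∀ γ, (conjRep h ρ γ : Mat3) = !![1, (conjRep h ρ γ : Mat3) 0 1, (conjRep h ρ γ : Mat3) 0 2;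
      0, 1, (conjRep h ρ γ : Mat3) 1 2; 0, 0, 1] := by
  obtain ⟨P, hP0, hPadj, hP⟩ := exists_limit hρ
  obtain ⟨v, φ, hv, hφ, rfl⟩ := rank_one hP0 hPadj
  have hs : φ 0 * v 0 + φ 1 * v 1 + φ 2 * v 2 = 0 := by
    by_contra h
    exact not_reg_of_idem hρ v φ h hP
  have pos : ∀ u : Fin 3 → ℝ, u ≠ 0 → u 0 ^ 2 + u 1 ^ 2 + u 2 ^ 2 ≠ 0 := by
    intro u hu h
    apply hu
    have h0 : u 0 = 0 := by nlinarith [sq_nonneg (u 0), sq_nonneg (u 1), sq_nonneg (u 2)]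
    have h1 : u 1 = 0 := by nlinarith [sq_nonneg (u 0), sq_nonneg (u 1), sq_nonneg (u 2)]
    have h2 : u 2 = 0 := by nlinarith [sq_nonneg (u 0), sq_nonneg (u 1), sq_nonneg (u 2)]
    ext i; fin_cases i <;> simp [h0, h1, h2]
  have hv' := pos v hv
  have hφ' := pos φ hφ
  set s := φ 0 ^ 2 + φ 1 ^ 2 + φ 2 ^ 2 with hsdef
  let Q : Mat3 := !![v 0, φ 1 * v 2 - φ 2 * v 1, φ 0; v 1, φ 2 * v 0 - φ 0 * v 2, φ 1; v 2, φ 0 * v 1 - φ 1 * v 0, φ 2]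
  let R : Mat3 := !![0, 0, s; 0, 0, 0; 0, 0, 0]
  have hQ : Q.det ≠ 0 := by
    have : Q.det = (v 0 ^ 2 + v 1 ^ 2 + v 2 ^ 2) * s := by
      simp only [Q, Matrix.det_fin_three, Matrix.of_apply, Matrix.cons_val', Matrix.cons_val, hsdef]
      linear_combination (-(φ 0 * v 0 + φ 1 * v 1 + φ 2 * v 2)) * hs
    rw [this]
    exact mul_ne_zero hv' hφ'
  have hPQ : Matrix.vecMulVec v φ * Q = Q * R := by
    ext i j
    rw [Matrix.mul_apply, Matrix.mul_apply, Fin.sum_univ_three, Fin.sum_univ_three]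
    simp only [Matrix.vecMulVec_apply]
    have : v i * φ 0 * Q 0 j + v i * φ 1 * Q 1 j + v i * φ 2 * Q 2 j =
      v i * (φ 0 * Q 0 j + φ 1 * Q 1 j + φ 2 * Q 2 j) := by ring
    rw [this]
    fin_cases j
    · simp [Q, R, hs]
    · simp [Q, R]; right; ring
    · simp [Q, R, ← sq, ← hsdef]
      fin_cases i <;> simp
  obtain ⟨h, hh⟩ := conj_commute hQ hP hPQ
  refine ⟨h, ?_⟩
  have hreg := hρ.conj h
  set σ := conjRep h ρ
  have e : ∀ γ i j, ((σ γ : Mat3) * R) i j = (R * (σ γ : Mat3)) i j :=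
    fun γ i j => by rw [hh]
  simp only [Matrix.mul_apply, Fin.sum_univ_three, R, Matrix.of_apply, Matrix.cons_val', Matrix.cons_val] at e
  have e10 : ∀ γ, (σ γ : Mat3) 1 0 = 0 := fun γ => by have := e γ 1 2; simpa [hφ'] using this
  have e20 : ∀ γ, (σ γ : Mat3) 2 0 = 0 := fun γ => by have := e γ 2 2; simpa [hφ'] using this
  have e21 : ∀ γ, (σ γ : Mat3) 2 1 = 0 := fun γ => by have := e γ 0 1; simpa [hφ'] using this
  have e22 : ∀ γ, (σ γ : Mat3) 2 2 = (σ γ : Mat3) 0 0 := fun γ => by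
    have := e γ 0 2
    simp [mul_comm s, hφ'] at this
    exact this.symm
  have e11 : ∀ γ, (σ γ : Mat3) 1 1 = (σ γ : Mat3) 0 0 := by
    intro γ0
    by_contra hne
    set X := (σ γ0 : Mat3) with hX
    set d := X 1 1 - X 0 0 with hd
    have hd0 : d ≠ 0 := sub_ne_zero.2 hne
    have hE : (X - X 0 0 • (1 : Mat3)) * (X - X 0 0 • (1 : Mat3)) =
        Matrix.vecMulVec ![X 0 1, d, 0] ![0, d, X 1 2] := by
      have f10 : X 1 0 = 0 := e10 γ0
      have f20 : X 2 0 = 0 := e20 γ0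
      have f21 : X 2 1 = 0 := e21 γ0
      have f22 : X 2 2 = X 0 0 := e22 γ0
      ext i j
      rw [Matrix.mul_apply, Fin.sum_univ_three]
      fin_cases i <;> fin_cases j <;>
        simp [Matrix.vecMulVec_apply, f10, f20, f21, f22, hd]
    refine not_reg_of_idem hreg ![X 0 1, d, 0] ![0, d, X 1 2] (by simpa using hd0) ?_
    intro γ
    rw [← hE]
    have hc : Commute (σ γ : Mat3) X := by
      show (σ γ : Mat3) * X = X * σ γ
      rw [hX, ← Matrix.SpecialLinearGroup.coe_mul, ← Matrix.SpecialLinearGroup.coe_mul,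
        ← map_mul, ← map_mul, mul_comm]
    have hc2 : Commute (σ γ : Mat3) (X - X 0 0 • (1 : Mat3)) :=
      hc.sub_right ((Commute.one_right _).smul_right _)
    exact (hc2.mul_right hc2).eq
  have e00 : ∀ γ, (σ γ : Mat3) 0 0 = 1 := by
    intro γ
    have := (σ γ).det_coe
    rw [Matrix.det_fin_three, e10, e20, e21, e11, e22] at this
    have h3 : ((σ γ : Mat3) 0 0 - 1) * ((σ γ : Mat3) 0 0 ^ 2 + (σ γ : Mat3) 0 0 + 1) = 0 := by linarith
    rcases mul_eq_zero.1 h3 with h4 | h4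
    · linarith
    · nlinarith [sq_nonneg ((σ γ : Mat3) 0 0 + 1 / 2)]
  intro γ
  ext i j
  fin_cases i <;> fin_cases j <;> simp [e00, e10, e20, e21, e11, e22]

lemma parabola {x w : ZZ → ℝ} (hx : Additiv x) (hw : Additiv w) (c : ℝ)
    (hD : x (zz 1 0) * w (zz 0 1) ≠ x (zz 0 1) * w (zz 1 0)) :
    ∃ C, 0 < C ∧ {γ | |w γ + c * x γ ^ 2 / 2| ≤ C * (1 + |x γ|)}.Infinite := by
  set x1 := x (zz 1 0) with hx1
  set x2 := x (zz 0 1) with hx2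
  set w1 := w (zz 1 0) with hw1
  set w2 := w (zz 0 1) with hw2
  have hD' : x1 * w2 - x2 * w1 ≠ 0 := sub_ne_zero.2 hD
  set E1 := |x1| + |x2| with hE1
  set E2 := |w1| + |w2| with hE2
  have hE1' : 0 ≤ E1 := by positivity
  have hE2' : 0 ≤ E2 := by positivity
  set C := 1 + E2 + |c| * E1 + |c| * E1 * E1 with hCdef
  refine ⟨C, by positivity, ?_⟩
  have key : ∀ k : ℕ, ∃ γ ∈ {γ | |w γ + c * x γ ^ 2 / 2| ≤ C * (1 + |x γ|)}, |x γ - k| ≤ E1 := by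
    intro k
    obtain ⟨X, hX⟩ : ∃ X : ℝ, X = (k : ℝ) := ⟨_, rfl⟩
    rw [← hX]
    set W : ℝ := - c * X ^ 2 / 2 with hW
    set m : ℝ := (X * w2 - x2 * W) / (x1 * w2 - x2 * w1) with hm
    set n : ℝ := (x1 * W - X * w1) / (x1 * w2 - x2 * w1) with hn
    have s1 : m * x1 + n * x2 = X := by
      rw [hm, hn, div_mul_eq_mul_div, div_mul_eq_mul_div, ← add_div, div_eq_iff hD']; ring
    have s2 : m * w1 + n * w2 = W := by
      rw [hm, hn, div_mul_eq_mul_div, div_mul_eq_mul_div, ← add_div, div_eq_iff hD']; ring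
    have err : ∀ a b : ℝ, |(⌊m⌋ * a + ⌊n⌋ * b) - (m * a + n * b)| ≤ |a| + |b| := by
      intro a b
      have : (⌊m⌋ * a + ⌊n⌋ * b) - (m * a + n * b) = -(Int.fract m * a + Int.fract n * b) := by
        simp only [Int.fract]; ring
      rw [this, abs_neg]
      refine (abs_add_le _ _).trans ?_
      rw [abs_mul, abs_mul, Int.abs_fract, Int.abs_fract]
      have := (Int.fract_lt_one m).le
      have := (Int.fract_lt_one n).le
      nlinarith [abs_nonneg a, abs_nonneg b]
    have g1 : |x (zz ⌊m⌋ ⌊n⌋) - X| ≤ E1 := by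
      rw [hx.eq, ← s1]; exact err _ _
    have g2 : |w (zz ⌊m⌋ ⌊n⌋) - W| ≤ E2 := by
      rw [hw.eq, ← s2]; exact err _ _
    refine ⟨zz ⌊m⌋ ⌊n⌋, ?_, g1⟩
    simp only [Set.mem_ofPred_eq]
    set ξ := x (zz ⌊m⌋ ⌊n⌋)
    set ω := w (zz ⌊m⌋ ⌊n⌋)
    have id : ω + c * ξ ^ 2 / 2 = (ω - W) + c * ((ξ - X) * (ξ + X)) / 2 := by rw [hW]; ring
    have g3 : |ξ + X| ≤ 2 * |ξ| + E1 := by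
      have : ξ + X = 2 * ξ - (ξ - X) := by ring
      rw [this]
      refine (abs_sub _ _).trans ?_
      rw [abs_mul, abs_two]; linarith
    have g4 : |(ξ - X) * (ξ + X)| ≤ E1 * (2 * |ξ| + E1) := by
      rw [abs_mul]; exact mul_le_mul g1 g3 (abs_nonneg _) hE1'
    have g5 : |c * ((ξ - X) * (ξ + X)) / 2| ≤ |c| * (E1 * (2 * |ξ| + E1)) / 2 := by
      rw [abs_div, abs_mul, abs_two]
      have := mul_le_mul_of_nonneg_left g4 (abs_nonneg c)
      linarith
    rw [id]
    refine (abs_add_le _ _).trans ?_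
    have p1 : 0 ≤ |c| * E1 := by positivity
    have p2 : 0 ≤ |c| * E1 * E1 := by positivity
    have p3 : 0 ≤ |ξ| := abs_nonneg _
    have p4 : 0 ≤ E2 * |ξ| := by positivity
    have p5 : 0 ≤ |c| * E1 * E1 * |ξ| := by positivity
    have : C * (1 + |ξ|) = 1 + E2 + |c| * E1 + |c| * E1 * E1 + (|ξ| + E2 * |ξ| + |c| * E1 * |ξ| + |c| * E1 * E1 * |ξ|) := by
      rw [hCdef]; ring
    rw [this]
    linarith
  intro hfin
  obtain ⟨B, hB⟩ := (hfin.image x).bddAbove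
  obtain ⟨k, hk⟩ := exists_nat_gt (B + E1)
  obtain ⟨γ, hγ, h1⟩ := key k
  have h2 := hB (Set.mem_image_of_mem x hγ)
  have h3 := (abs_le.1 h1).1
  linarith

lemma hom_ext' {σ τ : ZZ →* SL3} (h1 : σ (zz 1 0) = τ (zz 1 0)) (h2 : σ (zz 0 1) = τ (zz 0 1)) : σ = τ := by
  refine MonoidHom.ext fun γ => ?_
  obtain ⟨m, n, rfl⟩ := zz_surj γ
  rw [zz_eq, map_mul, map_mul, map_zpow, map_zpow, map_zpow, map_zpow, h1, h2]

lemma linInd_iff (a₁ b₁ a₂ b₂ : ℝ) :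
    LinearIndependent ℝ ![![a₁, b₁], ![a₂, b₂]] ↔ a₁ * b₂ - b₁ * a₂ ≠ 0 := by
  have h := Matrix.linearIndependent_rows_iff_isUnit (A := !![a₁, b₁; a₂, b₂])
  rw [Matrix.isUnit_iff_isUnit_det, Matrix.det_fin_two_of, isUnit_iff_ne_zero] at h
  exact h

/-- unipotent coordinates -/
lemma unip_facts {σ : ZZ →* SL3} (x y z : ZZ → ℝ)
    (h : ∀ γ, (σ γ : Mat3) = !![1, x γ, z γ; 0, 1, y γ; 0, 0, 1]) :
    Additiv x ∧ Additiv y ∧ (∀ a b, z (a * b) = z a + z b + x a * y b) ∧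
    (∀ γ, nsq (σ γ : Mat3) = 3 + x γ ^ 2 + y γ ^ 2 + z γ ^ 2) ∧
    (∀ γ, nsq (((σ γ)⁻¹ : SL3) : Mat3) = 3 + x γ ^ 2 + y γ ^ 2 + (x γ * y γ - z γ) ^ 2) := by
  refine ⟨fun a b => ?_, fun a b => ?_, fun a b => ?_, fun γ => ?_, fun γ => ?_⟩
  · have := coe_map_mul σ a b 0 1
    rw [h, h, h] at this
    simp at this; linarith
  · have := coe_map_mul σ a b 1 2
    rw [h, h, h] at this
    simp at this; linarith
  · have := coe_map_mul σ a b 0 2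
    rw [h, h, h] at this
    simp at this; linarith
  · rw [nsq_expand, h]; simp; ring
  · rw [nsq_expand, inv_entry, h]; simp; ring

lemma forward_unip {σ : ZZ →* SL3} (hσ : Reg σ) (x y z : ZZ → ℝ)
    (h : ∀ γ, (σ γ : Mat3) = !![1, x γ, z γ; 0, 1, y γ; 0, 0, 1]) :
    ((∀ γ, x γ = 0) ∧ z (zz 1 0) * y (zz 0 1) - y (zz 1 0) * z (zz 0 1) ≠ 0) ∨
    ((∀ γ, y γ = 0) ∧ x (zz 1 0) * z (zz 0 1) - z (zz 1 0) * x (zz 0 1) ≠ 0) := by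
  obtain ⟨hx, hy, hz, hn, hni⟩ := unip_facts x y z h
  have bdd : ∀ (S : Set ZZ) (C : ℝ), S.Infinite →
      (∀ γ ∈ S, x γ ^ 2 + y γ ^ 2 + z γ ^ 2 ≤ C) → False := by
    intro S C hS hb
    refine hσ.false_of_infinite hS ((3 + |C|) ^ 2) (by positivity) fun γ hγ => ?_
    rw [hn, hni]
    have h1 := hb γ hγ
    have h2 := le_abs_self C
    have h3 : (3 + x γ ^ 2 + y γ ^ 2 + z γ ^ 2) ^ 2 ≤ (3 + |C|) ^ 2 :=
      pow_le_pow_left₀ (by positivity) (by linarith) 2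
    have h4 : (1 : ℝ) ≤ 3 + x γ ^ 2 + y γ ^ 2 + (x γ * y γ - z γ) ^ 2 := by nlinarith [sq_nonneg (x γ), sq_nonneg (y γ), sq_nonneg (x γ * y γ - z γ)]
    nlinarith [sq_nonneg (3 + |C|)]
  have sqb : ∀ t C : ℝ, |t| ≤ C → t ^ 2 ≤ C ^ 2 := fun t C ht => by
    rw [← sq_abs]; exact pow_le_pow_left₀ (abs_nonneg _) ht 2
  have hcomm : ∀ a b, x a * y b = x b * y a := by
    intro a b
    have h1 := hz a b
    rw [mul_comm, hz b a] at h1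
    linarith
  by_cases hx0 : ∀ γ, x γ = 0
  · refine Or.inl ⟨hx0, fun hD => ?_⟩
    have hza : Additiv z := fun a b => by rw [hz, hx0]; ring
    obtain ⟨C, -, hC⟩ := infinite_two hza hy (by linarith)
    refine bdd _ (C ^ 2 + C ^ 2) hC ?_
    rintro γ ⟨h1, h2⟩
    have := sqb _ _ h1
    have := sqb _ _ h2
    rw [hx0]; linarith
  by_cases hy0 : ∀ γ, y γ = 0
  · refine Or.inr ⟨hy0, fun hD => ?_⟩
    have hza : Additiv z := fun a b => by rw [hz, hy0]; ring
    obtain ⟨C, -, hC⟩ := infinite_two hx hza (by linarith)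
    refine bdd _ (C ^ 2 + C ^ 2) hC ?_
    rintro γ ⟨h1, h2⟩
    have := sqb _ _ h1
    have := sqb _ _ h2
    rw [hy0]; linarith
  exfalso
  push Not at hx0 hy0
  obtain ⟨a, ha⟩ := hx0
  obtain ⟨b, hb⟩ := hy0
  set c := y a / x a with hc
  have hyc : ∀ γ, y γ = c * x γ := fun γ => by
    rw [hc]; field_simp; linarith [hcomm a γ]
  have hc0 : c ≠ 0 := fun h0 => hb (by rw [hyc, h0, zero_mul])
  set w : ZZ → ℝ := fun γ => z γ - c * x γ ^ 2 / 2 with hw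
  have hwa : Additiv w := fun a b => by
    simp only [hw]; rw [hz, hx a b, hyc]; ring
  by_cases hD : x (zz 1 0) * w (zz 0 1) = x (zz 0 1) * w (zz 1 0)
  · obtain ⟨C, hCp, hC⟩ := infinite_two hx hwa hD
    refine bdd _ (C ^ 2 + c ^ 2 * C ^ 2 + (2 * C ^ 2 + c ^ 2 * C ^ 4)) hC ?_
    rintro γ ⟨h1, h2⟩
    have h1 := sqb _ _ h1
    have h2 := sqb _ _ h2
    have hzw : z γ = w γ + c * x γ ^ 2 / 2 := by simp only [hw]; ring
    rw [hyc, hzw]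
    have h3 : (x γ ^ 2) ^ 2 ≤ (C ^ 2) ^ 2 := pow_le_pow_left₀ (sq_nonneg _) h1 2
    have h4 : c ^ 2 * (x γ ^ 2) ^ 2 ≤ c ^ 2 * (C ^ 2) ^ 2 := by gcongr
    have h5 : c ^ 2 * x γ ^ 2 ≤ c ^ 2 * C ^ 2 := by gcongr
    have h6 : 0 ≤ c ^ 2 * (x γ ^ 2) ^ 2 := by positivity
    nlinarith [sq_nonneg (w γ - c * x γ ^ 2 / 2)]
  · obtain ⟨C, hCp, hC⟩ := parabola hx hwa c hD
    have hcp : 0 < |c| := abs_pos.2 hc0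
    set L := C + C ^ 2 / (2 * |c|) with hL
    have hLp : 0 < L := by positivity
    -- constants
    set K1 := 3 + c ^ 2 + 2 * C ^ 2 with hK1
    set K2 := 2 + 8 * (2 + 2 * L ^ 2) / c ^ 2 with hK2
    have hK2p : 0 < K2 := by positivity
    refine hσ.false_of_infinite hC (K1 ^ 2 * K2) (by positivity) fun γ hγ => ?_
    rw [hn, hni, hyc]
    have hzw : w γ + c * x γ ^ 2 / 2 = z γ := by simp only [hw]; ring
    simp only [Set.mem_ofPred_eq, hzw] at hγ
    set X := x γ
    set Z := z γ
    have f1 : Z ^ 2 ≤ C ^ 2 * (2 * (1 + X ^ 2)) := by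
      have := sqb _ _ hγ
      rw [mul_pow] at this
      have h2 : (1 + |X|) ^ 2 ≤ 2 * (1 + X ^ 2) := by nlinarith [sq_nonneg (1 - |X|), sq_abs X]
      exact this.trans (by gcongr)
    have f2 : 3 + X ^ 2 + (c * X) ^ 2 + Z ^ 2 ≤ K1 * (1 + X ^ 2) := by
      rw [hK1]; nlinarith [sq_nonneg c, sq_nonneg X]
    set T := X * (c * X) - Z with hT
    have f3 : |c| * X ^ 2 / 2 ≤ |T| + L := by
      have e1 : |c| * X ^ 2 ≤ |T| + |Z| := by
        have : |c| * X ^ 2 = |T + Z| := by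
          rw [hT, show X * (c * X) - Z + Z = c * X ^ 2 by ring, abs_mul, abs_of_nonneg (sq_nonneg X)]
        rw [this]; exact abs_add_le _ _
      have e2 : C * |X| ≤ |c| * X ^ 2 / 2 + C ^ 2 / (2 * |c|) := by
        have : |c| * X ^ 2 / 2 + C ^ 2 / (2 * |c|) - C * |X| = (|c| * |X| - C) ^ 2 / (2 * |c|) := by
          rw [← sq_abs X]; field_simp; ring
        have h0 : 0 ≤ (|c| * |X| - C) ^ 2 / (2 * |c|) := by positivity
        linarith
      rw [hL]; linarith
    have f4 : c ^ 2 * (X ^ 2) ^ 2 ≤ 8 * (T ^ 2 + L ^ 2) := by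
      have h0 : 0 ≤ |c| * X ^ 2 / 2 := by positivity
      have := pow_le_pow_left₀ h0 f3 2
      have h2 : (|c| * X ^ 2 / 2) ^ 2 = c ^ 2 * (X ^ 2) ^ 2 / 4 := by
        rw [← sq_abs c]; ring
      rw [h2] at this
      nlinarith [sq_nonneg (|T| - L), sq_abs T]
    have f5 : (X ^ 2) ^ 2 ≤ 8 * (T ^ 2 + L ^ 2) / c ^ 2 := by
      rw [le_div_iff₀ (by positivity)]; linarith
    have f6 : (1 + X ^ 2) ^ 2 ≤ K2 * (3 + X ^ 2 + (c * X) ^ 2 + T ^ 2) := by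
      have g1 : (1 + X ^ 2) ^ 2 ≤ 2 + 2 * (X ^ 2) ^ 2 := by nlinarith [sq_nonneg (1 - X ^ 2)]
      have g2 : K2 * (1 + T ^ 2) ≤ K2 * (3 + X ^ 2 + (c * X) ^ 2 + T ^ 2) := by
        gcongr
        nlinarith [sq_nonneg X, sq_nonneg (c * X)]
      have g3 : 2 + 2 * (8 * (T ^ 2 + L ^ 2) / c ^ 2) ≤ K2 * (1 + T ^ 2) := by
        have : K2 * (1 + T ^ 2) - (2 + 2 * (8 * (T ^ 2 + L ^ 2) / c ^ 2)) =
          2 * T ^ 2 + 16 * (1 + L ^ 2 * T ^ 2) / c ^ 2 := by rw [hK2]; field_simp; ring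
        have h0 : 0 ≤ 2 * T ^ 2 + 16 * (1 + L ^ 2 * T ^ 2) / c ^ 2 := by positivity
        linarith
      linarith
    have f7 : (3 + X ^ 2 + (c * X) ^ 2 + Z ^ 2) ^ 2 ≤ (K1 * (1 + X ^ 2)) ^ 2 :=
      pow_le_pow_left₀ (by positivity) f2 2
    calc _ ≤ _ := f7
      _ = K1 ^ 2 * (1 + X ^ 2) ^ 2 := by ring
      _ ≤ K1 ^ 2 * (K2 * _) := by gcongr
      _ = _ := by ring

lemma finite_of_indep (a₁ b₁ a₂ b₂ : ℝ) (hD : a₁ * b₂ - b₁ * a₂ ≠ 0) (C : ℝ) (S : Set ZZ)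
    (hS : ∀ m n : ℤ, zz m n ∈ S → (m * a₁ + n * a₂) ^ 2 + (m * b₁ + n * b₂) ^ 2 ≤ C) : S.Finite := by
  set D := a₁ * b₂ - b₁ * a₂ with hDd
  have hDp : 0 < |D| := abs_pos.2 hD
  set B := (1 + |C|) * (|a₁| + |a₂| + |b₁| + |b₂|) / |D| with hB
  refine ((Set.finite_Icc (-⌈B⌉) ⌈B⌉).prod (Set.finite_Icc (-⌈B⌉) ⌈B⌉)).image
    (fun p => zz p.1 p.2) |>.subset ?_
  intro γ hγ
  obtain ⟨m, n, rfl⟩ := zz_surj γ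
  have h1 := hS m n hγ
  set u : ℝ := m * a₁ + n * a₂ with hu
  set v : ℝ := m * b₁ + n * b₂ with hv
  have hC := le_abs_self C
  have bu : |u| ≤ 1 + |C| := by
    refine abs_le_of_sq_le_sq ?_ (by positivity)
    nlinarith [sq_nonneg v, abs_nonneg C]
  have bv : |v| ≤ 1 + |C| := by
    refine abs_le_of_sq_le_sq ?_ (by positivity)
    nlinarith [sq_nonneg u, abs_nonneg C]
  have bound : ∀ (k : ℤ) (p q : ℝ), |p| + |q| ≤ |a₁| + |a₂| + |b₁| + |b₂| → k * D = u * p - v * q → k ∈ Set.Icc (-⌈B⌉) ⌈B⌉ := by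
    intro k p q hpq hk
    have e1 : |(k : ℝ)| * |D| ≤ (1 + |C|) * (|a₁| + |a₂| + |b₁| + |b₂|) := by
      rw [← abs_mul, hk]
      refine (abs_sub _ _).trans ?_
      rw [abs_mul, abs_mul]
      have := mul_le_mul_of_nonneg_right bu (abs_nonneg p)
      have := mul_le_mul_of_nonneg_right bv (abs_nonneg q)
      have := mul_le_mul_of_nonneg_left hpq (by positivity : 0 ≤ 1 + |C|)
      linarith
    have e2 : |(k : ℝ)| ≤ B := by rw [hB, le_div_iff₀ hDp]; exact e1
    have e3 := abs_le.1 (e2.trans (Int.le_ceil B))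
    constructor
    · exact_mod_cast e3.1
    · exact_mod_cast e3.2
  refine ⟨(m, n), ⟨bound m b₂ a₂ ?_ ?_, bound n (-b₁) (-a₁) ?_ ?_⟩, rfl⟩
  · linarith [abs_nonneg a₁, abs_nonneg b₁]
  · rw [hDd, hu, hv]; ring
  · rw [abs_neg, abs_neg]; linarith [abs_nonneg a₂, abs_nonneg b₂]
  · rw [hDd, hu, hv]; ring

noncomputable def upper (x y z : ℝ) : SL3 := ⟨!![1, x, z; 0, 1, y; 0, 0, 1], by simp [Matrix.det_fin_three]⟩

/-- explicit homomorphism -/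
noncomputable def modelHom (x y z : ZZ → ℝ) (hx : Additiv x) (hy : Additiv y) (hz : Additiv z)
    (hxy : ∀ a b, x a * y b = 0) : ZZ →* SL3 :=
  MonoidHom.mk' (fun γ => upper (x γ) (y γ) (z γ)) (by
    intro a b
    apply Subtype.ext
    rw [Matrix.SpecialLinearGroup.coe_mul]
    simp only [upper]
    ext i j
    rw [Matrix.mul_apply, Fin.sum_univ_three]
    have := hxy a b
    fin_cases i <;> fin_cases j <;> simp [hx a b, hy a b, hz a b, this, add_comm])

def lin (p q : ℝ) (γ : ZZ) : ℝ := γ.toAdd.1 * p + γ.toAdd.2 * q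

lemma lin_add (p q : ℝ) : Additiv (lin p q) := by
  intro a b; simp [lin]; ring

lemma lin_zz (p q : ℝ) (m n : ℤ) : lin p q (zz m n) = m * p + n * q := rfl

lemma zero_add' : Additiv (fun _ => 0) := fun _ _ => by simp

lemma modelHom_coe (x y z : ZZ → ℝ) (hx : Additiv x) (hy : Additiv y) (hz : Additiv z)
    (hxy : ∀ a b, x a * y b = 0) (γ : ZZ) : (modelHom x y z hx hy hz hxy γ : Mat3) =
      !![1, x γ, z γ; 0, 1, y γ; 0, 0, 1] := rfl

lemma Reg.of_conj {ρ : ZZ →* SL3} {g : SL3} (h : Reg (conjRep g ρ)) : Reg ρ := by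
  have h1 := h.conj g⁻¹
  have : conjRep g⁻¹ (conjRep g ρ) = ρ := by
    refine MonoidHom.ext fun γ => ?_
    simp only [conjRep_apply]
    group
  rwa [this] at h1

lemma reg_of_model {σ : ZZ →* SL3} (x y z : ZZ → ℝ)
    (h : ∀ γ, (σ γ : Mat3) = !![1, x γ, z γ; 0, 1, y γ; 0, 0, 1]) (hxy : ∀ γ, x γ * y γ = 0)
    (hfin : ∀ C, {γ | x γ ^ 2 + y γ ^ 2 + z γ ^ 2 ≤ C}.Finite) : Reg σ := by
  obtain ⟨-, -, -, hn, hni⟩ := unip_facts x y z h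
  intro C hC
  refine (hfin C).subset ?_
  intro γ hγ
  simp only [Set.mem_ofPred_eq] at hγ ⊢
  rw [hn, hni, hxy, zero_sub, neg_sq, sq] at hγ
  have := le_of_mul_le_mul_right hγ (by positivity)
  linarith

/-- A homomorphism ρ : ℤ² → SL(3,ℝ) is regular if and only if its image is a
lattice in a minimal horospherical subgroup of SL(3,ℝ). -/
theorem regular_iff_lattice_in_minimal_horospherical
    (ρ : Multiplicative (ℤ × ℤ) →* Matrix.SpecialLinearGroup (Fin 3) ℝ) :
    IsRegularHom ρ ↔
      ∃ (g : Matrix.SpecialLinearGroup (Fin 3) ℝ) (a₁ b₁ a₂ b₂ : ℝ),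
        LinearIndependent ℝ ![![a₁, b₁], ![a₂, b₂]] ∧
        ((↑(g * ρ (Multiplicative.ofAdd (1, 0)) * g⁻¹) =
            !![1, a₁, b₁; 0, 1, 0; 0, 0, 1] ∧
          ↑(g * ρ (Multiplicative.ofAdd (0, 1)) * g⁻¹) =
            !![1, a₂, b₂; 0, 1, 0; 0, 0, 1]) ∨
         (↑(g * ρ (Multiplicative.ofAdd (1, 0)) * g⁻¹) =
            !![1, 0, a₁; 0, 1, b₁; 0, 0, 1] ∧
          ↑(g * ρ (Multiplicative.ofAdd (0, 1)) * g⁻¹) =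
            !![1, 0, a₂; 0, 1, b₂; 0, 0, 1])) := by
  rw [regular_iff_reg]
  constructor
  · intro hρ
    obtain ⟨g, hg⟩ := exists_unipotent hρ
    have e1 := hg (zz 1 0)
    have e2 := hg (zz 0 1)
    rcases forward_unip (hρ.conj g) _ _ _ hg with ⟨h0, hD⟩ | ⟨h0, hD⟩
    · rw [h0] at e1 e2
      exact ⟨g, _, _, _, _, (linInd_iff _ _ _ _).2 hD, Or.inr ⟨e1, e2⟩⟩
    · rw [h0] at e1 e2
      exact ⟨g, _, _, _, _, (linInd_iff _ _ _ _).2 hD, Or.inl ⟨e1, e2⟩⟩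
  · rintro ⟨g, a₁, b₁, a₂, b₂, hli, ⟨h1, h2⟩ | ⟨h1, h2⟩⟩
    · rw [linInd_iff] at hli
      apply Reg.of_conj (g := g)
      have hm : conjRep g ρ = modelHom (lin a₁ a₂) (fun _ => 0) (lin b₁ b₂) (lin_add _ _)
          zero_add' (lin_add _ _) (fun _ _ => by simp) := by
        apply hom_ext'
        · apply Subtype.ext
          refine h1.trans ?_
          rw [modelHom_coe]; simp [lin_zz]
        · apply Subtype.ext
          refine h2.trans ?_
          rw [modelHom_coe]; simp [lin_zz]
      refine reg_of_model (lin a₁ a₂) (fun _ => 0) (lin b₁ b₂) (fun γ => by rw [hm, modelHom_coe])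
        (fun _ => by simp) (fun C => finite_of_indep a₁ b₁ a₂ b₂ hli C _ ?_)
      intro m n hmn
      simp only [Set.mem_ofPred_eq, lin_zz] at hmn
      linarith
    · rw [linInd_iff] at hli
      apply Reg.of_conj (g := g)
      have hm : conjRep g ρ = modelHom (fun _ => 0) (lin b₁ b₂) (lin a₁ a₂)
          zero_add' (lin_add _ _) (lin_add _ _) (fun _ _ => by simp) := by
        apply hom_ext'
        · apply Subtype.ext
          refine h1.trans ?_
          rw [modelHom_coe]; simp [lin_zz]
        · apply Subtype.ext
          refine h2.trans ?_
          rw [modelHom_coe]; simp [lin_zz]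
      refine reg_of_model (fun _ => 0) (lin b₁ b₂) (lin a₁ a₂) (fun γ => by rw [hm, modelHom_coe])
        (fun _ => by simp) (fun C => finite_of_indep a₁ b₁ a₂ b₂ hli C _ ?_)
      intro m n hmn
      simp only [Set.mem_ofPred_eq, lin_zz] at hmn
      linarith
end

section
/- A Zariski-dense regular subgroup of SL(3,ℝ) contains no ℤ² subgroups. Precisely: if Γ ≤ SL(3,ℝ) is a subgroup that is regular and Zariski-dense, then there is no injective group homomorphism from ℤ × ℤ into Γ. -/
open Filter

/-- A subgroup of SL(3,ℝ) is regular if every sequence of pairwise distinct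
elements of it is regular. -/
def IsRegularSubgroup (Γ : Subgroup (Matrix.SpecialLinearGroup (Fin 3) ℝ)) : Prop :=
  ∀ γ : ℕ → Γ, Function.Injective γ → IsRegularSeq fun n => (γ n : Matrix.SpecialLinearGroup (Fin 3) ℝ)

/-- A subgroup of SL(3,ℝ) is Zariski-dense if every polynomial in the nine matrix
entries vanishing on the subgroup vanishes on all of SL(3,ℝ). -/
def IsZariskiDense (Γ : Subgroup (Matrix.SpecialLinearGroup (Fin 3) ℝ)) : Prop :=
  ∀ p : MvPolynomial (Fin 3 × Fin 3) ℝ,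
    (∀ γ ∈ Γ,
      MvPolynomial.eval (fun ij => (γ : Matrix (Fin 3) (Fin 3) ℝ) ij.1 ij.2) p = 0) →
    ∀ g : Matrix.SpecialLinearGroup (Fin 3) ℝ,
      MvPolynomial.eval (fun ij => (g : Matrix (Fin 3) (Fin 3) ℝ) ij.1 ij.2) p = 0

attribute [local instance] Matrix.frobeniusNormedAddCommGroup Matrix.frobeniusNormedSpace
  Matrix.frobeniusNormedRing Matrix.frobeniusNormedAlgebra

open Matrix Asymptotics

abbrev Mat3 := Matrix (Fin 3) (Fin 3) ℝ

lemma nrm_eq (g : Mat3) : ‖g‖ = frobNorm g := by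
  rw [Matrix.frobenius_norm_def, frobNorm, Real.sqrt_eq_rpow]
  simp

lemma nrm_sq (g : Mat3) : ‖g‖ ^ 2 = ∑ i, ∑ j, (g i j) ^ 2 := by
  rw [nrm_eq, frobNorm, Real.sq_sqrt (by positivity)]

lemma entry_le (g : Mat3) (i j : Fin 3) : |g i j| ≤ ‖g‖ := by
  rw [nrm_eq, frobNorm]
  apply Real.le_sqrt_of_sq_le
  rw [sq_abs]
  calc (g i j)^2 ≤ ∑ j, (g i j)^2 :=
        Finset.single_le_sum (f := fun j => (g i j)^2) (fun _ _ => sq_nonneg _) (Finset.mem_univ j)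
    _ ≤ _ := Finset.single_le_sum (f := fun i => ∑ j, (g i j)^2)
        (fun _ _ => by positivity) (Finset.mem_univ i)

lemma one_le_nrm_one : (1:ℝ) ≤ ‖(1 : Mat3)‖ := by
  have := entry_le 1 0 0
  simpa using this

/-- A set of matrices which is a regular group. -/
structure RG (S : Set Mat3) : Prop where
  one : (1 : Mat3) ∈ S
  mul : ∀ g ∈ S, ∀ h ∈ S, g * h ∈ S
  inv : ∀ g ∈ S, g⁻¹ ∈ S
  det : ∀ g ∈ S, g.det = 1
  fin : ∀ C : ℝ, {g ∈ S | ‖g‖ ^ 2 ≤ C * ‖g⁻¹‖}.Finite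

def Mov (S : Set Mat3) : Prop := ∀ φ : Fin 3 → ℝ, φ ≠ 0 → ∃ γ ∈ S, φ ⨯₃ (φ ᵥ* γ⁻¹) ≠ 0

lemma RG.transpose {S : Set Mat3} (h : RG S) : RG {g | gᵀ ∈ S} where
  one := by simpa using h.one
  mul := fun g hg k hk => by
    simp only [Set.mem_ofPred_eq, transpose_mul] at *
    exact h.mul _ hk _ hg
  inv := fun g hg => by
    simp only [Set.mem_ofPred_eq, transpose_nonsing_inv] at *
    exact h.inv _ hg
  det := fun g hg => by
    rw [← det_transpose]; exact h.det _ hg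
  fin := fun C => by
    have ht : ∀ g : Mat3, ‖gᵀ‖ = ‖g‖ := fun g => Matrix.frobenius_norm_transpose g
    refine ((h.fin C).preimage (f := fun g : Mat3 => gᵀ) (Matrix.transpose_injective.injOn)).subset ?_
    rintro g ⟨h1, h2⟩
    refine ⟨h1, ?_⟩
    simp only [← transpose_nonsing_inv, ht]
    exact h2

/-- The image of a regular subgroup. -/
def SG (Γ : Subgroup (Matrix.SpecialLinearGroup (Fin 3) ℝ)) : Set Mat3 :=
  {g | ∃ γ ∈ Γ, (γ : Mat3) = g}

lemma sl_inv (γ : Matrix.SpecialLinearGroup (Fin 3) ℝ) : ((γ⁻¹ : Matrix.SpecialLinearGroup (Fin 3) ℝ) : Mat3) = (γ : Mat3)⁻¹ := by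
  symm
  apply Matrix.inv_eq_right_inv
  rw [← Matrix.SpecialLinearGroup.coe_mul]; simp

lemma rg_SG (Γ : Subgroup (Matrix.SpecialLinearGroup (Fin 3) ℝ)) (hreg : IsRegularSubgroup Γ) :
    RG (SG Γ) where
  one := ⟨1, Γ.one_mem, by simp⟩
  mul := by
    rintro _ ⟨a, ha, rfl⟩ _ ⟨b, hb, rfl⟩
    exact ⟨a * b, Γ.mul_mem ha hb, by simp⟩
  inv := by
    rintro _ ⟨a, ha, rfl⟩
    exact ⟨a⁻¹, Γ.inv_mem ha, sl_inv a⟩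
  det := by
    rintro _ ⟨a, ha, rfl⟩
    exact a.2
  fin := fun C => by
    by_contra hinf
    have hinf : Set.Infinite {g ∈ SG Γ | ‖g‖ ^ 2 ≤ C * ‖g⁻¹‖} := hinf
    let e := hinf.natEmbedding
    choose γ hγ hγe using fun n => (e n).2.1
    have hinj : Function.Injective (fun n => (⟨γ n, hγ n⟩ : Γ)) := by
      intro m n hmn
      have : γ m = γ n := by simpa using hmn
      apply e.injective
      apply Subtype.ext
      rw [← hγe m, ← hγe n, this]
    have ht := hreg _ hinj
    unfold IsRegularSeq at ht
    obtain ⟨n, hn⟩ := (ht.eventually_gt_atTop C).exists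
    have h2 := (e n).2.2
    rw [← hγe n] at h2
    simp only [sl_inv, ← nrm_eq] at hn
    by_cases h0 : ‖(γ n : Mat3)⁻¹‖ = 0
    · rw [norm_eq_zero] at h0
      have := (sl_inv (γ n)).trans h0
      have h3 := (γ n)⁻¹.2
      change (((γ n)⁻¹ : Matrix.SpecialLinearGroup (Fin 3) ℝ) : Mat3).det = 1 at h3
      rw [this] at h3
      simp at h3
    · have hp : 0 < ‖(γ n : Mat3)⁻¹‖ := lt_of_le_of_ne (norm_nonneg _) (Ne.symm h0)
      rw [lt_div_iff₀ hp] at hn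
      linarith

/-- finishing lemma -/
lemma finish {S : Set Mat3} (h : RG S) (G : ℕ → Mat3) (hG : ∀ n, G n ∈ S) (Q : Mat3) (hQ : Q ≠ 0)
    (h1 : G =O[atTop] (fun n : ℕ => (n : ℝ)))
    (h2 : (fun n : ℕ => (G n)⁻¹ - ((n:ℝ)^2) • Q) =O[atTop] (fun n : ℕ => (n : ℝ))) : False := by
  obtain ⟨A, hA⟩ := h1.bound
  obtain ⟨B, hB⟩ := h2.bound
  have hq : 0 < ‖Q‖ := norm_pos_iff.2 hQ
  set q := ‖Q‖ with hqd
  have key : ∀ᶠ n : ℕ in atTop, q / 2 * (n:ℝ)^2 ≤ ‖(G n)⁻¹‖ := by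
    have hlarge : ∀ᶠ n : ℕ in atTop, 2 * B / q ≤ (n:ℝ) :=
      tendsto_natCast_atTop_atTop.eventually_ge_atTop _
    filter_upwards [hB, hlarge] with n hn hl
    have h3 : ‖((n:ℝ)^2) • Q‖ ≤ ‖(G n)⁻¹‖ + ‖(G n)⁻¹ - ((n:ℝ)^2) • Q‖ := by
      have := norm_sub_le ((G n)⁻¹) ((G n)⁻¹ - ((n:ℝ)^2) • Q)
      simpa using this
    rw [norm_smul] at h3
    simp only [norm_pow, Real.norm_natCast] at h3 hn
    rw [div_le_iff₀ hq] at hl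
    have hn0 : (0:ℝ) ≤ n := Nat.cast_nonneg n
    nlinarith
  have hfin := h.fin (2 * A^2 / q)
  obtain ⟨D, hD⟩ := (hfin.image (fun g : Mat3 => ‖g⁻¹‖)).bddAbove
  have hlarge : ∀ᶠ n : ℕ in atTop, 2 * (|D| + 1) / q + 1 ≤ (n:ℝ) :=
      tendsto_natCast_atTop_atTop.eventually_ge_atTop _
  obtain ⟨n, hn1, hn2, hn3⟩ := (hA.and (key.and hlarge)).exists
  have hmem : G n ∈ {g ∈ S | ‖g‖ ^ 2 ≤ 2 * A^2 / q * ‖g⁻¹‖} := by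
    refine ⟨hG n, ?_⟩
    rw [Real.norm_natCast] at hn1
    calc ‖G n‖^2 ≤ (A * n)^2 := by gcongr
      _ = 2 * A^2 / q * (q / 2 * (n:ℝ)^2) := by field_simp
      _ ≤ _ := by gcongr
  have h5 : ‖(G n)⁻¹‖ ≤ D := hD ⟨_, hmem, rfl⟩
  have h6 : 2 * (|D| + 1) / q ≤ (n:ℝ) - 1 := by linarith
  rw [div_le_iff₀ hq] at h6
  have : D ≤ |D| := le_abs_self D
  have : 0 ≤ |D| := abs_nonneg D
  have hn1 : (1:ℝ) ≤ n := by
    have : 0 ≤ 2 * (|D| + 1) / q := by positivity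
    linarith
  nlinarith [mul_nonneg hq.le (sub_nonneg.2 hn1)]

/-- Dirichlet type lemma. -/
lemma dirichlet {E : Type*} [NormedAddCommGroup E] [NormedSpace ℝ E] (v w : E)
    (h : ¬ LinearIndependent ℝ ![v, w]) :
    ∃ C : ℝ, {k : ℤ × ℤ | ‖(k.1 : ℝ) • v + (k.2 : ℝ) • w‖ ≤ C}.Infinite := by
  refine ⟨‖w‖, ?_⟩
  by_cases hw : w = 0
  · refine Set.infinite_of_injective_forall_mem (f := fun n : ℤ => ((0 : ℤ), n)) ?_ ?_
    · intro a b hab; simpa using hab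
    · intro n; simp [hw]
  · have : ∃ c : ℝ, v = c • w := by
      by_contra hc
      push Not at hc
      apply h
      rw [LinearIndependent.pair_symm_iff, LinearIndependent.pair_iff' hw]
      exact fun a => (hc a).symm
    obtain ⟨c, rfl⟩ := this
    refine Set.infinite_of_injective_forall_mem (f := fun m : ℤ => (m, - round (m * c))) ?_ ?_
    · intro a b hab; simpa using (Prod.ext_iff.1 hab).1
    · intro m
      simp only [Set.mem_ofPred_eq]
      rw [smul_smul, ← add_smul, norm_smul]
      have := abs_sub_round ((m:ℝ) * c)
      push_cast
      rw [← sub_eq_add_neg, Real.norm_eq_abs]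
      nlinarith [norm_nonneg w]

/-- additive maps from ℤ² -/
lemma add_formula {E : Type*} [AddCommGroup E] [Module ℝ E] (f : ℤ × ℤ → E)
    (hf : ∀ k l, f (k + l) = f k + f l) (k : ℤ × ℤ) :
    f k = (k.1:ℝ) • f (1,0) + (k.2:ℝ) • f (0,1) := by
  let F : ℤ × ℤ →+ E := AddMonoidHom.mk' f hf
  have : k = k.1 • ((1:ℤ),(0:ℤ)) + k.2 • ((0:ℤ),(1:ℤ)) := by ext <;> simp
  have h2 : F k = F (k.1 • ((1:ℤ),(0:ℤ)) + k.2 • ((0:ℤ),(1:ℤ))) := by rw [← this]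
  rw [map_add, map_zsmul, map_zsmul] at h2
  rw [Int.cast_smul_eq_zsmul, Int.cast_smul_eq_zsmul]
  exact h2

lemma dirichlet1 (f : ℤ × ℤ → ℝ) (hf : ∀ k l, f (k + l) = f k + f l) :
    ∃ C : ℝ, {k : ℤ × ℤ | |f k| ≤ C}.Infinite := by
  obtain ⟨C, hC⟩ := dirichlet (f (1,0)) (f (0,1)) (by
    intro h
    have := h.fintype_card_le_finrank
    simp at this)
  refine ⟨C, ?_⟩
  convert hC using 3 with k
  rw [add_formula f hf k, Real.norm_eq_abs]

/-- bounded approximations by lattice points -/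
lemma approx {E : Type*} [NormedAddCommGroup E] [NormedSpace ℝ E] (v w e : E) (α β : ℝ)
    (h : e = α • v + β • w) :
    ∃ k : ℤ × ℤ, ‖((k.1 : ℝ) • v + (k.2 : ℝ) • w) - e‖ ≤ ‖v‖ + ‖w‖ := by
  refine ⟨(round α, round β), ?_⟩
  have e1 : (((round α : ℤ) : ℝ) • v + ((round β : ℤ) : ℝ) • w) - e
      = (((round α : ℤ) : ℝ) - α) • v + (((round β : ℤ) : ℝ) - β) • w := by
    rw [h]; module
  simp only [e1]
  refine (norm_add_le _ _).trans ?_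
  rw [norm_smul, norm_smul, Real.norm_eq_abs, Real.norm_eq_abs, abs_sub_comm, abs_sub_comm _ β]
  have := abs_sub_round α
  have := abs_sub_round β
  nlinarith [norm_nonneg v, norm_nonneg w]

/-- algebra of x + yT with T² = δ -/
lemma quad_dir (x y : ℤ × ℤ → ℝ) (δ : ℝ)
    (hx : ∀ k l, x (k + l) = x k * x l + δ * (y k * y l))
    (hy : ∀ k l, y (k + l) = x k * y l + y k * x l)
    (hn : ∀ k, x k ^ 2 - δ * y k ^ 2 ≠ 0) :
    ∃ C : ℝ, {k | x k ^ 2 + y k ^ 2 ≤ C * |x k ^ 2 - δ * y k ^ 2|}.Infinite := by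
  rcases lt_trichotomy δ 0 with hδ | hδ | hδ
  · refine ⟨1 + 1 / (-δ), ?_⟩
    convert Set.infinite_univ (α := ℤ × ℤ)
    ext k
    simp only [Set.mem_ofPred_eq, Set.mem_univ, iff_true]
    have h1 : 0 < -δ := by linarith
    have hp : 0 ≤ x k ^ 2 - δ * y k ^ 2 := by nlinarith [sq_nonneg (x k), sq_nonneg (y k)]
    rw [abs_of_nonneg hp]
    have e : (1 + 1 / (-δ)) * (x k ^ 2 - δ * y k ^ 2)
        = x k ^ 2 + y k ^ 2 + (-δ) * y k^2 + 1/(-δ) * x k ^2 := by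
      have := hδ.ne
      field_simp; ring
    rw [e]
    have : 0 ≤ (-δ) * y k^2 := by positivity
    have : 0 ≤ 1/(-δ) * x k ^2 := by positivity
    linarith
  · subst hδ
    have hx0 : ∀ k, x k ≠ 0 := fun k h => hn k (by rw [h]; ring)
    obtain ⟨C, hC⟩ := dirichlet1 (fun k => y k / x k) (by
      intro k l
      have := hx0 k
      have := hx0 l
      simp only [hx, hy]
      field_simp
      ring)
    refine ⟨1 + C^2, hC.mono ?_⟩
    intro k hk
    simp only [Set.mem_ofPred_eq] at hk ⊢
    have h1 : 0 < |x k| := abs_pos.2 (hx0 k)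
    rw [abs_div, div_le_iff₀ h1] at hk
    have h2 : y k ^ 2 ≤ C^2 * x k^2 := by
      rw [← sq_abs (y k), ← sq_abs (x k), ← mul_pow]
      gcongr
    rw [zero_mul, sub_zero, abs_of_nonneg (sq_nonneg _)]
    linarith
  · set s := Real.sqrt δ with hs
    have hs2 : s ^ 2 = δ := Real.sq_sqrt hδ.le
    have hs0 : 0 < s := Real.sqrt_pos.2 hδ
    have hfac : ∀ k, x k ^ 2 - δ * y k ^ 2 = (x k + s * y k) * (x k - s * y k) := by
      intro k; rw [← hs2]; ring
    have hp : ∀ k, x k + s * y k ≠ 0 := fun k h => hn k (by rw [hfac, h]; ring)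
    have hm : ∀ k, x k - s * y k ≠ 0 := fun k h => hn k (by rw [hfac, h]; ring)
    obtain ⟨C, hC⟩ := dirichlet1
      (fun k => Real.log (x k + s * y k) - Real.log (x k - s * y k)) (by
      intro k l
      have e1 : x (k + l) + s * y (k + l) = (x k + s * y k) * (x l + s * y l) := by
        rw [hx, hy, ← hs2]; ring
      have e2 : x (k + l) - s * y (k + l) = (x k - s * y k) * (x l - s * y l) := by
        rw [hx, hy, ← hs2]; ring
      simp only [e1, e2]
      rw [Real.log_mul (hp k) (hp l), Real.log_mul (hm k) (hm l)]
      ring)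
    set c := Real.exp C with hc
    have hc0 : 0 < c := Real.exp_pos C
    refine ⟨c * (1 + 1 / δ), hC.mono ?_⟩
    intro k hk
    simp only [Set.mem_ofPred_eq] at hk ⊢
    rw [hfac, abs_mul]
    set a := |x k + s * y k| with ha
    set b := |x k - s * y k| with hb
    have ha0 : 0 < a := abs_pos.2 (hp k)
    have hb0 : 0 < b := abs_pos.2 (hm k)
    rw [← Real.log_abs, ← Real.log_abs (x k - _), ← Real.log_div ha0.ne' hb0.ne', abs_le] at hk
    have h1 : a ≤ c * b := by
      have := (Real.log_le_iff_le_exp (by positivity)).1 hk.2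
      rwa [div_le_iff₀ hb0] at this
    have h2 : b ≤ c * a := by
      have h3 : Real.log (b / a) ≤ C := by
        rw [← inv_div, Real.log_inv]; linarith [hk.1]
      have := (Real.log_le_iff_le_exp (by positivity)).1 h3
      rwa [div_le_iff₀ ha0] at this
    have h4 : a^2 + b^2 = 2 * (x k ^2 + δ * y k^2) := by
      rw [ha, hb, sq_abs, sq_abs, ← hs2]; ring
    have h5 : x k ^2 + δ * y k^2 ≤ c * (a * b) := by nlinarith
    have h6 : x k ^ 2 + y k ^ 2 ≤ (1 + 1/δ) * (x k ^2 + δ * y k^2) := by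
      have e : (1 + 1/δ) * (x k ^2 + δ * y k^2)
         = x k ^ 2 + y k ^ 2 + δ * y k^2 + 1/δ * x k ^2 := by field_simp; ring
      rw [e]
      have : 0 ≤ δ * y k^2 := by positivity
      have : 0 ≤ 1/δ * x k ^2 := by positivity
      linarith
    calc _ ≤ _ := h6
      _ ≤ (1 + 1/δ) * (c * (a * b)) := by gcongr
      _ = _ := by ring

/-- 2×2 case. entries a b c d -/
lemma two_dir (a b c d : ℤ × ℤ → ℝ)
    (ha : ∀ k l, a (k + l) = a k * a l + b k * c l)
    (hb : ∀ k l, b (k + l) = a k * b l + b k * d l)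
    (hc : ∀ k l, c (k + l) = c k * a l + d k * c l)
    (hd : ∀ k l, d (k + l) = c k * b l + d k * d l)
    (hn : ∀ k, a k * d k - b k * c k ≠ 0) :
    ∃ C : ℝ, {k | a k ^ 2 + b k ^ 2 + c k ^ 2 + d k ^ 2 ≤ C * |a k * d k - b k * c k|}.Infinite := by
  by_cases hs : ∀ k, a k = d k ∧ b k = 0 ∧ c k = 0
  · refine ⟨2, ?_⟩
    convert Set.infinite_univ (α := ℤ × ℤ)
    ext k
    simp only [Set.mem_ofPred_eq, Set.mem_univ, iff_true]
    obtain ⟨h1, h2, h3⟩ := hs k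
    rw [h1, h2, h3, zero_mul, sub_zero, abs_mul_self]
    nlinarith
  · push Not at hs
    obtain ⟨k0, hk0⟩ := hs
    set p := (a k0 - d k0) / 2 with hp
    set q := b k0 with hq
    set r := c k0 with hr
    have hT : p ≠ 0 ∨ q ≠ 0 ∨ r ≠ 0 := by
      by_contra hcon
      push Not at hcon
      exact hk0 (by linarith [hcon.1]) hcon.2.1 hcon.2.2
    have hcomm : ∀ k, b k * r = q * c k ∧ (a k - d k) / 2 * q = b k * p ∧ (a k - d k) / 2 * r = c k * p := by
      intro k
      have e := add_comm k k0
      have e1 := (ha k k0).symm.trans ((congrArg a e).trans (ha k0 k))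
      have e2 := (hb k k0).symm.trans ((congrArg b e).trans (hb k0 k))
      have e3 := (hc k k0).symm.trans ((congrArg c e).trans (hc k0 k))
      refine ⟨?_, ?_, ?_⟩ <;> simp only [hp, hq, hr] <;> linarith
    have hy : ∀ k, ∃ y : ℝ, (a k - d k) / 2 = y * p ∧ b k = y * q ∧ c k = y * r := by
      intro k
      obtain ⟨h1, h2, h3⟩ := hcomm k
      rcases hT with h | h | h
      · refine ⟨(a k - d k) / 2 / p, ?_, ?_, ?_⟩ <;> field_simp <;> linarith
      · refine ⟨b k / q, ?_, ?_, ?_⟩ <;> field_simp <;> linarith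
      · refine ⟨c k / r, ?_, ?_, ?_⟩ <;> field_simp <;> linarith
    choose y hy1 hy2 hy3 using hy
    set x := fun k => (a k + d k) / 2 with hx
    have hak : ∀ k, a k = x k + y k * p := fun k => by rw [← hy1]; simp only [hx]; ring
    have hdk : ∀ k, d k = x k - y k * p := fun k => by rw [← hy1]; simp only [hx]; ring
    have hdet : ∀ k, a k * d k - b k * c k = x k ^2 - (p^2 + q * r) * y k^2 := by
      intro k; rw [hak, hdk, hy2, hy3]; ring
    obtain ⟨C, hC⟩ := quad_dir x y (p^2 + q * r) (by
        intro k l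
        have e1 := ha k l
        have e2 := hd k l
        rw [hak (k+l), hak k, hak l, hy2, hy3] at e1
        rw [hdk (k+l), hdk k, hdk l, hy2, hy3] at e2
        linarith) (by
        intro k l
        have e1 := ha k l
        have e2 := hd k l
        have e3 := hb k l
        have e4 := hc k l
        rw [hak (k+l), hak k, hak l, hy2, hy3] at e1
        rw [hdk (k+l), hdk k, hdk l, hy2, hy3] at e2
        rw [hy2 (k+l), hak k, hdk l, hy2, hy2] at e3
        rw [hy3 (k+l), hak l, hdk k, hy3, hy3] at e4
        rcases hT with h | h | h
        · apply mul_right_cancel₀ h; linarith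
        · apply mul_right_cancel₀ h; linarith
        · apply mul_right_cancel₀ h; linarith) (by
        intro k; rw [← hdet]; exact hn k)
    set D := 2 + 2 * p^2 + q^2 + r^2 with hD
    refine ⟨D * C, hC.mono ?_⟩
    intro k hk
    simp only [Set.mem_ofPred_eq] at hk ⊢
    rw [hdet, mul_assoc]
    calc _ ≤ D * (x k^2 + y k^2) := by
          rw [hak, hdk, hy2, hy3, hD]
          nlinarith [sq_nonneg (x k), sq_nonneg (y k), mul_nonneg (sq_nonneg p) (sq_nonneg (x k)),
            mul_nonneg (sq_nonneg q) (sq_nonneg (x k)), mul_nonneg (sq_nonneg r) (sq_nonneg (x k))]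
      _ ≤ _ := by
          have : 0 ≤ D := by positivity
          gcongr

structure RZ (M : ℤ × ℤ → Mat3) : Prop where
  one : M 0 = 1
  mul : ∀ k l, M (k + l) = M k * M l
  det : ∀ k, (M k).det = 1
  fin : ∀ C : ℝ, {k | ‖M k‖ ^ 2 ≤ C * ‖M (-k)‖}.Finite

lemma RZ.comm {M} (h : RZ M) (k l : ℤ × ℤ) : M k * M l = M l * M k := by
  rw [← h.mul, ← h.mul, add_comm]

lemma RZ.neg_mul {M} (h : RZ M) (k : ℤ × ℤ) : M (-k) * M k = 1 := by
  rw [← h.mul, neg_add_cancel, h.one]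

lemma RZ.mul_neg {M} (h : RZ M) (k : ℤ × ℤ) : M k * M (-k) = 1 := by
  rw [← h.mul, add_neg_cancel, h.one]

lemma RZ.bdd {M} (h : RZ M) (C : ℝ) : {k | ‖M k‖ ≤ C}.Finite := by
  refine (h.fin (C^2 * C)).subset ?_
  intro k hk
  simp only [Set.mem_ofPred_eq] at hk ⊢
  have h1 : 1 ≤ ‖M k‖ * ‖M (-k)‖ := by
    calc _ ≤ _ := one_le_nrm_one
      _ = ‖M k * M (-k)‖ := by rw [h.mul_neg]
      _ ≤ _ := norm_mul_le _ _
  have h2 : 1 ≤ C * ‖M (-k)‖ := h1.trans (by gcongr)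
  have h3 : ‖M k‖^2 ≤ C^2 := by gcongr
  nlinarith [sq_nonneg C]

lemma RZ.conj {M} (h : RZ M) (P : Mat3) (hP : P.det ≠ 0) : RZ (fun k => P⁻¹ * M k * P) := by
  have hu : IsUnit P.det := isUnit_iff_ne_zero.2 hP
  have e1 : P * P⁻¹ = 1 := Matrix.mul_nonsing_inv P hu
  have e2 : P⁻¹ * P = 1 := Matrix.nonsing_inv_mul P hu
  refine ⟨by simp [h.one, e2], ?_, ?_, ?_⟩
  · intro k l
    simp only [h.mul]
    calc P⁻¹ * (M k * M l) * P = P⁻¹ * M k * 1 * M l * P := by noncomm_ring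
      _ = _ := by rw [← e1]; noncomm_ring
  · intro k
    rw [det_mul, det_mul, h.det, mul_one, ← det_mul, e2, det_one]
  · intro C
    set c := ‖P‖ * ‖P⁻¹‖ with hc
    have hc0 : 0 ≤ c := by positivity
    have b1 : ∀ k, ‖M k‖ ≤ c * ‖P⁻¹ * M k * P‖ := by
      intro k
      have : M k = P * (P⁻¹ * M k * P) * P⁻¹ := by
        calc M k = 1 * M k * 1 := by simp
          _ = _ := by rw [← e1]; noncomm_ring
      calc ‖M k‖ = ‖P * (P⁻¹ * M k * P) * P⁻¹‖ := by rw [← this]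
        _ ≤ ‖P‖ * ‖(P⁻¹ * M k * P)‖ * ‖P⁻¹‖ :=
          (norm_mul_le _ _).trans (by gcongr; exact norm_mul_le _ _)
        _ = _ := by rw [hc]; ring
    have b2 : ∀ k, ‖P⁻¹ * M k * P‖ ≤ c * ‖M k‖ := by
      intro k
      calc _ ≤ ‖P⁻¹‖ * ‖M k‖ * ‖P‖ :=
          (norm_mul_le _ _).trans (by gcongr; exact norm_mul_le _ _)
        _ = _ := by rw [hc]; ring
    refine (h.fin (c^2 * (|C| * c))).subset ?_
    intro k hk
    simp only [Set.mem_ofPred_eq] at hk ⊢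
    calc ‖M k‖^2 ≤ (c * ‖P⁻¹ * M k * P‖)^2 := by gcongr; exact b1 k
      _ = c^2 * ‖P⁻¹ * M k * P‖^2 := by ring
      _ ≤ c^2 * (C * ‖P⁻¹ * M (-k) * P‖) := by gcongr
      _ ≤ c^2 * (|C| * (c * ‖M (-k)‖)) := by
        gcongr
        · exact le_abs_self C
        · exact b2 (-k)
      _ = _ := by ring

lemma RZ.block {M} (h : RZ M) (h02 : ∀ k, M k 0 2 = 0) (h12 : ∀ k, M k 1 2 = 0)
    (h20 : ∀ k, M k 2 0 = 0) (h21 : ∀ k, M k 2 1 = 0) : False := by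
  have ee : ∀ k l i j, M (k + l) i j = M k i 0 * M l 0 j + M k i 1 * M l 1 j + M k i 2 * M l 2 j := by
    intro k l i j
    rw [h.mul, Matrix.mul_apply, Fin.sum_univ_three]
  have hdet : ∀ k, (M k 0 0 * M k 1 1 - M k 0 1 * M k 1 0) * M k 2 2 = 1 := by
    intro k
    have := h.det k
    rw [Matrix.det_fin_three, h02, h12, h20, h21] at this
    linarith
  obtain ⟨C, hC⟩ := two_dir (fun k => M k 0 0) (fun k => M k 0 1) (fun k => M k 1 0) (fun k => M k 1 1)
    (fun k l => by simp only [ee, h02, h12]; ring) (fun k l => by simp only [ee, h02, h12]; ring)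
    (fun k l => by simp only [ee, h02, h12]; ring) (fun k l => by simp only [ee, h02, h12]; ring)
    (fun k h0 => by have := hdet k; rw [h0] at this; simp at this)
  apply hC
  refine ((h.fin (C + 1)).union ((h.fin (C + 1)).preimage (f := fun k => -k) neg_injective.injOn)).subset ?_
  intro k hk
  simp only [Set.mem_ofPred_eq, Set.mem_union, Set.mem_preimage, neg_neg] at hk ⊢
  have hmk : ∀ i j, M (-k) i 0 * M k 0 j + M (-k) i 1 * M k 1 j + M (-k) i 2 * M k 2 j = (1 : Mat3) i j := by
    intro i j
    rw [← ee, neg_add_cancel, h.one]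
  have q00 := hmk 0 0
  have q01 := hmk 0 1
  have q10 := hmk 1 0
  have q11 := hmk 1 1
  have q22 := hmk 2 2
  simp only [h02, h12, h20, h21, Matrix.one_apply_eq, zero_mul, mul_zero, add_zero, zero_add] at q00 q01 q10 q11 q22
  rw [Matrix.one_apply_ne (by decide)] at q01 q10
  have n1 := nrm_sq (M k)
  have n2 := nrm_sq (M (-k))
  simp only [Fin.sum_univ_three, h02, h12, h20, h21] at n1 n2
  have l1 := entry_le (M k) 2 2
  have l2 := entry_le (M (-k)) 2 2
  have hd := hdet k
  rw [n1, n2]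
  generalize ‖M k‖ = X at *
  generalize ‖M (-k)‖ = Y at *
  generalize M (-k) 0 0 = a' at *
  generalize M (-k) 0 1 = b' at *
  generalize M (-k) 1 0 = c' at *
  generalize M (-k) 1 1 = d' at *
  generalize M (-k) 2 2 = e' at *
  generalize M k 0 0 = a at *
  generalize M k 0 1 = b at *
  generalize M k 1 0 = c at *
  generalize M k 1 1 = d at *
  generalize M k 2 2 = e at *
  obtain ⟨D, hD⟩ : ∃ D, D = a * d - b * c := ⟨_, rfl⟩
  rw [← hD] at hd hk
  have ra : a' * D = d := by rw [hD]; linear_combination d * q00 - c * q01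
  have rb : b' * D = -b := by rw [hD]; linear_combination a * q01 - b * q00
  have rc : c' * D = -c := by rw [hD]; linear_combination d * q10 - c * q11
  have rd : d' * D = a := by rw [hD]; linear_combination a * q11 - b * q10
  have re : e' = D := by linear_combination D * q22 - e' * hd
  subst re
  have hD0 : e' ≠ 0 := by rintro rfl; simp at hd
  have habs : 0 < |e'| := abs_pos.2 hD0
  have habs2 : |e'| * |e| = 1 := by rw [← abs_mul, q22, abs_one]
  have hC0 : 0 ≤ C := by
    by_contra hneg
    push Not at hneg
    nlinarith [sq_nonneg a, sq_nonneg b, sq_nonneg c, sq_nonneg d]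
  rcases le_total 1 |e'| with hge | hle
  · left
    have he1 : e^2 ≤ 1 := by
      rw [← sq_abs]
      have : |e| ≤ 1 := by nlinarith [abs_nonneg e]
      nlinarith [abs_nonneg e]
    have hs3 : (C + 1) * |e'| ≤ (C + 1) * Y := by gcongr
    linarith
  · right
    have he1 : 1 ≤ |e| := by nlinarith [abs_nonneg e]
    have he2 : e' ^2 ≤ 1 := by rw [← sq_abs]; nlinarith
    have hs : (a'^2 + b'^2 + c'^2 + d'^2) = (a^2+b^2+c^2+d^2) * |e|^2 := by
      have : |e'|^2 * |e|^2 = 1 := by rw [← mul_pow, habs2, one_pow]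
      have e3 : (a'^2 + b'^2 + c'^2 + d'^2) * |e'|^2 = a^2+b^2+c^2+d^2 := by
        rw [sq_abs, ← neg_sq b, ← neg_sq c, ← ra, ← rb, ← rc, ← rd]; ring
      rw [← e3, mul_assoc, this, mul_one]
    have hs2 : (a^2+b^2+c^2+d^2) * |e|^2 ≤ C * |e| := by
      calc _ ≤ C * |e'| * |e|^2 := by gcongr
        _ = C * (|e'| * |e|) * |e| := by ring
        _ = _ := by rw [habs2, mul_one]
    have hs3 : (C + 1) * |e| ≤ (C + 1) * X := by gcongr
    linarith

lemma adj_formula (A : Mat3) : A.adjugate = A ^ 2 - A.trace • A + ((A.trace ^ 2 - (A ^ 2).trace) / 2) • (1 : Mat3) := by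
  rw [Matrix.adjugate_fin_three]
  ext i j
  fin_cases i <;> fin_cases j <;>
  simp [pow_two, Matrix.mul_apply, Fin.sum_univ_three, Matrix.trace, Matrix.one_apply] <;> ring

lemma rank_one_of_adj (A : Mat3) (h : A.adjugate = 0) : ∃ v φ : Fin 3 → ℝ, A = vecMulVec v φ := by
  by_cases h0 : A = 0
  · exact ⟨0, 0, by simp [h0]⟩
  obtain ⟨i0, j0, hij⟩ : ∃ i j, A i j ≠ 0 := by
    by_contra hcon
    push Not at hcon
    exact h0 (by ext i j; simpa using hcon i j)
  refine ⟨fun i => A i j0, fun j => A i0 j / A i0 j0, ?_⟩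
  have key : ∀ i j, A i j * A i0 j0 = A i j0 * A i0 j := by
    rw [Matrix.adjugate_fin_three] at h
    have g := fun i j => congrFun (congrFun h i) j
    have g00 := g 0 0
    have g01 := g 0 1
    have g02 := g 0 2
    have g10 := g 1 0
    have g11 := g 1 1
    have g12 := g 1 2
    have g20 := g 2 0
    have g21 := g 2 1
    have g22 := g 2 2
    simp at g00 g01 g02 g10 g11 g12 g20 g21 g22
    clear g h hij h0
    intro i j
    fin_cases i0 <;> fin_cases j0 <;> fin_cases i <;> fin_cases j <;> simp <;> linarith
  ext i j
  rw [vecMulVec_apply]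
  field_simp
  exact key i j

lemma exists_frame (v φ : Fin 3 → ℝ) (h : φ ⬝ᵥ v ≠ 0) :
    ∃ P : Mat3, P.det ≠ 0 ∧ (∀ i, P i 2 = v i) ∧ (φ ᵥ* P) 0 = 0 ∧ (φ ᵥ* P) 1 = 0 := by
  have h' : φ 0 * v 0 + φ 1 * v 1 + φ 2 * v 2 ≠ 0 := by
    simpa [dotProduct, Fin.sum_univ_three] using h
  have : φ 0 ≠ 0 ∨ φ 1 ≠ 0 ∨ φ 2 ≠ 0 := by
    by_contra hcon
    push Not at hcon
    obtain ⟨a, b, c⟩ := hcon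
    rw [a, b, c] at h'
    simp at h'
  rcases this with h0 | h0 | h0
  · refine ⟨!![-φ 1, -φ 2, v 0; φ 0, 0, v 1; 0, φ 0, v 2], ?_, ?_, ?_, ?_⟩
    · rw [Matrix.det_fin_three]
      simp
      intro hh
      exact mul_ne_zero h0 h' (by linarith)
    · intro i; fin_cases i <;> simp
    · simp [vecMul, dotProduct, Fin.sum_univ_three]; ring
    · simp [vecMul, dotProduct, Fin.sum_univ_three]; ring
  · refine ⟨!![φ 1, 0, v 0; -φ 0, -φ 2, v 1; 0, φ 1, v 2], ?_, ?_, ?_, ?_⟩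
    · rw [Matrix.det_fin_three]
      simp
      intro hh
      exact mul_ne_zero h0 h' (by linarith)
    · intro i; fin_cases i <;> simp
    · simp [vecMul, dotProduct, Fin.sum_univ_three]; ring
    · simp [vecMul, dotProduct, Fin.sum_univ_three]; ring
  · refine ⟨!![φ 2, 0, v 0; 0, φ 2, v 1; -φ 0, -φ 1, v 2], ?_, ?_, ?_, ?_⟩
    · rw [Matrix.det_fin_three]
      simp
      intro hh
      exact mul_ne_zero h0 h' (by linarith)
    · intro i; fin_cases i <;> simp
    · simp [vecMul, dotProduct, Fin.sum_univ_three]; ring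
    · simp [vecMul, dotProduct, Fin.sum_univ_three]; ring

lemma RZ.case_two {M} (h : RZ M) (k0 : ℤ × ℤ) (μ : ℝ)
    (h1 : (μ • (1 : Mat3) - M k0).det = 0) (h2 : (μ • (1 : Mat3) - M k0).adjugate.trace ≠ 0) : False := by
  set A := μ • (1 : Mat3) - M k0 with hA
  have hadj : A.adjugate.adjugate = 0 := by
    rw [Matrix.adjugate_adjugate _ (by simp), h1]; simp
  obtain ⟨v, φ, hv⟩ := rank_one_of_adj _ hadj
  have htr : φ ⬝ᵥ v ≠ 0 := by
    rw [hv, Matrix.trace_vecMulVec] at h2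
    rwa [dotProduct_comm]
  have hcA : ∀ k, M k * A = A * M k := by
    intro k
    rw [hA, mul_sub, sub_mul, h.comm k k0]; simp
  have hcadj : ∀ k, M k * A.adjugate = A.adjugate * M k := by
    intro k
    have hc2 : M k * A^2 = A^2 * M k := Commute.pow_right (show Commute (M k) A from hcA k) 2
    rw [adj_formula]
    simp only [mul_add, mul_sub, add_mul, sub_mul, hc2, Matrix.mul_smul, Matrix.smul_mul, hcA k, mul_one, one_mul]
  have hcv : ∀ k, vecMulVec (M k *ᵥ v) φ = vecMulVec v (φ ᵥ* M k) := by
    intro k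
    have := hcadj k
    rwa [hv, Matrix.mul_vecMulVec, Matrix.vecMulVec_mul] at this
  have hent : ∀ k i j, (M k *ᵥ v) i * φ j = v i * (φ ᵥ* M k) j := by
    intro k i j
    have := congrFun (congrFun (hcv k) i) j
    simpa [vecMulVec_apply] using this
  obtain ⟨j0, hj0⟩ : ∃ j, φ j ≠ 0 := by
    by_contra hcon
    push Not at hcon
    have : φ = 0 := by ext j; simpa using hcon j
    rw [this] at htr; simp at htr
  obtain ⟨i0, hi0⟩ : ∃ j, v j ≠ 0 := by
    by_contra hcon
    push Not at hcon
    have : v = 0 := by ext j; simpa using hcon j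
    rw [this] at htr; simp at htr
  have hMv : ∀ k, ∃ χ : ℝ, M k *ᵥ v = χ • v := by
    intro k
    refine ⟨(φ ᵥ* M k) j0 / φ j0, ?_⟩
    ext i
    have := hent k i j0
    simp only [Pi.smul_apply, smul_eq_mul]
    field_simp
    linarith
  have hMφ : ∀ k, ∃ χ : ℝ, φ ᵥ* M k = χ • φ := by
    intro k
    refine ⟨(M k *ᵥ v) i0 / v i0, ?_⟩
    ext j
    have := hent k i0 j
    simp only [Pi.smul_apply, smul_eq_mul]
    field_simp
    linarith
  obtain ⟨P, hP, hPv, hP0, hP1⟩ := exists_frame v φ htr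
  have hu : IsUnit P.det := isUnit_iff_ne_zero.2 hP
  have e1 : P * P⁻¹ = 1 := Matrix.mul_nonsing_inv P hu
  have e2 : P⁻¹ * P = 1 := Matrix.nonsing_inv_mul P hu
  have hPv' : P *ᵥ (Pi.single 2 1) = v := by
    ext i; simp [hPv]
  have hPφ : ∃ c : ℝ, c ≠ 0 ∧ φ ᵥ* P = c • (Pi.single 2 1) := by
    refine ⟨(φ ᵥ* P) 2, ?_, ?_⟩
    · have e : φ ⬝ᵥ v = (φ ᵥ* P) 2 := by
        rw [← hPv', Matrix.dotProduct_mulVec]; simp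
      rwa [← e]
    · ext i
      fin_cases i
      · simpa using hP0
      · simpa using hP1
      · simp
  obtain ⟨c, hc, hPφ⟩ := hPφ
  have hcol : ∀ k, ∃ χ : ℝ, (P⁻¹ * M k * P) *ᵥ (Pi.single 2 1) = χ • (Pi.single 2 1) := by
    intro k
    obtain ⟨χ, hχ⟩ := hMv k
    refine ⟨χ, ?_⟩
    rw [← Matrix.mulVec_mulVec, hPv', ← Matrix.mulVec_mulVec, hχ, Matrix.mulVec_smul, ← hPv',
      Matrix.mulVec_mulVec, e2, Matrix.one_mulVec]
  have hrow : ∀ k, ∃ χ : ℝ, (Pi.single 2 1) ᵥ* (P⁻¹ * M k * P) = χ • (Pi.single 2 1) := by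
    intro k
    obtain ⟨χ, hχ⟩ := hMφ k
    refine ⟨χ, ?_⟩
    have : (Pi.single 2 1 : Fin 3 → ℝ) = c⁻¹ • (φ ᵥ* P) := by
      rw [hPφ, smul_smul, inv_mul_cancel₀ hc, one_smul]
    rw [this, Matrix.smul_vecMul, Matrix.vecMul_vecMul]
    have e3 : P * (P⁻¹ * M k * P) = M k * P := by
      rw [← mul_assoc, ← mul_assoc, e1, one_mul]
    rw [e3, ← Matrix.vecMul_vecMul, hχ, Matrix.smul_vecMul, smul_comm]
  refine (h.conj P hP).block ?_ ?_ ?_ ?_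
  · intro k
    obtain ⟨χ, hχ⟩ := hcol k
    simpa using congrFun hχ 0
  · intro k
    obtain ⟨χ, hχ⟩ := hcol k
    simpa using congrFun hχ 1
  · intro k
    obtain ⟨χ, hχ⟩ := hrow k
    simpa using congrFun hχ 0
  · intro k
    obtain ⟨χ, hχ⟩ := hrow k
    simpa using congrFun hχ 1

lemma cubic_root (t s : ℝ) : ∃ μ : ℝ, μ^3 - t * μ^2 + s * μ - 1 = 0 := by
  have hc : ContinuousOn (fun μ : ℝ => μ^3 - t * μ^2 + s * μ - 1) (Set.Icc 0 (1 + |t| + |s|)) := by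
    fun_prop
  have hle : (0:ℝ) ≤ 1 + |t| + |s| := by positivity
  have := intermediate_value_Icc hle hc
  have hmem : (0:ℝ) ∈ Set.Icc ((fun μ : ℝ => μ^3 - t * μ^2 + s * μ - 1) 0)
      ((fun μ : ℝ => μ^3 - t * μ^2 + s * μ - 1) (1 + |t| + |s|)) := by
    constructor
    · simp
    · simp only
      set B := 1 + |t| + |s| with hB
      have ht : t ≤ |t| := le_abs_self t
      have hs : -|s| ≤ s := neg_abs_le s
      have h1 : 1 ≤ B := by have := abs_nonneg t; have := abs_nonneg s; linarith
      have h2 : t * B^2 ≤ |t| * B^2 := by gcongr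
      have h3 : -|s| * B ≤ s * B := by gcongr
      have h4 : B^3 = (1 + |t| + |s|) * B^2 := by rw [hB]; ring
      have h5 : |s| * B ≤ |s| * B^2 := by
        have := abs_nonneg s
        gcongr
        nlinarith
      nlinarith
  obtain ⟨μ, _, hμ⟩ := this hmem
  exact ⟨μ, hμ⟩

lemma RZ.unip {M} (h : RZ M) (k : ℤ × ℤ) : (M k - 1) ^ 3 = 0 := by
  set g := M k with hg
  set t := g.trace with ht
  set s := g.adjugate.trace with hs
  have hdet1 : g.det = 1 := h.det k
  have hcp : ∀ μ : ℝ, (μ • (1 : Mat3) - g).det = μ^3 - t * μ^2 + s * μ - 1 := by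
    intro μ
    rw [← hdet1, hs, ht, Matrix.adjugate_fin_three, Matrix.det_fin_three, Matrix.det_fin_three]
    simp [Matrix.trace, Fin.sum_univ_three, Matrix.one_apply]
    ring
  have hcp' : ∀ μ : ℝ, (μ • (1 : Mat3) - g).adjugate.trace = 3 * μ^2 - 2 * t * μ + s := by
    intro μ
    rw [hs, ht, Matrix.adjugate_fin_three, Matrix.adjugate_fin_three]
    simp [Matrix.trace, Fin.sum_univ_three, Matrix.one_apply]
    ring
  have hCH : g^3 = t • g^2 - s • g + 1 := by
    have e1 := adj_formula g
    have e2 : g * g.adjugate = 1 := by rw [Matrix.mul_adjugate, hdet1, one_smul]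
    have e3 : s = (g.trace ^ 2 - (g ^ 2).trace) / 2 := by
      rw [hs, e1]
      simp [Matrix.trace_add, Matrix.trace_sub, Matrix.trace_smul]
      ring
    rw [← e3, ← ht] at e1
    rw [e1, mul_add, mul_sub, Matrix.mul_smul, Matrix.mul_smul, mul_one] at e2
    rw [← e2]
    have : g^3 = g * g^2 := by noncomm_ring
    rw [this, ← pow_two]; abel
  have hno : ∀ μ : ℝ, μ^3 - t * μ^2 + s * μ - 1 = 0 → 3 * μ^2 - 2 * t * μ + s = 0 := by
    intro μ h1
    by_contra h2
    exact h.case_two k μ (by rw [← hg, hcp, h1]) (by rw [← hg, hcp']; exact h2)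
  obtain ⟨μ, hμ⟩ := cubic_root t s
  have hμ' := hno μ hμ
  have hs' : s = 2 * t * μ - 3 * μ^2 := by linarith
  have hν := hno (t - 2 * μ) (by rw [hs'] at hμ ⊢; linear_combination hμ)
  have ht' : t = 3 * μ := by
    have : (t - 3 * μ)^2 = 0 := by rw [hs'] at hν; linear_combination hν
    have := pow_eq_zero_iff (two_ne_zero) |>.1 this
    linarith
  rw [ht'] at hs'
  have h3 : μ^3 = 1 := by rw [ht', hs'] at hμ; linear_combination hμ
  have hμ1 : μ = 1 := by
    have : (μ - 1) * (μ^2 + μ + 1) = 0 := by linear_combination h3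
    rcases mul_eq_zero.1 this with h | h
    · linarith
    · nlinarith [sq_nonneg (μ + 1), sq_nonneg μ]
  rw [hμ1] at ht' hs'
  have e : (g - 1)^3 = g^3 - (3:ℝ) • g^2 + (3:ℝ) • g - 1 := by
    have e3 : ∀ x : Mat3, (3:ℝ) • x = x + x + x := fun x => by module
    rw [e3, e3]; noncomm_ring
  rw [e, hCH, ht', hs']
  module

lemma centralizer_nil (N h : Mat3) (h3 : N ^ 3 = 0) (h2 : N ^ 2 ≠ 0) (hc : h * N = N * h) :
    ∃ x y z : ℝ, h = x • (1 : Mat3) + y • N + z • N ^ 2 := by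
  obtain ⟨v, hv⟩ : ∃ v : Fin 3 → ℝ, N ^ 2 *ᵥ v ≠ 0 := by
    by_contra hcon
    push Not at hcon
    apply h2
    apply Matrix.mulVec_injective
    ext1 v
    simpa using hcon v
  have n3 : N *ᵥ (N ^ 2 *ᵥ v) = 0 := by
    rw [Matrix.mulVec_mulVec, ← pow_succ', h3, Matrix.zero_mulVec]
  have n2 : N *ᵥ (N *ᵥ v) = N ^ 2 *ᵥ v := by
    rw [Matrix.mulVec_mulVec, pow_two]
  have hli : LinearIndependent ℝ ![v, N *ᵥ v, N ^ 2 *ᵥ v] := by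
    rw [Fintype.linearIndependent_iff]
    intro g hg
    simp only [Fin.sum_univ_three, Matrix.cons_val_zero, Matrix.cons_val_one, Matrix.cons_val] at hg
    have hg1 := congrArg (fun u => N *ᵥ u) hg
    simp only [Matrix.mulVec_add, Matrix.mulVec_smul, n3, n2, Matrix.mulVec_zero, smul_zero, add_zero] at hg1
    have hg2 := congrArg (fun u => N *ᵥ u) hg1
    simp only [Matrix.mulVec_add, Matrix.mulVec_smul, n3, n2, Matrix.mulVec_zero, smul_zero, add_zero] at hg2
    have g0 : g 0 = 0 := (smul_eq_zero.1 hg2).resolve_right hv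
    rw [g0, zero_smul, zero_add] at hg1
    have g1 : g 1 = 0 := (smul_eq_zero.1 hg1).resolve_right hv
    rw [g0, g1, zero_smul, zero_smul, zero_add, zero_add] at hg
    have g2 : g 2 = 0 := (smul_eq_zero.1 hg).resolve_right hv
    intro i
    fin_cases i
    · exact g0
    · exact g1
    · exact g2
  let b := basisOfLinearIndependentOfCardEqFinrank hli (by simp)
  have hb : ∀ i, b i = ![v, N *ᵥ v, N ^ 2 *ᵥ v] i := fun i => by simp [b]
  have hs := b.sum_repr (h *ᵥ v)
  simp only [Fin.sum_univ_three, hb, Matrix.cons_val_zero, Matrix.cons_val_one, Matrix.cons_val] at hs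
  generalize (b.repr (h *ᵥ v)) 0 = x at hs
  generalize (b.repr (h *ᵥ v)) 1 = y at hs
  generalize (b.repr (h *ᵥ v)) 2 = z at hs
  refine ⟨x, y, z, ?_⟩
  set K := x • (1 : Mat3) + y • N + z • N ^ 2 with hK
  have hKc : K * N = N * K := by
    rw [hK]
    simp only [add_mul, mul_add, Matrix.smul_mul, Matrix.mul_smul, one_mul, mul_one, pow_two, mul_assoc]
  have e0 : h *ᵥ v = K *ᵥ v := by
    rw [← hs, hK]
    simp only [Matrix.add_mulVec, Matrix.smul_mulVec, Matrix.one_mulVec]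
  have e1 : h *ᵥ (N *ᵥ v) = K *ᵥ (N *ᵥ v) := by
    rw [Matrix.mulVec_mulVec, Matrix.mulVec_mulVec, hc, hKc, ← Matrix.mulVec_mulVec, e0, Matrix.mulVec_mulVec]
  have e2 : h *ᵥ (N ^ 2 *ᵥ v) = K *ᵥ (N ^ 2 *ᵥ v) := by
    rw [← n2, Matrix.mulVec_mulVec (N *ᵥ v) h N, Matrix.mulVec_mulVec (N *ᵥ v) K N, hc, hKc, ← Matrix.mulVec_mulVec, e1, Matrix.mulVec_mulVec]
  have : Matrix.mulVecLin h = Matrix.mulVecLin K := by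
    apply b.ext
    intro i
    rw [hb]
    fin_cases i
    · simpa using e0
    · simpa using e1
    · simpa using e2
  apply Matrix.mulVec_injective
  ext1 u
  exact congrArg (fun f => f u) this

lemma RZ.case_Ia {S : Set Mat3} (hS : RG S) {M} (h : RZ M) (hMS : ∀ k, M k ∈ S) (k0 : ℤ × ℤ)
    (h2 : (M k0 - 1) ^ 2 ≠ 0) : False := by
  set N := M k0 - 1 with hN
  have h3 : N ^ 3 = 0 := h.unip k0
  have hN4 : N * N ^ 2 = 0 := by rw [← pow_succ', h3]
  have hN5 : N ^ 2 * N = 0 := by rw [← pow_succ, h3]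
  have hN6 : N ^ 2 * N ^ 2 = 0 := by rw [pow_two N, mul_assoc, ← pow_two, hN4, mul_zero]
  have hNN : N * N = N ^ 2 := (pow_two N).symm
  have hex : ∀ k, ∃ y z : ℝ, M k = 1 + y • N + z • N ^ 2 := by
    intro k
    obtain ⟨x, y, z, hxyz⟩ := centralizer_nil N (M k) h3 h2 (by
      rw [hN, mul_sub, sub_mul, h.comm k k0]; simp)
    have hu := h.unip k
    have hx : x = 1 := by
      have e : (M k - 1) = (x - 1) • (1 : Mat3) + y • N + z • N ^ 2 := by rw [hxyz]; module
      have e1 : (M k - 1) * N ^ 2 = (x - 1) • N ^ 2 := by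
        rw [e]
        simp only [add_mul, Matrix.smul_mul, one_mul, hN4, hN6, smul_zero, add_zero]
      have e2 : (M k - 1) ^ 3 * N ^ 2 = (x - 1) ^ 3 • N ^ 2 := by
        rw [pow_succ, mul_assoc, e1, Matrix.mul_smul, pow_two, mul_assoc, e1, Matrix.mul_smul, e1]
        module
      rw [hu, zero_mul] at e2
      have := (smul_eq_zero.1 e2.symm).resolve_right h2
      have := pow_eq_zero_iff (three_ne_zero) |>.1 this
      linarith
    exact ⟨y, z, by rw [hxyz, hx, one_smul]⟩
  choose y z hyz using hex
  have huniq : ∀ a b a' b' : ℝ, 1 + a • N + b • N ^ 2 = 1 + a' • N + b' • N ^ 2 → a = a' ∧ b = b' := by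
    intro a b a' b' hh
    have e1 := congrArg (fun X => X * N) hh
    simp only [add_mul, Matrix.smul_mul, one_mul, hNN, hN5, smul_zero, add_zero] at e1
    have e2 : (a - a') • N ^ 2 = 0 := by
      have : a • N ^ 2 = a' • N ^ 2 := add_left_cancel e1
      rw [sub_smul, this, sub_self]
    have e3 : a = a' := sub_eq_zero.1 ((smul_eq_zero.1 e2).resolve_right h2)
    refine ⟨e3, ?_⟩
    rw [e3] at hh
    have e4 : b • N ^ 2 = b' • N ^ 2 := add_left_cancel hh
    have e5 : (b - b') • N ^ 2 = 0 := by rw [sub_smul, e4, sub_self]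
    exact sub_eq_zero.1 ((smul_eq_zero.1 e5).resolve_right h2)
  have hmul : ∀ k l, y (k + l) = y k + y l ∧ z (k + l) = z k + z l + y k * y l := by
    intro k l
    apply huniq
    rw [← hyz, h.mul, hyz k, hyz l]
    simp only [add_mul, mul_add, Matrix.smul_mul, Matrix.mul_smul, one_mul, mul_one, hNN, hN5, hN4, hN6, smul_zero,
      add_zero]
    module
  set w : ℤ × ℤ → ℝ := fun k => z k - y k ^ 2 / 2 with hw
  have hzw : ∀ k, z k = w k + y k ^ 2 / 2 := fun k => by simp [hw]
  set f : ℤ × ℤ → ℝ × ℝ := fun k => (y k, w k) with hf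
  have hfadd : ∀ k l, f (k + l) = f k + f l := by
    intro k l
    simp only [hf, hw, (hmul k l).1, (hmul k l).2, Prod.mk_add_mk]
    congr 1
    ring
  have hff := add_formula f hfadd
  have hli : LinearIndependent ℝ ![f (1,0), f (0,1)] := by
    by_contra hcon
    obtain ⟨C, hC⟩ := dirichlet _ _ hcon
    apply hC
    refine (h.bdd (‖(1 : Mat3)‖ + C * ‖N‖ + (C + C ^ 2 / 2) * ‖N ^ 2‖)).subset ?_
    intro k hk
    simp only [Set.mem_ofPred_eq] at hk ⊢
    rw [← hff k] at hk
    have hy : |y k| ≤ C := (norm_fst_le (f k)).trans hk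
    have hw' : |w k| ≤ C := (norm_snd_le (f k)).trans hk
    have hz : |z k| ≤ C + C ^ 2 / 2 := by
      rw [hzw]
      refine (abs_add_le _ _).trans ?_
      have : |y k ^ 2 / 2| ≤ C ^ 2 / 2 := by
        rw [abs_of_nonneg (by positivity), ← sq_abs]
        gcongr
      linarith
    rw [hyz k]
    refine (norm_add_le _ _).trans ?_
    refine add_le_add ((norm_add_le _ _).trans ?_) ?_
    · rw [norm_smul, Real.norm_eq_abs]; gcongr
    · rw [norm_smul, Real.norm_eq_abs]; gcongr
  -- approximations
  have hspan : ∀ e : ℝ × ℝ, ∃ α β : ℝ, e = α • f (1,0) + β • f (0,1) := by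
    intro e
    let b := basisOfLinearIndependentOfCardEqFinrank hli (by simp)
    have hs := b.sum_repr e
    simp only [Fin.sum_univ_two, b, coe_basisOfLinearIndependentOfCardEqFinrank, Matrix.cons_val_zero, Matrix.cons_val_one] at hs
    exact ⟨_, _, hs.symm⟩
  have happ : ∀ n : ℕ, ∃ k, ‖f k - ((n:ℝ), -(n:ℝ)^2/2)‖ ≤ ‖f (1,0)‖ + ‖f (0,1)‖ := by
    intro n
    obtain ⟨α, β, hαβ⟩ := hspan ((n:ℝ), -(n:ℝ)^2/2)
    obtain ⟨k, hk⟩ := approx _ _ _ α β hαβ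
    exact ⟨k, by rw [hff k]; exact hk⟩
  choose κ hκ using happ
  set D := ‖f (1,0)‖ + ‖f (0,1)‖ with hD
  have h1n : (fun _ : ℕ => (1:ℝ)) =O[atTop] (fun n : ℕ => (n:ℝ)) := by
    apply IsBigO.of_bound 1
    filter_upwards [eventually_ge_atTop 1] with n hn
    simpa using hn
  have hy1 : (fun n => y (κ n) - n) =O[atTop] (fun _ : ℕ => (1:ℝ)) := by
    apply IsBigO.of_bound D
    filter_upwards with n
    rw [norm_one, mul_one]
    exact (norm_fst_le (f (κ n) - ((n:ℝ), -(n:ℝ)^2/2))).trans (hκ n)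
  have hw1 : (fun n => w (κ n) + (n:ℝ)^2/2) =O[atTop] (fun _ : ℕ => (1:ℝ)) := by
    apply IsBigO.of_bound D
    filter_upwards with n
    rw [norm_one, mul_one]
    have := (norm_snd_le (f (κ n) - ((n:ℝ), -(n:ℝ)^2/2))).trans (hκ n)
    simpa [hf, sub_neg_eq_add, neg_div] using this
  have hyn : (fun n => y (κ n)) =O[atTop] (fun n : ℕ => (n:ℝ)) := by
    have := (hy1.trans h1n).add (isBigO_refl (fun n : ℕ => (n:ℝ)) atTop)
    simpa using this
  have hy2 : (fun n => y (κ n) ^ 2 - (n:ℝ) ^ 2) =O[atTop] (fun n : ℕ => (n:ℝ)) := by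
    have := hy1.mul (hyn.add (isBigO_refl (fun n : ℕ => (n:ℝ)) atTop))
    refine (this.congr ?_ ?_)
    · intro n; ring
    · intro n; ring
  have hzn : (fun n => z (κ n)) =O[atTop] (fun n : ℕ => (n:ℝ)) := by
    have := (hw1.trans h1n).add (hy2.const_mul_left (1/2))
    refine this.congr_left ?_
    intro n
    rw [hzw]; ring
  have hconst : ∀ X : Mat3, (fun _ : ℕ => X) =O[atTop] (fun n : ℕ => (n:ℝ)) := fun X =>
    (isBigO_const_const X one_ne_zero atTop).trans h1n
  have hsm : ∀ (u : ℕ → ℝ) (X : Mat3), u =O[atTop] (fun n : ℕ => (n:ℝ)) →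
      (fun n => u n • X) =O[atTop] (fun n : ℕ => (n:ℝ)) := by
    intro u X hu
    have := hu.smul (isBigO_const_const X (one_ne_zero (α := ℝ)) atTop)
    simpa using this
  refine finish hS (fun n => M (κ n)) (fun n => hMS _) (N ^ 2) h2 ?_ ?_
  · simp only [hyz]
    exact ((hconst 1).add (hsm _ _ hyn)).add (hsm _ _ hzn)
  · have hinv : ∀ k, (M k)⁻¹ = 1 - y k • N + (y k ^ 2 - z k) • N ^ 2 := by
      intro k
      apply Matrix.inv_eq_right_inv
      rw [hyz k]
      simp only [add_mul, mul_add, mul_sub, sub_mul, Matrix.smul_mul, Matrix.mul_smul, one_mul, mul_one, hNN, hN5, hN4, hN6, smul_zero,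
        add_zero]
      module
    simp only [hinv]
    have := ((hconst 1).sub (hsm _ N hyn)).add (hsm _ (N ^ 2) (hy2.sub hzn))
    refine this.congr_left ?_
    intro n
    module

lemma rank_one_of_sq (N : Mat3) (h : N ^ 2 = 0) : ∃ v φ : Fin 3 → ℝ, N = vecMulVec v φ := by
  apply rank_one_of_adj
  have ht : N.trace = 0 := by
    have : IsNilpotent N.trace := Matrix.isNilpotent_trace_of_isNilpotent ⟨2, h⟩
    exact this.eq_zero
  rw [adj_formula, h, ht]
  simp

lemma RZ.case_Ib {M} (h : RZ M) (h2 : ∀ k, (M k - 1) ^ 2 = 0) :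
    (∃ v w φ : Fin 3 → ℝ, LinearIndependent ℝ ![v, w] ∧ φ ≠ 0 ∧ φ ⬝ᵥ v = 0 ∧ φ ⬝ᵥ w = 0 ∧
      ∀ k : ℤ × ℤ, M k = 1 + vecMulVec ((k.1:ℝ) • v + (k.2:ℝ) • w) φ) ∨
    (∃ v w φ : Fin 3 → ℝ, LinearIndependent ℝ ![v, w] ∧ φ ≠ 0 ∧ φ ⬝ᵥ v = 0 ∧ φ ⬝ᵥ w = 0 ∧
      ∀ k : ℤ × ℤ, M k = 1 + vecMulVec φ ((k.1:ℝ) • v + (k.2:ℝ) • w)) := by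
  set f : ℤ × ℤ → Mat3 := fun k => M k - 1 with hf
  have hMf : ∀ k, M k = 1 + f k := fun k => by simp [hf]
  have hsq : ∀ k, f k * f k = 0 := fun k => by rw [← pow_two]; exact h2 k
  have hcomm : ∀ k l, f k * f l = f l * f k := by
    intro k l
    have e : ∀ A B : Mat3, (A - 1) * (B - 1) = A * B - A - B + 1 := fun A B => by noncomm_ring
    simp only [hf, e]
    rw [h.comm k l]; abel
  have hprod : ∀ k l, f k * f l = 0 := by
    intro k l
    have e1 : f (k + l) = f k + f l + f k * f l := by
      simp only [hf, h.mul]; noncomm_ring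
    have e2 := hsq (k + l)
    have e3 : f k * f l * f k = 0 := by rw [mul_assoc, hcomm l k, ← mul_assoc, hsq, zero_mul]
    have e4 : f k * f l * f l = 0 := by rw [mul_assoc, hsq, mul_zero]
    have e5 : f l * (f k * f l) = 0 := by rw [← mul_assoc, hcomm l k, e4]
    have e6 : f k * (f k * f l) = 0 := by rw [← mul_assoc, hsq, zero_mul]
    have e7 : (f k * f l) * (f k * f l) = 0 := by rw [← mul_assoc, e3, zero_mul]
    rw [e1] at e2
    simp only [add_mul, mul_add, hsq, e3, e4, e5, e6, e7, hcomm l k, add_zero, zero_add] at e2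
    have e8 : (2:ℝ) • (f k * f l) = 0 := by rw [two_smul]; exact e2
    exact (smul_eq_zero.1 e8).resolve_left two_ne_zero
  have hfadd : ∀ k l, f (k + l) = f k + f l := by
    intro k l
    have e1 : f (k + l) = f k + f l + f k * f l := by
      simp only [hf, h.mul]; noncomm_ring
    rw [e1, hprod, add_zero]
  have hff := add_formula f hfadd
  have hli : LinearIndependent ℝ ![f (1,0), f (0,1)] := by
    by_contra hcon
    obtain ⟨C, hC⟩ := dirichlet _ _ hcon
    apply hC
    refine (h.bdd (‖(1 : Mat3)‖ + C)).subset ?_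
    intro k hk
    simp only [Set.mem_ofPred_eq] at hk ⊢
    rw [← hff k] at hk
    rw [hMf]
    exact (norm_add_le _ _).trans (by gcongr)
  obtain ⟨v, φ, hv⟩ := rank_one_of_sq (f (1,0)) (h2 _)
  obtain ⟨w, ψ, hw⟩ := rank_one_of_sq (f (0,1)) (h2 _)
  have hne1 : f (1,0) ≠ 0 := hli.ne_zero 0
  have hne2 : f (0,1) ≠ 0 := hli.ne_zero 1
  have hv0 : v ≠ 0 := by rintro rfl; simp [hv] at hne1
  have hw0 : w ≠ 0 := by rintro rfl; simp [hw] at hne2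
  have hφ0 : φ ≠ 0 := by rintro rfl; simp [hv] at hne1
  have hψ0 : ψ ≠ 0 := by rintro rfl; simp [hw] at hne2
  have hz : ∀ a b c d : Fin 3 → ℝ, a ≠ 0 → d ≠ 0 → vecMulVec a b * vecMulVec c d = 0 → b ⬝ᵥ c = 0 := by
    intro a b c d ha hd h0
    rw [Matrix.vecMulVec_mul_vecMulVec] at h0
    by_contra hne
    obtain ⟨i, hi⟩ := Function.ne_iff.1 ha
    obtain ⟨j, hj⟩ := Function.ne_iff.1 hd
    have := congrFun (congrFun h0 i) j
    simp [vecMulVec_apply] at this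
    tauto
  have o11 := hz v φ v φ hv0 hφ0 (by rw [← hv]; exact hprod _ _)
  have o12 := hz v φ w ψ hv0 hψ0 (by rw [← hv, ← hw]; exact hprod _ _)
  have o21 := hz w ψ v φ hw0 hφ0 (by rw [← hv, ← hw]; exact hprod _ _)
  have o22 := hz w ψ w ψ hw0 hψ0 (by rw [← hw]; exact hprod _ _)
  by_cases hpar : LinearIndependent ℝ ![φ, ψ]
  · right
    -- v and w are parallel
    have hvw : ∃ c : ℝ, w = c • v := by
      by_contra hcon
      push Not at hcon
      have hli2 : LinearIndependent ℝ ![v, w] := by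
        rw [LinearIndependent.pair_iff' hv0]
        exact fun a => (hcon a).symm
      have c1 : φ ⨯₃ ψ ≠ 0 := crossProduct_ne_zero_iff_linearIndependent.2 hpar
      have c2 : v ⨯₃ w ≠ 0 := crossProduct_ne_zero_iff_linearIndependent.2 hli2
      have par : ∀ θ : Fin 3 → ℝ, θ ⬝ᵥ v = 0 → θ ⬝ᵥ w = 0 → ∃ a : ℝ, a • (v ⨯₃ w) = θ := by
        intro θ h1 h2
        by_contra hno
        push Not at hno
        have := crossProduct_ne_zero_iff_linearIndependent.2 ((LinearIndependent.pair_iff' c2).2 hno)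
        apply this
        rw [← cross_anticomm, cross_cross_eq_smul_sub_smul', h2, dotProduct_comm v θ, h1]
        simp
      obtain ⟨a, ha⟩ := par φ o11 o12
      obtain ⟨b, hb⟩ := par ψ o21 o22
      apply c1
      rw [← ha, ← hb]
      simp
    obtain ⟨c, hc⟩ := hvw
    have hc0 : c ≠ 0 := by rintro rfl; simp [hc] at hw0
    refine ⟨φ, c • ψ, v, ?_, hv0, ?_, ?_, ?_⟩
    · rw [LinearIndependent.pair_iff]
      intro s t hst
      rw [LinearIndependent.pair_iff] at hli
      apply hli s t
      rw [hv, hw, hc]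
      ext i j
      have := congrFun hst j
      simp [vecMulVec_apply] at this ⊢
      linear_combination v i * this
    · rw [dotProduct_comm]; exact o11
    · rw [dotProduct_smul, dotProduct_comm, o21, smul_zero]
    · intro k
      rw [hMf, hff k, hv, hw, hc]
      ext i j
      simp [vecMulVec_apply]
      ring
  · left
    obtain ⟨c, hc⟩ : ∃ c : ℝ, ψ = c • φ := by
      by_contra hcon
      push Not at hcon
      apply hpar
      rw [LinearIndependent.pair_iff' hφ0]
      exact fun a => (hcon a).symm
    refine ⟨v, c • w, φ, ?_, hφ0, o11, ?_, ?_⟩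
    · rw [LinearIndependent.pair_iff]
      intro s t hst
      rw [LinearIndependent.pair_iff] at hli
      apply hli s t
      rw [hv, hw, hc]
      ext i j
      have := congrFun hst i
      simp [vecMulVec_apply] at this ⊢
      linear_combination φ j * this
    · rw [dotProduct_smul, o12, smul_zero]
    · intro k
      rw [hMf, hff k, hv, hw, hc]
      ext i j
      simp [vecMulVec_apply]
      ring

lemma mem_span_ker (v w φ e : Fin 3 → ℝ) (hli : LinearIndependent ℝ ![v, w]) (hφ : φ ≠ 0)
    (hv : φ ⬝ᵥ v = 0) (hw : φ ⬝ᵥ w = 0) (he : φ ⬝ᵥ e = 0) : ∃ α β : ℝ, e = α • v + β • w := by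
  by_contra hno
  push Not at hno
  have h3 : LinearIndependent ℝ (Matrix.of ![e, v, w]).row := by
    have : LinearIndependent ℝ (Fin.cons e ![v, w] : Fin 3 → Fin 3 → ℝ) := by
      rw [linearIndependent_finCons]
      refine ⟨hli, ?_⟩
      intro hmem
      simp only [Matrix.range_cons, Matrix.range_empty, Set.union_empty, Set.singleton_union] at hmem
      rw [Submodule.mem_span_pair] at hmem
      obtain ⟨a, b, hab⟩ := hmem
      exact hno a b hab.symm
    exact this
  rw [Matrix.linearIndependent_rows_iff_isUnit] at h3
  apply hφ
  apply Matrix.mulVec_injective_of_isUnit h3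
  rw [Matrix.mulVec_zero]
  ext i
  fin_cases i
  · simpa [Matrix.mulVec, dotProduct_comm] using he
  · simpa [Matrix.mulVec, dotProduct_comm] using hv
  · simpa [Matrix.mulVec, dotProduct_comm] using hw

lemma final_contra {S : Set Mat3} (hS : RG S) (hmov : Mov S) (v w φ : Fin 3 → ℝ)
    (hli : LinearIndependent ℝ ![v, w]) (hφ : φ ≠ 0) (hv : φ ⬝ᵥ v = 0) (hw : φ ⬝ᵥ w = 0)
    (hmem : ∀ k : ℤ × ℤ, 1 + vecMulVec ((k.1:ℝ) • v + (k.2:ℝ) • w) φ ∈ S) : False := by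
  obtain ⟨γ, hγ, hcr⟩ := hmov φ hφ
  have hdet := hS.det γ hγ
  have hu : IsUnit γ.det := by rw [hdet]; exact isUnit_one
  have e1 : γ * γ⁻¹ = 1 := Matrix.mul_nonsing_inv γ hu
  have e2 : γ⁻¹ * γ = 1 := Matrix.nonsing_inv_mul γ hu
  set ψ := φ ᵥ* γ⁻¹ with hψ
  set p := φ ⨯₃ ψ with hp
  set q := φ ⨯₃ p with hq
  have hφp : φ ⬝ᵥ p = 0 := dot_self_cross φ ψ
  have hψp : ψ ⬝ᵥ p = 0 := dot_cross_self φ ψ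
  have hφq : φ ⬝ᵥ q = 0 := dot_self_cross φ p
  have hψq : ψ ⬝ᵥ q ≠ 0 := by
    have : ψ ⬝ᵥ q = - (p ⬝ᵥ p) := by
      rw [hq, triple_product_permutation, triple_product_permutation, ← cross_anticomm, dotProduct_neg]
    rw [this, neg_ne_zero]
    intro h0
    exact hcr (dotProduct_self_eq_zero.1 h0)
  obtain ⟨α, β, hαβ⟩ := mem_span_ker v w φ q hli hφ hv hw hφq
  obtain ⟨α', β', hαβ'⟩ := mem_span_ker v w φ (γ⁻¹ *ᵥ p) hli hφ hv hw (by
    rw [Matrix.dotProduct_mulVec]; exact hψp)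
  have hx : ∀ n : ℕ, ∃ x : Fin 3 → ℝ, 1 + vecMulVec x φ ∈ S ∧ φ ⬝ᵥ x = 0 ∧ ‖x - (n:ℝ) • q‖ ≤ ‖v‖ + ‖w‖ := by
    intro n
    obtain ⟨k, hk⟩ := approx v w ((n:ℝ) • q) (n * α) (n * β) (by rw [hαβ]; module)
    exact ⟨_, hmem k, by simp [hv, hw], hk⟩
  have hy : ∀ n : ℕ, ∃ y : Fin 3 → ℝ, 1 + vecMulVec y φ ∈ S ∧ φ ⬝ᵥ y = 0 ∧ ‖y - (n:ℝ) • (γ⁻¹ *ᵥ p)‖ ≤ ‖v‖ + ‖w‖ := by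
    intro n
    obtain ⟨k, hk⟩ := approx v w ((n:ℝ) • (γ⁻¹ *ᵥ p)) (n * α') (n * β') (by rw [hαβ']; module)
    exact ⟨_, hmem k, by simp [hv, hw], hk⟩
  choose x hxS hxφ hxb using hx
  choose y' hyS hyφ hyb using hy
  set y := fun n => γ *ᵥ y' n with hydef
  have hyS2 : ∀ n, 1 + vecMulVec (y n) ψ ∈ S := by
    intro n
    have := hS.mul _ (hS.mul _ hγ _ (hyS n)) _ (hS.inv _ hγ)
    have e : γ * (1 + vecMulVec (y' n) φ) * γ⁻¹ = 1 + vecMulVec (y n) ψ := by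
      rw [mul_add, add_mul, mul_one, e1, Matrix.mul_vecMulVec, Matrix.vecMulVec_mul]
    rwa [e] at this
  have hyψ : ∀ n, ψ ⬝ᵥ y n = 0 := by
    intro n
    rw [hψ, hydef, Matrix.dotProduct_mulVec, Matrix.vecMul_vecMul, e2, Matrix.vecMul_one]
    exact hyφ n
  have h1n : (fun _ : ℕ => (1:ℝ)) =O[atTop] (fun n : ℕ => (n:ℝ)) := by
    apply IsBigO.of_bound 1
    filter_upwards [eventually_ge_atTop 1] with n hn
    simpa using hn
  have hx1 : (fun n => x n - (n:ℝ) • q) =O[atTop] (fun _ : ℕ => (1:ℝ)) := by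
    apply IsBigO.of_bound (‖v‖ + ‖w‖)
    filter_upwards with n
    rw [norm_one, mul_one]
    exact hxb n
  have hy0 : (fun n => y' n - (n:ℝ) • (γ⁻¹ *ᵥ p)) =O[atTop] (fun _ : ℕ => (1:ℝ)) := by
    apply IsBigO.of_bound (‖v‖ + ‖w‖)
    filter_upwards with n
    rw [norm_one, mul_one]
    exact hyb n
  have hlin : ∀ {F : Type} [NormedAddCommGroup F] [NormedSpace ℝ F] (L : (Fin 3 → ℝ) →ₗ[ℝ] F)
      (u : ℕ → Fin 3 → ℝ) (g : ℕ → ℝ), u =O[atTop] g → (fun n => L (u n)) =O[atTop] g := by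
    intro F _ _ L u g hu
    exact ((LinearMap.toContinuousLinearMap L).isBigO_comp u atTop).trans hu
  have hy1 : (fun n => y n - (n:ℝ) • p) =O[atTop] (fun _ : ℕ => (1:ℝ)) := by
    refine (hlin (Matrix.mulVecLin γ) _ _ hy0).congr_left ?_
    intro n
    simp only [Matrix.mulVecLin_apply, Matrix.mulVec_sub, Matrix.mulVec_smul, Matrix.mulVec_mulVec, e1,
      Matrix.one_mulVec, hydef]
  have hnq : ∀ u : Fin 3 → ℝ, (fun n : ℕ => (n:ℝ) • u) =O[atTop] (fun n : ℕ => (n:ℝ)) := by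
    intro u
    have := (isBigO_refl (fun n : ℕ => (n:ℝ)) atTop).smul (isBigO_const_const u (one_ne_zero (α := ℝ)) atTop)
    simpa using this
  have hxn : x =O[atTop] (fun n : ℕ => (n:ℝ)) := by
    refine ((hx1.trans h1n).add (hnq q)).congr_left ?_
    intro n; simp
  have hyn : y =O[atTop] (fun n : ℕ => (n:ℝ)) := by
    refine ((hy1.trans h1n).add (hnq p)).congr_left ?_
    intro n; simp
  let V : (Fin 3 → ℝ) → (Fin 3 → ℝ) →ₗ[ℝ] Mat3 := fun θ =>
    { toFun := fun u => vecMulVec u θ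
      map_add' := fun a b => by ext i j; simp [vecMulVec_apply, add_mul]
      map_smul' := fun a b => by ext i j; simp [vecMulVec_apply, mul_assoc] }
  let T : (Fin 3 → ℝ) → (Fin 3 → ℝ) →ₗ[ℝ] ℝ := fun θ =>
    { toFun := fun u => θ ⬝ᵥ u
      map_add' := fun a b => by simp
      map_smul' := fun a b => by simp }
  have hconst : ∀ X : Mat3, (fun _ : ℕ => X) =O[atTop] (fun n : ℕ => (n:ℝ)) := fun X =>
    (isBigO_const_const X one_ne_zero atTop).trans h1n
  have hφy : (fun n => φ ⬝ᵥ y n) =O[atTop] (fun _ : ℕ => (1:ℝ)) := by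
    refine (hlin (T φ) _ _ hy1).congr_left ?_
    intro n
    simp [T, hφp, dotProduct_sub]
  have hψx : (fun n => ψ ⬝ᵥ x n - n * (ψ ⬝ᵥ q)) =O[atTop] (fun _ : ℕ => (1:ℝ)) := by
    refine (hlin (T ψ) _ _ hx1).congr_left ?_
    intro n
    simp [T, dotProduct_sub]
  have hQ : (ψ ⬝ᵥ q) • vecMulVec p φ ≠ 0 := by
    intro h0
    have h0 := (smul_eq_zero.1 h0).resolve_left hψq
    obtain ⟨i, hi⟩ := Function.ne_iff.1 hcr
    obtain ⟨j, hj⟩ := Function.ne_iff.1 hφ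
    have := congrFun (congrFun h0 i) j
    rw [vecMulVec_apply] at this
    exact mul_ne_zero hi hj this
  refine finish hS (fun n => (1 + vecMulVec (x n) φ) * (1 + vecMulVec (y n) ψ))
    (fun n => hS.mul _ (hxS n) _ (hyS2 n)) ((ψ ⬝ᵥ q) • vecMulVec p φ) hQ ?_ ?_
  · have hb := (((hconst 1).add (hlin (V φ) _ _ hxn)).add (hlin (V ψ) _ _ hyn)).add
      ((hφy.smul (hlin (V ψ) _ _ hxn)).congr_right (g₂ := fun n : ℕ => (n:ℝ)) (fun n => by simp))
    refine hb.congr_left ?_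
    intro n
    simp only [V, LinearMap.coe_mk, AddHom.coe_mk, mul_add, add_mul, one_mul, mul_one,
      Matrix.vecMulVec_mul_vecMulVec]
    ext i j
    simp [vecMulVec_apply]
    ring
  · have hinv : ∀ n, ((1 + vecMulVec (x n) φ) * (1 + vecMulVec (y n) ψ))⁻¹
        = (1 - vecMulVec (y n) ψ) * (1 - vecMulVec (x n) φ) := by
      intro n
      apply Matrix.inv_eq_right_inv
      have a1 : vecMulVec (y n) ψ * vecMulVec (y n) ψ = 0 := by
        rw [Matrix.vecMulVec_mul_vecMulVec, hyψ]; simp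
      have a2 : vecMulVec (x n) φ * vecMulVec (x n) φ = 0 := by
        rw [Matrix.vecMulVec_mul_vecMulVec, hxφ]; simp
      have a3 : (1 + vecMulVec (y n) ψ) * (1 - vecMulVec (y n) ψ) = 1 := by
        have : (1 + vecMulVec (y n) ψ) * (1 - vecMulVec (y n) ψ) = 1 - vecMulVec (y n) ψ * vecMulVec (y n) ψ := by
          noncomm_ring
        rw [this, a1, sub_zero]
      have a4 : (1 + vecMulVec (x n) φ) * (1 - vecMulVec (x n) φ) = 1 := by
        have : (1 + vecMulVec (x n) φ) * (1 - vecMulVec (x n) φ) = 1 - vecMulVec (x n) φ * vecMulVec (x n) φ := by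
          noncomm_ring
        rw [this, a2, sub_zero]
      rw [mul_assoc, ← mul_assoc (1 + vecMulVec (y n) ψ), a3, one_mul, a4]
    have hb := (((hconst 1).sub (hlin (V φ) _ _ hxn)).sub (hlin (V ψ) _ _ hyn)).add
      (((hψx.smul (hlin (V φ) _ _ hyn)).congr_right (g₂ := fun n : ℕ => (n:ℝ)) (fun n => by simp)).add
      ((((isBigO_refl (fun n : ℕ => (n:ℝ)) atTop).const_mul_left (ψ ⬝ᵥ q)).smul (hlin (V φ) _ _ hy1)).congr_right
        (g₂ := fun n : ℕ => (n:ℝ)) (fun n => by simp)))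
    refine hb.congr_left ?_
    intro n
    simp only [hinv]
    simp only [V, LinearMap.coe_mk, AddHom.coe_mk, mul_sub, sub_mul, one_mul, mul_one,
      Matrix.vecMulVec_mul_vecMulVec]
    ext i j
    simp [vecMulVec_apply]
    ring

lemma sl_cross (φ : Fin 3 → ℝ) (hφ : φ ≠ 0) :
    (∃ g : Matrix.SpecialLinearGroup (Fin 3) ℝ, φ ⨯₃ (φ ᵥ* (g : Mat3)) ≠ 0) ∧
    (∃ g : Matrix.SpecialLinearGroup (Fin 3) ℝ, φ ⨯₃ ((g : Mat3) *ᵥ φ) ≠ 0) := by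
  have main : ∃ g : Matrix.SpecialLinearGroup (Fin 3) ℝ, φ ⨯₃ (φ ᵥ* (g : Mat3)) ≠ 0 := by
    by_contra hcon
    push Not at hcon
    have d1 : (!![1,1,0;0,1,0;0,0,1] : Mat3).det = 1 := by simp [Matrix.det_fin_three]
    have d2 : (!![1,0,0;0,1,1;0,0,1] : Mat3).det = 1 := by simp [Matrix.det_fin_three]
    have d3 : (!![1,0,0;0,1,0;1,0,1] : Mat3).det = 1 := by simp [Matrix.det_fin_three]
    have c1 := congrFun (hcon ⟨_, d1⟩) 2
    have c2 := congrFun (hcon ⟨_, d2⟩) 0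
    have c3 := congrFun (hcon ⟨_, d3⟩) 1
    simp [cross_apply, vecMul, dotProduct, Fin.sum_univ_three] at c1 c2 c3
    have e1 : φ 0 * (φ 0 + φ 1) - φ 1 * φ 0 = 0 := c1
    have e2 : φ 1 * (φ 1 + φ 2) - φ 2 * φ 1 = 0 := c2
    have e3 : φ 2 * (φ 0 + φ 2) - φ 0 * φ 2 = 0 := c3
    have f0 : φ 0 = 0 := by
      have : φ 0 ^ 2 = 0 := by linear_combination e1
      exact (pow_eq_zero_iff two_ne_zero).1 this
    have f1 : φ 1 = 0 := by
      have : φ 1 ^ 2 = 0 := by linear_combination e2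
      exact (pow_eq_zero_iff two_ne_zero).1 this
    have f2 : φ 2 = 0 := by
      have : φ 2 ^ 2 = 0 := by linear_combination e3
      exact (pow_eq_zero_iff two_ne_zero).1 this
    apply hφ
    ext i
    fin_cases i
    · exact f0
    · exact f1
    · exact f2
  refine ⟨main, ?_⟩
  obtain ⟨g, hg⟩ := main
  refine ⟨g.transpose, ?_⟩
  rw [Matrix.SpecialLinearGroup.coe_transpose, Matrix.mulVec_transpose]
  exact hg

lemma mov_SG (Γ : Subgroup (Matrix.SpecialLinearGroup (Fin 3) ℝ)) (hd : IsZariskiDense Γ) :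
    Mov (SG Γ) ∧ Mov {g | gᵀ ∈ SG Γ} := by
  constructor
  · intro φ hφ
    by_contra hcon
    push Not at hcon
    obtain ⟨g, hg⟩ := (sl_cross φ hφ).1
    apply hg
    have hz : ∀ γ ∈ Γ, φ ⨯₃ (φ ᵥ* (γ : Mat3)) = 0 := by
      intro γ hγ
      have := hcon ((γ⁻¹ : Matrix.SpecialLinearGroup (Fin 3) ℝ) : Mat3) ⟨γ⁻¹, Γ.inv_mem hγ, rfl⟩
      rwa [← sl_inv, inv_inv] at this
    ext i
    let p : MvPolynomial (Fin 3 × Fin 3) ℝ :=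
      ((fun i => MvPolynomial.C (φ i)) ⨯₃
        (fun j => ∑ i, MvPolynomial.C (φ i) * MvPolynomial.X (i, j))) i
    have hp : ∀ g : Mat3, MvPolynomial.eval (fun ij => g ij.1 ij.2) p = (φ ⨯₃ (φ ᵥ* g)) i := by
      intro g
      fin_cases i <;> simp [p, cross_apply, vecMul, dotProduct, Fin.sum_univ_three]
    have := hd p (fun γ hγ => by rw [hp, hz γ hγ]; rfl) g
    rw [hp] at this
    exact this
  · intro φ hφ
    by_contra hcon
    push Not at hcon
    obtain ⟨g, hg⟩ := (sl_cross φ hφ).2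
    apply hg
    have hz : ∀ γ ∈ Γ, φ ⨯₃ ((γ : Mat3) *ᵥ φ) = 0 := by
      intro γ hγ
      have := hcon (((γ⁻¹ : Matrix.SpecialLinearGroup (Fin 3) ℝ) : Mat3)ᵀ) ⟨γ⁻¹, Γ.inv_mem hγ, by simp⟩
      rwa [← Matrix.transpose_nonsing_inv, ← sl_inv, inv_inv, Matrix.vecMul_transpose] at this
    ext i
    let p : MvPolynomial (Fin 3 × Fin 3) ℝ :=
      ((fun i => MvPolynomial.C (φ i)) ⨯₃
        (fun j => ∑ i, MvPolynomial.X (j, i) * MvPolynomial.C (φ i))) i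
    have hp : ∀ g : Mat3, MvPolynomial.eval (fun ij => g ij.1 ij.2) p = (φ ⨯₃ (g *ᵥ φ)) i := by
      intro g
      fin_cases i <;> simp [p, cross_apply, mulVec, dotProduct, Fin.sum_univ_three]
    have := hd p (fun γ hγ => by rw [hp, hz γ hγ]; rfl) g
    rw [hp] at this
    exact this

/-- A Zariski-dense regular subgroup of SL(3,ℝ) contains no ℤ² subgroup. -/
theorem no_Z2_in_zariski_dense_regular_subgroup
    (Γ : Subgroup (Matrix.SpecialLinearGroup (Fin 3) ℝ))
    (hreg : IsRegularSubgroup Γ) (hdense : IsZariskiDense Γ) :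
    ¬ ∃ φ : Multiplicative (ℤ × ℤ) →* Γ, Function.Injective φ := by
  rintro ⟨ρ, hρ⟩
  have hS := rg_SG Γ hreg
  obtain ⟨hm1, hm2⟩ := mov_SG Γ hdense
  set M : ℤ × ℤ → Mat3 := fun k =>
    ((ρ (Multiplicative.ofAdd k) : Matrix.SpecialLinearGroup (Fin 3) ℝ) : Mat3) with hM
  have hMS : ∀ k, M k ∈ SG Γ := fun k => ⟨_, (ρ (Multiplicative.ofAdd k)).2, rfl⟩
  have hinj : Function.Injective M := by
    intro k l hkl
    have h1 : (ρ (Multiplicative.ofAdd k) : Matrix.SpecialLinearGroup (Fin 3) ℝ)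
      = ρ (Multiplicative.ofAdd l) := Subtype.ext hkl
    exact Multiplicative.ofAdd.injective (hρ (Subtype.ext h1))
  have hneg : ∀ k, M (-k) = (M k)⁻¹ := by
    intro k
    simp only [hM, ofAdd_neg, map_inv]
    exact sl_inv _
  have hZ : RZ M := by
    refine ⟨?_, ?_, ?_, ?_⟩
    · simp [hM]
    · intro k l
      simp [hM]
    · intro k; exact hS.det _ (hMS k)
    · intro C
      refine ((hS.fin C).preimage (f := M) hinj.injOn).subset ?_
      intro k hk
      simp only [Set.mem_ofPred_eq, Set.mem_preimage] at hk ⊢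
      rw [hneg] at hk
      exact ⟨hMS k, hk⟩
  by_cases hall : ∀ k, (M k - 1) ^ 2 = 0
  · rcases hZ.case_Ib hall with ⟨v, w, φ, h1, h2, h3, h4, h5⟩ | ⟨v, w, φ, h1, h2, h3, h4, h5⟩
    · exact final_contra hS hm1 v w φ h1 h2 h3 h4 (fun k => by rw [← h5]; exact hMS k)
    · refine final_contra hS.transpose hm2 v w φ h1 h2 h3 h4 (fun k => ?_)
      have : (1 + vecMulVec ((k.1:ℝ) • v + (k.2:ℝ) • w) φ)ᵀ = M k := by
        rw [h5, Matrix.transpose_add, Matrix.transpose_one, Matrix.transpose_vecMulVec]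
      change (1 + vecMulVec ((k.1:ℝ) • v + (k.2:ℝ) • w) φ)ᵀ ∈ SG Γ
      rw [this]
      exact hMS k
  · push Not at hall
    obtain ⟨k0, hk0⟩ := hall
    exact hZ.case_Ia hS hMS k0 hk0
end

section
/- If ρ : ℤ² → SL(3,ℝ) is a regular homomorphism, then the image of ρ is unipotent: for every v ∈ ℤ², the matrix ρ(v) − 1 is nilpotent, i.e., (ρ(v) − 1)³ = 0 as a 3×3 real matrix. -/
open Filter

lemma aux_CH (M : Matrix (Fin 3) (Fin 3) ℝ) (h1 : M.trace = 3) (h2 : M.adjugate.trace = 3)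
    (hd : M.det = 1) : (M - 1) ^ 3 = 0 := by
  have key : M * M * M - M.trace • (M * M) + M.adjugate.trace • M - M.det • 1 = 0 := by
    ext i j
    fin_cases i <;> fin_cases j <;>
      simp [Matrix.trace, Matrix.det_fin_three, Matrix.adjugate_fin_three, Matrix.mul_apply,
        Fin.sum_univ_three, Matrix.diag] <;> ring
  rw [h1, h2, hd] at key
  rw [← key]
  have : (3 : ℝ) • (M * M) = M * M + M * M + M * M := by module
  rw [this]
  have : (3 : ℝ) • M = M + M + M := by module
  rw [this, one_smul]
  noncomm_ring

lemma aux_detlam (M : Matrix (Fin 3) (Fin 3) ℝ) (hd : M.det = 1) (l : ℝ) :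
    (M - l • (1 : Matrix (Fin 3) (Fin 3) ℝ)).det
      = - (l ^ 3 - M.trace * l ^ 2 + M.adjugate.trace * l - 1) := by
  rw [← hd]
  simp [Matrix.trace, Matrix.det_fin_three, Matrix.adjugate_fin_three,
        Fin.sum_univ_three, Matrix.diag]
  ring

lemma aux_tradj (M : Matrix (Fin 3) (Fin 3) ℝ) (l : ℝ) :
    (M - l • (1 : Matrix (Fin 3) (Fin 3) ℝ)).adjugate.trace
      = 3 * l ^ 2 - 2 * M.trace * l + M.adjugate.trace := by
  simp [Matrix.trace, Matrix.adjugate_fin_three,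
        Fin.sum_univ_three, Matrix.diag]
  ring

lemma aux_root (a b : ℝ) : ∃ l : ℝ, l ^ 3 - a * l ^ 2 + b * l - 1 = 0 := by
  have hc : Continuous (fun l : ℝ => l ^ 3 - a * l ^ 2 + b * l - 1) := by fun_prop
  set K := 1 + |a| + |b| with hK
  have ha := abs_nonneg a
  have hb := abs_nonneg b
  have ha1 := le_abs_self a
  have ha2 := neg_abs_le a
  have hb1 := le_abs_self b
  have hb2 := neg_abs_le b
  have hK1 : 1 ≤ K := by linarith
  have hKK : K ≤ K ^ 2 := by nlinarith
  have h1 : (-K) ^ 3 - a * (-K) ^ 2 + b * (-K) - 1 ≤ 0 := by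
    have e : (-K) ^ 3 - a * (-K) ^ 2 + b * (-K) - 1 = -(K^2 * (1 + |a| + |b|)) - a * K^2 - b * K - 1 := by
      rw [← hK]; ring
    rw [e]
    nlinarith [mul_nonneg (sq_nonneg K) (by linarith : 0 ≤ |a| + a), mul_nonneg hb (by linarith : 0 ≤ K^2 - K), mul_nonneg (by linarith : 0 ≤ K) (by linarith : 0 ≤ |b| + b)]
  have h2 : 0 ≤ K ^ 3 - a * K ^ 2 + b * K - 1 := by
    have e : K ^ 3 - a * K ^ 2 + b * K - 1 = K^2 * (1 + |a| + |b|) - a * K^2 + b * K - 1 := by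
      rw [← hK]; ring
    rw [e]
    nlinarith [mul_nonneg (sq_nonneg K) (by linarith : 0 ≤ |a| - a), mul_nonneg hb (by linarith : 0 ≤ K^2 - K), mul_nonneg (by linarith : 0 ≤ K) (by linarith : 0 ≤ |b| + b)]
  obtain ⟨l, hl⟩ := mem_range_of_exists_le_of_exists_ge hc ⟨-K, h1⟩ ⟨K, h2⟩
  exact ⟨l, hl⟩

lemma aux_simple (M : Matrix (Fin 3) (Fin 3) ℝ) (hd : M.det = 1) (h : (M - 1) ^ 3 ≠ 0) :
    ∃ l : ℝ, (M - l • (1 : Matrix (Fin 3) (Fin 3) ℝ)).det = 0 ∧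
      (M - l • (1 : Matrix (Fin 3) (Fin 3) ℝ)).adjugate.trace ≠ 0 := by
  by_contra! hcon
  apply h
  simp only [aux_detlam M hd, aux_tradj] at hcon
  set a := M.trace
  set b := M.adjugate.trace
  obtain ⟨l, hl⟩ := aux_root a b
  have h1 := hcon l (by rw [hl]; simp)
  have hb : b = -(3 * l ^ 2 - 2 * a * l) := by linarith
  have h2 := hcon (a - 2 * l) (by
    have h3 : 1 = l ^ 3 - a * l ^ 2 + b * l := by linarith
    rw [hb] at h3 ⊢
    linear_combination h3)
  have h4 : (a - 3 * l) ^ 2 = 0 := by rw [hb] at h2; linarith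
  have h5 : a = 3 * l := by
    have := pow_eq_zero_iff (two_ne_zero) |>.1 h4
    linarith
  have h6 : l ^ 3 = 1 := by rw [hb, h5] at hl; linarith
  have h7 : l = 1 := by
    have : (l - 1) * (l ^ 2 + l + 1) = 0 := by linarith
    rcases mul_eq_zero.1 this with h | h
    · linarith
    · nlinarith [sq_nonneg (l + 1/2)]
  have ha3 : a = 3 := by rw [h5, h7]; norm_num
  exact aux_CH M ha3 (by change b = 3; rw [hb, ha3, h7]; norm_num) hd

lemma aux_cross (w : Fin 3 → ℝ) (hw : w ≠ 0) : ∃ p q : Fin 3 → ℝ,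
    w 0 = p 1 * q 2 - p 2 * q 1 ∧ w 1 = p 2 * q 0 - p 0 * q 2 ∧ w 2 = p 0 * q 1 - p 1 * q 0 := by
  have : w 0 ≠ 0 ∨ w 1 ≠ 0 ∨ w 2 ≠ 0 := by
    by_contra! hc
    apply hw
    ext i
    fin_cases i <;> simp [hc]
  rcases this with h | h | h
  · refine ⟨![-w 1 / w 0, 1, 0], ![-w 2, 0, w 0], ?_, ?_, ?_⟩ <;> simp <;> field_simp
  · refine ⟨![0, -w 2 / w 1, 1], ![w 1, -w 0, 0], ?_, ?_, ?_⟩ <;> simp <;> field_simp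
  · refine ⟨![1, 0, -w 0 / w 2], ![0, w 2, -w 1], ?_, ?_, ?_⟩ <;> simp <;> field_simp

lemma aux_rank1 (F : Matrix (Fin 3) (Fin 3) ℝ) (hF : F.adjugate = 0) (ht : F.trace ≠ 0) :
    ∃ u w : Fin 3 → ℝ, ∀ i j, F i j = u i * w j := by
  have hne : F ≠ 0 := by rintro rfl; simp at ht
  obtain ⟨i, j, hij⟩ : ∃ i j, F i j ≠ 0 := by
    by_contra! hc
    exact hne (by ext i j; simp [hc])
  have hm : ∀ k l, F k l * F i j = F k j * F i l := by
    rw [Matrix.adjugate_fin_three] at hF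
    have h00 := congrFun (congrFun hF 0) 0
    have h01 := congrFun (congrFun hF 0) 1
    have h02 := congrFun (congrFun hF 0) 2
    have h10 := congrFun (congrFun hF 1) 0
    have h11 := congrFun (congrFun hF 1) 1
    have h12 := congrFun (congrFun hF 1) 2
    have h20 := congrFun (congrFun hF 2) 0
    have h21 := congrFun (congrFun hF 2) 1
    have h22 := congrFun (congrFun hF 2) 2
    simp at h00 h01 h02 h10 h11 h12 h20 h21 h22
    clear hij hne ht hF
    intro k l
    fin_cases i <;> fin_cases j <;> fin_cases k <;> fin_cases l <;> simp <;> linarith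
  refine ⟨fun k => F k j, fun l => F i l / F i j, fun k l => ?_⟩
  have := hm k l
  field_simp
  linarith

lemma aux_conj (F : Matrix (Fin 3) (Fin 3) ℝ) (hF : F.adjugate = 0) (ht : F.trace ≠ 0) :
    ∃ g : Matrix (Fin 3) (Fin 3) ℝ, g.det ≠ 0 ∧
      F * g = g * (!![0,0,0;0,0,0;0,0,F.trace]) := by
  obtain ⟨u, w, huw⟩ := aux_rank1 F hF ht
  have htr : F.trace = u 0 * w 0 + u 1 * w 1 + u 2 * w 2 := by
    simp [Matrix.trace, Fin.sum_univ_three, huw]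
  have hw : w ≠ 0 := by
    rintro rfl
    simp at htr
    exact ht htr
  obtain ⟨p, q, h0, h1, h2⟩ := aux_cross w hw
  refine ⟨!![p 0, q 0, u 0; p 1, q 1, u 1; p 2, q 2, u 2], ?_, ?_⟩
  · have : Matrix.det !![p 0, q 0, u 0; p 1, q 1, u 1; p 2, q 2, u 2] = F.trace := by
      rw [htr, Matrix.det_fin_three, h0, h1, h2]; simp; ring
    rwa [this]
  · rw [htr]
    ext i j
    fin_cases i <;> fin_cases j <;> simp [Matrix.mul_apply, Fin.sum_univ_three, huw, h0, h1, h2] <;> ring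

lemma aux_dirichlet (φ : ℤ × ℤ → ℝ) (hφ : ∀ v w, φ (v + w) = φ v + φ w) :
    ∃ c : ℝ, ∃ v : ℕ → ℤ × ℤ, (∀ n m, v n = v m ∨ v n = - v m → n = m) ∧
      ∀ n, |φ (v n)| ≤ c := by
  let ψ : ℤ × ℤ →+ ℝ := AddMonoidHom.mk' φ hφ
  have hlin : ∀ m n : ℤ, φ (m, n) = m * φ (1, 0) + n * φ (0, 1) := by
    intro m n
    have e : ((m, n) : ℤ × ℤ) = m • (1, 0) + n • (0, 1) := by simp
    have : ψ (m, n) = m * ψ (1, 0) + n * ψ (0, 1) := by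
      rw [e, map_add, map_zsmul, map_zsmul]; simp
    exact this
  by_cases ha : φ (1, 0) = 0
  · refine ⟨0, fun n => (n, 0), ?_, ?_⟩
    · intro n m h
      simp at h
      omega
    · intro n; rw [hlin]; simp [ha]
  · refine ⟨|φ (1, 0)|, fun n => (-⌊n * φ (0, 1) / φ (1, 0)⌋, n), ?_, ?_⟩
    · intro n m h
      simp only [Prod.mk.injEq, Prod.neg_mk] at h
      omega
    · intro n
      rw [hlin]
      have : ((-⌊n * φ (0, 1) / φ (1, 0)⌋ : ℤ) : ℝ) * φ (1, 0) + ((n : ℤ) : ℝ) * φ (0, 1)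
        = Int.fract (n * φ (0, 1) / φ (1, 0)) * φ (1, 0) := by
        rw [Int.fract]; push_cast; field_simp; ring
      rw [this, abs_mul, abs_of_nonneg (Int.fract_nonneg _)]
      exact mul_le_of_le_one_left (abs_nonneg _) (Int.fract_lt_one _).le

/-- the key additive character -/
lemma aux_key (δ : ℝ) (x y : ℤ × ℤ → ℝ)
    (hx : ∀ v w, x (v + w) = x v * x w + δ * (y v * y w))
    (hy : ∀ v w, y (v + w) = x v * y w + y v * x w)
    (hD : ∀ v, x v ^ 2 - δ * y v ^ 2 ≠ 0) :
    ∃ φ : ℤ × ℤ → ℝ, (∀ v w, φ (v + w) = φ v + φ w) ∧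
      ∀ c, ∃ C, ∀ v, |φ v| ≤ c → x v ^ 2 + y v ^ 2 ≤ C * |x v ^ 2 - δ * y v ^ 2| := by
  rcases lt_trichotomy δ 0 with h | h | h
  · refine ⟨fun _ => 0, by simp, fun c => ⟨1 + 1 / (-δ), fun v _ => ?_⟩⟩
    have h' : 0 < -δ := by linarith
    have e : |x v ^ 2 - δ * y v ^ 2| = x v ^ 2 + (-δ) * y v ^ 2 := by
      rw [abs_of_nonneg]
      · ring
      · nlinarith [sq_nonneg (x v), mul_nonneg h'.le (sq_nonneg (y v))]
    rw [e]
    have h0 : δ ≠ 0 := h.ne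
    have : (1 + 1 / (-δ)) * (x v ^ 2 + (-δ) * y v ^ 2)
      = x v ^ 2 + y v ^ 2 + (1 / (-δ) * x v ^ 2 + (-δ) * y v ^ 2) := by
      field_simp; ring
    rw [this]
    have : 0 ≤ 1 / (-δ) * x v ^ 2 + (-δ) * y v ^ 2 := by positivity
    linarith
  · subst h
    have hx0 : ∀ v, x v ≠ 0 := fun v h0 => hD v (by rw [h0]; ring)
    refine ⟨fun v => y v / x v, ?_, fun c => ⟨1 + c ^ 2, fun v hv => ?_⟩⟩
    · intro v w
      have := hx0 v
      have := hx0 w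
      simp only [hx, hy, zero_mul, add_zero]
      field_simp
      ring
    · have h1 : (y v / x v) ^ 2 ≤ c ^ 2 := by
        rw [← sq_abs]
        exact pow_le_pow_left₀ (abs_nonneg _) hv 2
      have h2 : y v ^ 2 = (y v / x v) ^ 2 * x v ^ 2 := by
        have := hx0 v
        field_simp
      have h3 : |x v ^ 2 - 0 * y v ^ 2| = x v ^ 2 := by
        rw [zero_mul, sub_zero, abs_of_nonneg (sq_nonneg _)]
      rw [h3]
      nlinarith [mul_le_mul_of_nonneg_right h1 (sq_nonneg (x v))]
  · obtain ⟨r, hr, rfl⟩ : ∃ r : ℝ, 0 < r ∧ δ = r ^ 2 :=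
      ⟨Real.sqrt δ, Real.sqrt_pos.2 h, (Real.sq_sqrt h.le).symm⟩
    have hp : ∀ v, x v + r * y v ≠ 0 := fun v h0 => hD v (by
      have : x v ^ 2 - r ^ 2 * y v ^ 2 = (x v + r * y v) * (x v - r * y v) := by ring
      rw [this, h0, zero_mul])
    have hm : ∀ v, x v - r * y v ≠ 0 := fun v h0 => hD v (by
      have : x v ^ 2 - r ^ 2 * y v ^ 2 = (x v + r * y v) * (x v - r * y v) := by ring
      rw [this, h0, mul_zero])
    refine ⟨fun v => Real.log (x v + r * y v) - Real.log (x v - r * y v), ?_,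
      fun c => ⟨(1 + 1 / r ^ 2) * Real.exp c, fun v hv => ?_⟩⟩
    · intro v w
      have e1 : x (v + w) + r * y (v + w) = (x v + r * y v) * (x w + r * y w) := by
        rw [hx, hy]; ring
      have e2 : x (v + w) - r * y (v + w) = (x v - r * y v) * (x w - r * y w) := by
        rw [hx, hy]; ring
      simp only [e1, e2]
      rw [Real.log_mul (hp v) (hp w), Real.log_mul (hm v) (hm w)]
      ring
    · set s := x v + r * y v with hs
      set t := x v - r * y v with ht
      have hs0 : 0 < |s| := abs_pos.2 (hp v)
      have ht0 : 0 < |t| := abs_pos.2 (hm v)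
      change |Real.log s - Real.log t| ≤ c at hv
      rw [← Real.log_abs s, ← Real.log_abs t, abs_le] at hv
      have h1 : |s| ≤ Real.exp c * |t| := by
        rw [← Real.exp_log hs0]
        rw [← Real.exp_log ht0]
        rw [← Real.exp_add, Real.exp_le_exp]; linarith [hv.2]
      have h2 : |t| ≤ Real.exp c * |s| := by
        rw [← Real.exp_log ht0]
        rw [← Real.exp_log hs0]
        rw [← Real.exp_add, Real.exp_le_exp]; linarith [hv.1]
      have e : x v ^ 2 - r ^ 2 * y v ^ 2 = s * t := by rw [hs, ht]; ring
      have ex : x v ^ 2 + r ^ 2 * y v ^ 2 = (|s| ^ 2 + |t| ^ 2) / 2 := by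
        rw [sq_abs, sq_abs, hs, ht]; ring
      rw [e, abs_mul]
      have h3 : x v ^ 2 + r ^ 2 * y v ^ 2 ≤ Real.exp c * (|s| * |t|) := by
        rw [ex]
        nlinarith [mul_le_mul_of_nonneg_right h1 hs0.le, mul_le_mul_of_nonneg_right h2 ht0.le]
      have h4 : x v ^ 2 + y v ^ 2 ≤ (1 + 1 / r ^ 2) * (x v ^ 2 + r ^ 2 * y v ^ 2) := by
        have : (1 + 1 / r ^ 2) * (x v ^ 2 + r ^ 2 * y v ^ 2)
          = x v ^ 2 + y v ^ 2 + (1 / r ^ 2 * x v ^ 2 + r ^ 2 * y v ^ 2) := by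
          field_simp; ring
        rw [this]
        have : 0 ≤ 1 / r ^ 2 * x v ^ 2 + r ^ 2 * y v ^ 2 := by positivity
        linarith
      calc _ ≤ _ := h4
        _ ≤ (1 + 1 / r ^ 2) * (Real.exp c * (|s| * |t|)) :=
          mul_le_mul_of_nonneg_left h3 (by positivity)
        _ = _ := by ring

/-- simultaneous form of commuting 2×2 blocks -/
lemma aux_block (a b c d : ℤ × ℤ → ℝ)
    (ha : ∀ v w, a (v + w) = a v * a w + b v * c w)
    (hb : ∀ v w, b (v + w) = a v * b w + b v * d w)
    (hc : ∀ v w, c (v + w) = c v * a w + d v * c w)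
    (hd : ∀ v w, d (v + w) = c v * b w + d v * d w) :
    ∃ (k1 k2 k3 : ℝ) (x y : ℤ × ℤ → ℝ),
      (∀ v, a v = x v + y v * k1) ∧ (∀ v, d v = x v - y v * k1) ∧
      (∀ v, b v = y v * k2) ∧ (∀ v, c v = y v * k3) ∧
      (∀ v w, x (v + w) = x v * x w + (k1 ^ 2 + k2 * k3) * (y v * y w)) ∧
      (∀ v w, y (v + w) = x v * y w + y v * x w) := by
  have main : ∃ (k1 k2 k3 : ℝ) (y : ℤ × ℤ → ℝ), (k1 ≠ 0 ∨ k2 ≠ 0 ∨ k3 ≠ 0) ∧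
      (∀ v, (a v - d v) / 2 = y v * k1) ∧ (∀ v, b v = y v * k2) ∧ (∀ v, c v = y v * k3) := by
    by_cases h : ∀ v, (a v - d v) / 2 = 0 ∧ b v = 0 ∧ c v = 0
    · exact ⟨1, 0, 0, fun _ => 0, by simp, fun v => by simp [(h v).1], fun v => by simp [h v],
        fun v => by simp [h v]⟩
    · push Not at h
      obtain ⟨z, hz⟩ := h
      have h1 : ∀ v, b v * c z = b z * c v := fun v => by
        have e1 := ha v z
        have e2 := ha z v
        rw [add_comm] at e1
        linarith
      have h2 : ∀ v, (a v - d v) * b z = (a z - d z) * b v := fun v => by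
        have e1 := hb v z
        have e2 := hb z v
        rw [add_comm] at e1
        linarith
      have h3 : ∀ v, (a v - d v) * c z = (a z - d z) * c v := fun v => by
        have e1 := hc v z
        have e2 := hc z v
        rw [add_comm] at e1
        linarith
      have hz' : (a z - d z) / 2 ≠ 0 ∨ b z ≠ 0 ∨ c z ≠ 0 := by tauto
      refine ⟨(a z - d z) / 2, b z, c z, ?_⟩
      rcases hz' with h | h | h
      · have h' : a z - d z ≠ 0 := by intro h0; apply h; rw [h0]; simp
        refine ⟨fun v => (a v - d v) / (a z - d z), Or.inl h, fun v => ?_, fun v => ?_, fun v => ?_⟩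
        · field_simp
        · field_simp; linarith [h2 v]
        · field_simp; linarith [h3 v]
      · refine ⟨fun v => b v / b z, Or.inr (Or.inl h), fun v => ?_, fun v => ?_, fun v => ?_⟩
        · field_simp; linarith [h2 v]
        · field_simp
        · field_simp; linarith [h1 v]
      · refine ⟨fun v => c v / c z, Or.inr (Or.inr h), fun v => ?_, fun v => ?_, fun v => ?_⟩
        · field_simp; linarith [h3 v]
        · field_simp; linarith [h1 v]
        · field_simp
  obtain ⟨k1, k2, k3, y, hk, hy1, hy2, hy3⟩ := main
  have hA : ∀ v, a v = (a v + d v) / 2 + y v * k1 := fun v => by linarith [hy1 v]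
  have hDD : ∀ v, d v = (a v + d v) / 2 - y v * k1 := fun v => by linarith [hy1 v]
  refine ⟨k1, k2, k3, fun v => (a v + d v) / 2, y, hA, hDD, hy2, hy3, ?_, ?_⟩
  · intro v w
    have e1 := ha v w
    have e2 := hd v w
    have p1 := hy1 v
    have p2 := hy1 w
    have q : a v * a w + d v * d w
      = 2 * ((a v + d v) / 2 * ((a w + d w) / 2)) + 2 * ((a v - d v) / 2 * ((a w - d w) / 2)) := by
      ring
    rw [p1, p2] at q
    rw [hy2 v, hy3 w] at e1
    rw [hy3 v, hy2 w] at e2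
    linarith
  · intro v w
    have p1 := hy1 v
    have p2 := hy1 w
    rcases hk with h | h | h
    · apply mul_right_cancel₀ h
      rw [← hy1 (v + w), ha, hd]
      rw [hy2 v, hy3 w, hy3 v, hy2 w]
      have : (a v * a w - d v * d w) / 2
        = (a v + d v) / 2 * ((a w - d w) / 2) + (a v - d v) / 2 * ((a w + d w) / 2) := by ring
      rw [p1, p2] at this
      linarith
    · apply mul_right_cancel₀ h
      rw [← hy2 (v + w), hb, hA v, hDD w, hy2 v, hy2 w]
      ring
    · apply mul_right_cancel₀ h
      rw [← hy3 (v + w), hc, hA w, hDD v, hy3 v, hy3 w]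
      ring

lemma aux_core (a b c d e : ℤ × ℤ → ℝ)
    (ha : ∀ v w, a (v + w) = a v * a w + b v * c w)
    (hb : ∀ v w, b (v + w) = a v * b w + b v * d w)
    (hc : ∀ v w, c (v + w) = c v * a w + d v * c w)
    (hd : ∀ v w, d (v + w) = c v * b w + d v * d w)
    (he : ∀ v w, e (v + w) = e v * e w)
    (hdet : ∀ v, (a v * d v - b v * c v) * e v = 1) :
    ∃ C : ℝ, ∃ γ : ℕ → ℤ × ℤ, Function.Injective γ ∧ ∀ n,
      a (γ n) ^ 2 + b (γ n) ^ 2 + c (γ n) ^ 2 + d (γ n) ^ 2 + e (γ n) ^ 2 ≤ C * |e (- γ n)| := by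
  obtain ⟨k1, k2, k3, x, y, hxa, hxd, hxb, hxc, hx, hy⟩ := aux_block a b c d ha hb hc hd
  have hDe : ∀ v, (x v ^ 2 - (k1 ^ 2 + k2 * k3) * y v ^ 2) * e v = 1 := fun v => by
    rw [← hdet v, hxa, hxd, hxb, hxc]; ring
  have he0 : ∀ v, e v ≠ 0 := fun v h => by have := hDe v; rw [h] at this; simp at this
  have hD0 : ∀ v, (x v ^ 2 - (k1 ^ 2 + k2 * k3) * y v ^ 2) ≠ 0 := fun v h => by
    have := hDe v; rw [h] at this; simp at this
  have e0 : e 0 = 1 := by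
    have := he 0 0
    rw [add_zero] at this
    exact mul_left_cancel₀ (he0 0) (by linarith)
  have hen : ∀ v, e v * e (-v) = 1 := fun v => by rw [← he, add_neg_cancel, e0]
  have hDn : ∀ v, x v ^ 2 - (k1 ^ 2 + k2 * k3) * y v ^ 2 = e (-v) := fun v =>
    mul_right_cancel₀ (he0 v) (by rw [hDe, mul_comm, hen])
  obtain ⟨φ, hφ, hC⟩ := aux_key _ x y hx hy hD0
  obtain ⟨c0, v, hv, hvb⟩ := aux_dirichlet φ hφ
  obtain ⟨C, hC⟩ := hC c0
  have φ0 : φ 0 = 0 := by have := hφ 0 0; rw [add_zero] at this; linarith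
  have φn : ∀ v, φ (-v) = - φ v := fun v => by
    have := hφ v (-v); rw [add_neg_cancel, φ0] at this; linarith
  have hs : ∀ n, ∃ w, (w = v n ∨ w = - v n) ∧ 1 ≤ |e (-w)| ∧ |φ w| ≤ c0 := by
    intro n
    by_cases h : 1 ≤ |e (- v n)|
    · exact ⟨v n, Or.inl rfl, h, hvb n⟩
    · refine ⟨- v n, Or.inr rfl, ?_, by rw [φn, abs_neg]; exact hvb n⟩
      rw [neg_neg]
      have := congrArg abs (hen (v n))
      rw [abs_mul, abs_one] at this
      push Not at h
      nlinarith [abs_nonneg (e (v n)), abs_nonneg (e (-v n))]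
  choose γ h1 h2 h3 using hs
  refine ⟨(2 + 2 * k1 ^ 2 + k2 ^ 2 + k3 ^ 2) * C + 1, γ, ?_, ?_⟩
  · intro n m h
    apply hv
    have a1 := h1 n
    have a2 := h1 m
    rw [h] at a1
    rcases a1 with a1 | a1 <;> rcases a2 with a2 | a2
    · left; rw [← a1, a2]
    · right; rw [← a1, a2]
    · right; rw [← a2, a1, neg_neg]
    · left; rw [a1] at a2; exact neg_injective a2
  · intro n
    have b1 := hC _ (h3 n)
    rw [hDn] at b1
    have b2 := h2 n
    have b3 : e (γ n) ^ 2 ≤ |e (-γ n)| := by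
      have := congrArg abs (hen (γ n))
      rw [abs_mul, abs_one] at this
      rw [← sq_abs]
      have : |e (γ n)| ≤ 1 := by nlinarith [abs_nonneg (e (γ n))]
      nlinarith [abs_nonneg (e (γ n))]
    have b4 := mul_le_mul_of_nonneg_left b1 (by positivity : 0 ≤ 2 + 2 * k1 ^ 2 + k2 ^ 2 + k3 ^ 2)
    rw [hxa, hxb, hxc, hxd]
    have b5 : (x (γ n) + y (γ n) * k1) ^ 2 + (y (γ n) * k2) ^ 2 + (y (γ n) * k3) ^ 2
        + (x (γ n) - y (γ n) * k1) ^ 2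
        ≤ (2 + 2 * k1 ^ 2 + k2 ^ 2 + k3 ^ 2) * (x (γ n) ^ 2 + y (γ n) ^ 2) := by
      have : (2 + 2 * k1 ^ 2 + k2 ^ 2 + k3 ^ 2) * (x (γ n) ^ 2 + y (γ n) ^ 2)
        = (x (γ n) + y (γ n) * k1) ^ 2 + (y (γ n) * k2) ^ 2 + (y (γ n) * k3) ^ 2
        + (x (γ n) - y (γ n) * k1) ^ 2
          + ((2 * k1 ^ 2 + k2 ^ 2 + k3 ^ 2) * x (γ n) ^ 2 + 2 * y (γ n) ^ 2) := by ring
      rw [this]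
      have : 0 ≤ ((2 * k1 ^ 2 + k2 ^ 2 + k3 ^ 2) * x (γ n) ^ 2 + 2 * y (γ n) ^ 2) := by positivity
      linarith
    linarith

lemma frob_nonneg (A : Matrix (Fin 3) (Fin 3) ℝ) : 0 ≤ frobNorm A := Real.sqrt_nonneg _

lemma frob_sq_s5 (A : Matrix (Fin 3) (Fin 3) ℝ) : frobNorm A ^ 2 = ∑ i, ∑ j, (A i j) ^ 2 :=
  Real.sq_sqrt (Finset.sum_nonneg fun _ _ => Finset.sum_nonneg fun _ _ => sq_nonneg _)

lemma frob_mul (A B : Matrix (Fin 3) (Fin 3) ℝ) :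
    frobNorm (A * B) ≤ frobNorm A * frobNorm B := by
  refine (pow_le_pow_iff_left₀ (frob_nonneg _) (mul_nonneg (frob_nonneg _) (frob_nonneg _)) two_ne_zero).1 ?_
  rw [mul_pow, frob_sq_s5, frob_sq_s5, frob_sq_s5]
  rw [Finset.sum_mul]
  apply Finset.sum_le_sum
  intro i _
  rw [Finset.sum_comm (f := fun i j => B i j ^ 2), Finset.mul_sum]
  apply Finset.sum_le_sum
  intro j _
  rw [Matrix.mul_apply]
  exact Finset.sum_mul_sq_le_sq_mul_sq _ _ _

lemma frob_entry (A : Matrix (Fin 3) (Fin 3) ℝ) (i j : Fin 3) : |A i j| ≤ frobNorm A := by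
  apply Real.abs_le_sqrt
  calc A i j ^ 2 ≤ ∑ j, A i j ^ 2 :=
        Finset.single_le_sum (f := fun j => A i j ^ 2) (fun _ _ => sq_nonneg _) (Finset.mem_univ j)
    _ ≤ _ := Finset.single_le_sum (f := fun i => ∑ j, A i j ^ 2)
      (fun _ _ => Finset.sum_nonneg fun _ _ => sq_nonneg _) (Finset.mem_univ i)

/-- The image of a regular homomorphism ℤ² → SL(3,ℝ) is unipotent. -/
theorem image_of_regular_Z2_is_unipotent
    (ρ : Multiplicative (ℤ × ℤ) →* Matrix.SpecialLinearGroup (Fin 3) ℝ)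
    (hreg : IsRegularHom ρ) :
    ∀ v : Multiplicative (ℤ × ℤ),
      ((ρ v : Matrix (Fin 3) (Fin 3) ℝ) - 1) ^ 3 = 0 := by
  intro v0
  by_contra hne
  obtain ⟨l, hl0, hl1⟩ := aux_simple _ (ρ v0).2 hne
  set A : Matrix (Fin 3) (Fin 3) ℝ :=
    (ρ v0 : Matrix (Fin 3) (Fin 3) ℝ) - l • (1 : Matrix (Fin 3) (Fin 3) ℝ) with hA
  have hF0 : A.adjugate.adjugate = 0 := by
    rw [Matrix.adjugate_adjugate _ (by simp), hl0]; simp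
  obtain ⟨g, hg, hFg⟩ := aux_conj _ hF0 hl1
  set t := A.adjugate.trace
  set D : Matrix (Fin 3) (Fin 3) ℝ := !![0,0,0;0,0,0;0,0,t] with hDdef
  have hgu : IsUnit g.det := isUnit_iff_ne_zero.2 hg
  have hg1 : g * g⁻¹ = 1 := Matrix.mul_nonsing_inv _ hgu
  have hg2 : g⁻¹ * g = 1 := Matrix.nonsing_inv_mul _ hgu
  let N : ℤ × ℤ → Matrix (Fin 3) (Fin 3) ℝ := fun v => (ρ (Multiplicative.ofAdd v) : Matrix (Fin 3) (Fin 3) ℝ)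
  have hNmul : ∀ v w, N (v + w) = N v * N w := fun v w => by
    simp only [N, ofAdd_add, map_mul, Matrix.SpecialLinearGroup.coe_mul]
  have hN0 : N 0 = 1 := by simp [N]
  have hNdet : ∀ v, (N v).det = 1 := fun v => (ρ (Multiplicative.ofAdd v)).2
  have hNA : ∀ v, N v * A = A * N v := fun v => by
    have : N v * N (Multiplicative.toAdd v0) = N (Multiplicative.toAdd v0) * N v := by
      rw [← hNmul, ← hNmul, add_comm]
    have h' : A = N (Multiplicative.toAdd v0) - l • (1 : Matrix (Fin 3) (Fin 3) ℝ) := rfl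
    rw [h', mul_sub, sub_mul, this]; simp
  have hNF' : ∀ v, (N v).adjugate * A.adjugate = A.adjugate * (N v).adjugate := fun v => by
    rw [← Matrix.adjugate_mul_distrib, ← Matrix.adjugate_mul_distrib, hNA]
  have hNF : ∀ v, N v * A.adjugate = A.adjugate * N v := fun v => by
    have h1 : N v * (N v).adjugate = 1 := by rw [Matrix.mul_adjugate, hNdet, one_smul]
    have h2 : (N v).adjugate * N v = 1 := by rw [Matrix.adjugate_mul, hNdet, one_smul]
    calc N v * A.adjugate = N v * (A.adjugate * (N v).adjugate) * N v := by
          rw [mul_assoc, mul_assoc, h2, mul_one]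
      _ = A.adjugate * N v := by
          rw [← hNF', ← mul_assoc (N v), h1, one_mul]
  let R : ℤ × ℤ → Matrix (Fin 3) (Fin 3) ℝ := fun v => g⁻¹ * N v * g
  have hRmul : ∀ v w, R (v + w) = R v * R w := fun v w => by
    simp only [R]
    rw [hNmul]
    calc g⁻¹ * (N v * N w) * g = g⁻¹ * N v * 1 * N w * g := by simp only [mul_assoc, one_mul]
      _ = _ := by rw [← hg1]; simp only [mul_assoc]
  have hRdet : ∀ v, (R v).det = 1 := fun v => by
    simp only [R]
    rw [Matrix.det_mul, Matrix.det_mul, hNdet, mul_one, ← Matrix.det_mul, hg2, Matrix.det_one]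
  have hDF : D = g⁻¹ * A.adjugate * g := by
    rw [mul_assoc, hFg, ← mul_assoc, hg2, one_mul]
  have hRD : ∀ v, R v * D = D * R v := fun v => by
    rw [hDF]
    simp only [R]
    calc g⁻¹ * N v * g * (g⁻¹ * A.adjugate * g) = g⁻¹ * N v * (g * g⁻¹) * A.adjugate * g := by
          simp only [mul_assoc]
      _ = g⁻¹ * (N v * A.adjugate) * g := by rw [hg1]; simp only [mul_assoc, one_mul]
      _ = g⁻¹ * A.adjugate * (g * g⁻¹) * N v * g := by
          rw [hNF, hg1]; simp only [mul_assoc, one_mul]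
      _ = _ := by simp only [mul_assoc]
  have z02 : ∀ v, R v 0 2 = 0 := fun v => by
    have := congrFun (congrFun (hRD v) 0) 2
    simpa [hDdef, Matrix.mul_apply, Fin.sum_univ_three, hl1] using this
  have z12 : ∀ v, R v 1 2 = 0 := fun v => by
    have := congrFun (congrFun (hRD v) 1) 2
    simpa [hDdef, Matrix.mul_apply, Fin.sum_univ_three, hl1] using this
  have z20 : ∀ v, R v 2 0 = 0 := fun v => by
    have := congrFun (congrFun (hRD v) 2) 0
    simpa [hDdef, Matrix.mul_apply, Fin.sum_univ_three, hl1] using this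
  have z21 : ∀ v, R v 2 1 = 0 := fun v => by
    have := congrFun (congrFun (hRD v) 2) 1
    simpa [hDdef, Matrix.mul_apply, Fin.sum_univ_three, hl1] using this
  obtain ⟨C, γ, hγ, hb⟩ := aux_core (fun v => R v 0 0) (fun v => R v 0 1) (fun v => R v 1 0)
    (fun v => R v 1 1) (fun v => R v 2 2)
    (fun v w => by simp [hRmul, Matrix.mul_apply, Fin.sum_univ_three, z02])
    (fun v w => by simp [hRmul, Matrix.mul_apply, Fin.sum_univ_three, z02])
    (fun v w => by simp [hRmul, Matrix.mul_apply, Fin.sum_univ_three, z12])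
    (fun v w => by simp [hRmul, Matrix.mul_apply, Fin.sum_univ_three, z12])
    (fun v w => by simp [hRmul, Matrix.mul_apply, Fin.sum_univ_three, z20, z21])
    (fun v => by
      have := hRdet v
      rw [Matrix.det_fin_three] at this
      simp only [z02, z12, z20, z21] at this
      linarith)
  have hreg' := hreg (fun n => Multiplicative.ofAdd (γ n))
    (fun n m h => hγ (Multiplicative.ofAdd.injective h))
  unfold IsRegularSeq at hreg'
  set G := frobNorm g * frobNorm g⁻¹ with hG
  have hG0 : 0 ≤ G := mul_nonneg (frob_nonneg _) (frob_nonneg _)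
  have hbound : ∀ n, (frobNorm ↑(ρ (Multiplicative.ofAdd (γ n)))) ^ 2 /
      frobNorm ↑((ρ (Multiplicative.ofAdd (γ n)))⁻¹) ≤ G ^ 2 * |C| * G := by
    intro n
    have hinv : ((ρ (Multiplicative.ofAdd (γ n)))⁻¹ : Matrix.SpecialLinearGroup (Fin 3) ℝ)
        = ρ (Multiplicative.ofAdd (-γ n)) := by
      rw [ofAdd_neg, map_inv]
    rw [hinv]
    change frobNorm (N (γ n)) ^ 2 / frobNorm (N (-γ n)) ≤ _
    have i1 : frobNorm (N (γ n)) ≤ G * frobNorm (R (γ n)) := by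
      have : N (γ n) = g * R (γ n) * g⁻¹ := by
        simp only [R]
        calc N (γ n) = 1 * N (γ n) * 1 := by simp
          _ = _ := by rw [← hg1]; simp only [mul_assoc]
      rw [this]
      calc _ ≤ frobNorm (g * R (γ n)) * frobNorm g⁻¹ := frob_mul _ _
        _ ≤ frobNorm g * frobNorm (R (γ n)) * frobNorm g⁻¹ :=
          mul_le_mul_of_nonneg_right (frob_mul _ _) (frob_nonneg _)
        _ = _ := by rw [hG]; ring
    have i2 : frobNorm (R (-γ n)) ≤ G * frobNorm (N (-γ n)) := by
      calc _ ≤ frobNorm (g⁻¹ * N (-γ n)) * frobNorm g := frob_mul _ _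
        _ ≤ frobNorm g⁻¹ * frobNorm (N (-γ n)) * frobNorm g :=
          mul_le_mul_of_nonneg_right (frob_mul _ _) (frob_nonneg _)
        _ = _ := by rw [hG]; ring
    have i3 : frobNorm (R (γ n)) ^ 2 ≤ C * |R (-γ n) 2 2| := by
      refine le_trans (le_of_eq ?_) (hb n)
      rw [frob_sq_s5]
      simp [Fin.sum_univ_three, z02, z12, z20, z21]
      ring
    have i4 : frobNorm (R (γ n)) ^ 2 ≤ |C| * (G * frobNorm (N (-γ n))) := by
      calc _ ≤ _ := i3
        _ ≤ |C| * |R (-γ n) 2 2| := mul_le_mul_of_nonneg_right (le_abs_self _) (abs_nonneg _)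
        _ ≤ _ := mul_le_mul_of_nonneg_left ((frob_entry _ 2 2).trans i2) (abs_nonneg _)
    apply div_le_of_le_mul₀ (frob_nonneg _) (by positivity)
    calc frobNorm (N (γ n)) ^ 2 ≤ (G * frobNorm (R (γ n))) ^ 2 :=
          pow_le_pow_left₀ (frob_nonneg _) i1 2
      _ = G ^ 2 * frobNorm (R (γ n)) ^ 2 := by ring
      _ ≤ G ^ 2 * (|C| * (G * frobNorm (N (-γ n)))) :=
          mul_le_mul_of_nonneg_left i4 (by positivity)
      _ = _ := by ring
  obtain ⟨n, hn⟩ := (hreg'.eventually (eventually_gt_atTop (G ^ 2 * |C| * G))).exists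
  exact absurd (hbound n) (not_le.2 hn)
end
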